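/- There exist constants k# and C, depending only on m and n, such that the following holds. Let E ⊂ ℝⁿ be finite, let f : E → [0,∞), and let M₀ > 0. Suppose that for each S ⊆ E with #(S) ≤ k# there exists a family (P^x)_{x∈S} of polynomials of degree at most m−1 such that P^x ∈ Γ'_f(x, M₀) for all x ∈ S, and |∂^β(P^x − P^y)(x)| ≤ M₀|x − y|^{m−|β|} for all x, y ∈ S and |β| ≤ m−1. Then there exists F ∈ C^{m-1,1}(ℝⁿ) such that ‖F‖_{C^{m-1,1}(ℝⁿ)} ≤ CM₀, F ≥ 0 everywhere on ℝⁿ, and F = f on E. -/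

import Mathlib

open scoped BigOperators

noncomputable section

abbrev Euc (n : ℕ) : Type := EuclideanSpace ℝ (Fin n)
abbrev MPoly (n : ℕ) : Type := MvPolynomial (Fin n) ℝ

/-- Partial derivative in the `i`-th coordinate direction. -/
noncomputable def pD {n : ℕ} (i : Fin n) (F : Euc n → ℝ) : Euc n → ℝ :=
  fun x => fderiv ℝ F x (EuclideanSpace.single i (1 : ℝ))

/-- The multi-index partial derivative `∂^α F`. -/
noncomputable def mD {n : ℕ} (α : Fin n → ℕ) (F : Euc n → ℝ) : Euc n → ℝ :=
  (((List.finRange n).flatMap fun i => List.replicate (α i) i)).foldr pD F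

/-- Partial derivative within a set. -/
noncomputable def pDW {n : ℕ} (s : Set (Euc n)) (i : Fin n) (F : Euc n → ℝ) : Euc n → ℝ :=
  fun x => fderivWithin ℝ F s x (EuclideanSpace.single i (1 : ℝ))

/-- Multi-index partial derivative within a set. -/
noncomputable def mDW {n : ℕ} (s : Set (Euc n)) (α : Fin n → ℕ) (F : Euc n → ℝ) : Euc n → ℝ :=
  (((List.finRange n).flatMap fun i => List.replicate (α i) i)).foldr (pDW s) F

/-- The order `|α|` of a multi-index. -/
def deg {n : ℕ} (α : Fin n → ℕ) : ℕ := ∑ i, α i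

/-- Evaluation of an `n`-variable polynomial at a point of `ℝⁿ`. -/
noncomputable def peval {n : ℕ} (P : MPoly n) (x : Euc n) : ℝ :=
  MvPolynomial.eval (fun i => x i) P

/-- `F ∈ C^m(ℝⁿ)` with `‖F‖_{C^m(ℝⁿ)} ≤ M`. -/
def CmNormLe (m n : ℕ) (F : Euc n → ℝ) (M : ℝ) : Prop :=
  ContDiff ℝ (m : ℕ∞) F ∧ ∀ α : Fin n → ℕ, deg α ≤ m → ∀ x : Euc n, |mD α F x| ≤ M

/-- `F ∈ C^{m-1,1}(ℝⁿ)` with `‖F‖_{C^{m-1,1}(ℝⁿ)} ≤ M`. -/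
def CmLipNormLe (m n : ℕ) (F : Euc n → ℝ) (M : ℝ) : Prop :=
  ContDiff ℝ ((m - 1 : ℕ) : ℕ∞) F ∧
  (∀ α : Fin n → ℕ, deg α ≤ m - 1 → ∀ x : Euc n, |mD α F x| ≤ M) ∧
  (∀ α : Fin n → ℕ, deg α = m - 1 → ∀ i : Fin n, ∀ x : Euc n, ∀ t : ℝ,
    |mD α F (x + t • EuclideanSpace.single i (1 : ℝ)) - mD α F x| ≤ M * |t|)

/-- `J_x(F) = P`, i.e. `P` is the `(m-1)`-st order Taylor polynomial of `F` at `x`. -/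
def IsJetAt (m n : ℕ) (F : Euc n → ℝ) (x : Euc n) (P : MPoly n) : Prop :=
  P.totalDegree ≤ m - 1 ∧
  ∀ α : Fin n → ℕ, deg α ≤ m - 1 → mD α (peval P) x = mD α F x

/-- `J_x^+(F) = P`, i.e. `P` is the `m`-th order Taylor polynomial of `F` at `x`. -/
def IsJetPlusAt (m n : ℕ) (F : Euc n → ℝ) (x : Euc n) (P : MPoly n) : Prop :=
  P.totalDegree ≤ m ∧
  ∀ α : Fin n → ℕ, deg α ≤ m → mD α (peval P) x = mD α F x

/-- Truncation of a polynomial: keep the monomials of total degree `≤ d`. -/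
noncomputable def truncLE {n : ℕ} (d : ℕ) (P : MPoly n) : MPoly n :=
  ∑ s ∈ P.support.filter (fun s => (s.sum fun _ e => e) ≤ d),
    MvPolynomial.monomial s (P.coeff s)

/-- Substitution `y ↦ y + v` in a polynomial. -/
noncomputable def polyShift {n : ℕ} (v : Fin n → ℝ) (P : MPoly n) : MPoly n :=
  MvPolynomial.aeval (fun i => (MvPolynomial.X i + MvPolynomial.C (v i) : MPoly n)) P

/-- The `(m-1)`-st order Taylor polynomial of a polynomial `P` at `x`. -/
noncomputable def jetTrunc (m n : ℕ) (x : Euc n) (P : MPoly n) : MPoly n :=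
  polyShift (fun i => -(x i)) (truncLE (m - 1) (polyShift (fun i => x i) P))

/-- Multiplication of `(m-1)`-jets at `x`: `P ⊙_x Q = J_x(PQ)`. -/
noncomputable def jmul (m n : ℕ) (x : Euc n) (P Q : MPoly n) : MPoly n :=
  jetTrunc m n x (P * Q)

/-- `Γ*(x,M)`. -/
def GammaStar (m n : ℕ) (x : Euc n) (M : ℝ) : Set (MPoly n) :=
  {P | ∃ F : Euc n → ℝ, CmNormLe m n F M ∧ (∀ y, 0 ≤ F y) ∧ IsJetAt m n F x P}

/-- `Γ_f(x,M)`. -/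
def GammaF (m n : ℕ) (f : Euc n → ℝ) (x : Euc n) (M : ℝ) : Set (MPoly n) :=
  {P ∈ GammaStar m n x M | peval P x = f x}

/-- `Γ'*(x,M)` (the `C^{m-1,1}` version). -/
def GammaStar' (m n : ℕ) (x : Euc n) (M : ℝ) : Set (MPoly n) :=
  {P | ∃ F : Euc n → ℝ, CmLipNormLe m n F M ∧ (∀ y, 0 ≤ F y) ∧ IsJetAt m n F x P}

/-- `Γ'_f(x,M)`. -/
def GammaF' (m n : ℕ) (f : Euc n → ℝ) (x : Euc n) (M : ℝ) : Set (MPoly n) :=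
  {P ∈ GammaStar' m n x M | peval P x = f x}

/-- `Γ₀⁺`. -/
def Gamma0plus (m n : ℕ) : Set (MPoly n) :=
  {P | P.totalDegree ≤ m ∧
    (∀ β : Fin n → ℕ, deg β ≤ m → |mD β (peval P) 0| ≤ 1) ∧
    (∀ x : Euc n, 0 ≤ peval P x + ‖x‖ ^ m) ∧
    (∀ ε : ℝ, 0 < ε → ∃ δ : ℝ, 0 < δ ∧ ∀ x : Euc n, ‖x‖ ≤ δ → 0 ≤ peval P x + ε * ‖x‖ ^ m)}

/-- `Γ̃₀'`. -/
def GammaTilde0' (m n : ℕ) : Set (MPoly n) :=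
  {P | P.totalDegree ≤ m - 1 ∧
    (∀ β : Fin n → ℕ, deg β ≤ m - 1 → |mD β (peval P) 0| ≤ 1) ∧
    ∀ x : Euc n, 0 ≤ peval P x + ‖x‖ ^ m}

/-- The closed axis-parallel cube with center `c` and sidelength `δ`. -/
def cube {n : ℕ} (c : Euc n) (δ : ℝ) : Set (Euc n) :=
  {y | ∀ i, |y i - c i| ≤ δ / 2}

/-- `F ∈ C^{m-1,1}(Q)` with `‖F‖_{C^{m-1,1}(Q)} ≤ M`, for the cube `Q` of center `c`,
sidelength `δ`. -/
def CmLipOnCubeLe (m n : ℕ) (c : Euc n) (δ : ℝ) (F : Euc n → ℝ) (M : ℝ) : Prop :=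
  ContDiffOn ℝ ((m - 1 : ℕ) : ℕ∞) F (cube c δ) ∧
  (∀ α : Fin n → ℕ, deg α ≤ m - 1 → ∀ x ∈ cube c δ, |mDW (cube c δ) α F x| ≤ M) ∧
  (∀ α : Fin n → ℕ, deg α = m - 1 → ∀ i : Fin n, ∀ x ∈ cube c δ, ∀ t : ℝ,
    x + t • EuclideanSpace.single i (1 : ℝ) ∈ cube c δ →
    |mDW (cube c δ) α F (x + t • EuclideanSpace.single i (1 : ℝ)) - mDW (cube c δ) α F x|
      ≤ M * |t|)


namespace FP

/-- Multi-indices of order `< m`. -/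
abbrev Ix (m n : ℕ) : Type := {α : Fin n → ℕ // deg α < m}

lemma le_deg {n : ℕ} (α : Fin n → ℕ) (i : Fin n) : α i ≤ deg α :=
  Finset.single_le_sum (f := α) (fun _ _ => Nat.zero_le _) (Finset.mem_univ i)

instance instFintypeIx (m n : ℕ) : Fintype (Ix m n) :=
  Fintype.ofInjective
    (fun α : Ix m n => (fun i => (⟨α.1 i, lt_of_le_of_lt (le_deg α.1 i) α.2⟩ : Fin m)))
    (by
      intro a b h
      apply Subtype.ext
      funext i
      have := congrFun h i
      simpa using this)

/-- coefficient vectors -/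
abbrev V (m n : ℕ) : Type := Ix m n → ℝ

variable {m n : ℕ}

/-- monomial -/
def mono (α : Fin n → ℕ) (h : Euc n) : ℝ := ∏ i, h i ^ α i

lemma abs_coord_le (h : Euc n) (i : Fin n) : |h i| ≤ ‖h‖ := by
  simpa using PiLp.norm_apply_le h i

lemma abs_mono_le (α : Fin n → ℕ) (h : Euc n) : |mono α h| ≤ ‖h‖ ^ deg α := by
  unfold mono deg
  rw [Finset.abs_prod, ← Finset.prod_pow_eq_pow_sum]
  refine Finset.prod_le_prod (fun i _ => abs_nonneg _) (fun i _ => ?_)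
  rw [abs_pow]
  exact pow_le_pow_left₀ (abs_nonneg _) (abs_coord_le h i) _

lemma mono_smul (α : Fin n → ℕ) (t : ℝ) (h : Euc n) : mono α (t • h) = t ^ deg α * mono α h := by
  unfold mono deg
  rw [← Finset.prod_pow_eq_pow_sum, ← Finset.prod_mul_distrib]
  refine Finset.prod_congr rfl fun i _ => ?_
  simp [mul_pow]

lemma mono_add_idx (α β : Fin n → ℕ) (h : Euc n) : mono (α + β) h = mono α h * mono β h := by
  unfold mono
  rw [← Finset.prod_mul_distrib]
  refine Finset.prod_congr rfl fun i _ => by simp [pow_add]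

lemma deg_add (α β : Fin n → ℕ) : deg (α + β) = deg α + deg β := by
  simp [deg, Finset.sum_add_distrib]

lemma continuous_mono (α : Fin n → ℕ) : Continuous (mono (n := n) α) := by
  unfold mono
  fun_prop

/-- evaluation of a coefficient vector -/
def pl (c : V m n) (h : Euc n) : ℝ := ∑ α, c α * mono α.1 h

lemma pl_add (c d : V m n) (h : Euc n) : pl (c + d) h = pl c h + pl d h := by
  simp [pl, add_mul, Finset.sum_add_distrib]
lemma pl_sub (c d : V m n) (h : Euc n) : pl (c - d) h = pl c h - pl d h := by
  simp [pl, sub_mul, Finset.sum_sub_distrib]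
lemma pl_smul (t : ℝ) (c : V m n) (h : Euc n) : pl (t • c) h = t * pl c h := by
  simp [pl, Finset.mul_sum, mul_assoc]
lemma pl_zero (h : Euc n) : pl (0 : V m n) h = 0 := by simp [pl]
lemma continuous_pl (c : V m n) : Continuous (pl c) := by
  unfold pl
  exact continuous_finsetSum _ fun α _ => continuous_const.mul (continuous_mono _)

/-- binomial coefficient of the shift -/
def bc (α β : Fin n → ℕ) (h : Euc n) : ℝ := ∏ i, ((β i).choose (α i) : ℝ) * h i ^ (β i - α i)

lemma bc_eq_zero {α β : Fin n → ℕ} (h : Euc n) (hab : ¬ α ≤ β) : bc α β h = 0 := by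
  simp only [Pi.le_def, not_forall, not_le] at hab
  obtain ⟨i, hi⟩ := hab
  exact Finset.prod_eq_zero (Finset.mem_univ i) (by simp [Nat.choose_eq_zero_of_lt hi])

lemma bc_self (α : Fin n → ℕ) (h : Euc n) : bc α α h = 1 := by simp [bc]

lemma deg_mono {α β : Fin n → ℕ} (h : α ≤ β) : deg α ≤ deg β :=
  Finset.sum_le_sum fun i _ => h i

lemma deg_sub {α β : Fin n → ℕ} (h : α ≤ β) : ∑ i, (β i - α i) = deg β - deg α := by
  have : ∑ i, (β i - α i) + deg α = deg β := by
    rw [deg, deg, ← Finset.sum_add_distrib]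
    exact Finset.sum_congr rfl fun i _ => Nat.sub_add_cancel (h i)
  omega

lemma deg_lt_of_ne {α β : Fin n → ℕ} (h : α ≤ β) (hne : α ≠ β) : deg α < deg β := by
  obtain ⟨i, hi⟩ : ∃ i, α i ≠ β i := by
    by_contra! hh
    exact hne (funext hh)
  exact Finset.sum_lt_sum (fun i _ => h i) ⟨i, Finset.mem_univ i, lt_of_le_of_ne (h i) hi⟩

lemma abs_bc_le {α β : Fin n → ℕ} (h : Euc n) (hab : α ≤ β) :
    |bc α β h| ≤ 2 ^ deg β * ‖h‖ ^ (deg β - deg α) := by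
  unfold bc
  rw [Finset.abs_prod, ← deg_sub hab, ← Finset.prod_pow_eq_pow_sum, deg,
    ← Finset.prod_pow_eq_pow_sum, ← Finset.prod_mul_distrib]
  refine Finset.prod_le_prod (fun i _ => abs_nonneg _) (fun i _ => ?_)
  rw [abs_mul, abs_pow, Nat.abs_cast]
  refine mul_le_mul ?_ (pow_le_pow_left₀ (abs_nonneg _) (abs_coord_le h i) _) (by positivity)
    (by positivity)
  exact_mod_cast Nat.choose_le_two_pow _ _

lemma mono_add (β : Ix m n) (h k : Euc n) :
    mono β.1 (h + k) = ∑ α : Ix m n, bc α.1 β.1 h * mono α.1 k := by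
  have h1 : mono β.1 (h + k) = ∑ p ∈ Fintype.piFinset (fun i => Finset.range (β.1 i + 1)),
      bc p β.1 h * mono p k := by
    unfold mono
    have : ∀ i, (h + k) i ^ β.1 i = ∑ j ∈ Finset.range (β.1 i + 1),
        (((β.1 i).choose j : ℝ) * h i ^ (β.1 i - j)) * k i ^ j := by
      intro i
      rw [PiLp.add_apply, add_comm, add_pow]
      exact Finset.sum_congr rfl fun j _ => by ring
    simp_rw [this]
    rw [Finset.prod_univ_sum]
    refine Finset.sum_congr rfl fun p _ => ?_
    rw [Finset.prod_mul_distrib]; rfl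
  rw [h1]
  symm
  refine Finset.sum_bij_ne_zero (fun α _ _ => α.1) ?_ ?_ ?_ ?_
  · intro α _ hne
    rw [Fintype.mem_piFinset]
    intro i
    have : α.1 ≤ β.1 := by
      by_contra hh
      exact hne (by rw [bc_eq_zero h hh, zero_mul])
    have := this i
    simp; omega
  · intro a _ _ b _ _ hab
    exact Subtype.ext hab
  · intro p hp hne
    rw [Fintype.mem_piFinset] at hp
    have : p ≤ β.1 := fun i => by
      have := hp i
      simp at this; omega
    exact ⟨⟨p, lt_of_le_of_lt (deg_mono this) β.2⟩, Finset.mem_univ _, hne, rfl⟩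
  · intros; rfl

/-- recentering -/
def sh (h : Euc n) : V m n →ₗ[ℝ] V m n where
  toFun c := fun α => ∑ β, bc α.1 β.1 h * c β
  map_add' c d := by
    funext α; simp [mul_add, Finset.sum_add_distrib]
  map_smul' t c := by
    funext α; simp only [Pi.smul_apply, smul_eq_mul, Finset.mul_sum, RingHom.id_apply]
    exact Finset.sum_congr rfl fun _ _ => by ring

lemma sh_apply (h : Euc n) (c : V m n) (α : Ix m n) :
    sh h c α = ∑ β, bc α.1 β.1 h * c β := rfl

lemma pl_sh (h k : Euc n) (c : V m n) : pl (sh h c) k = pl c (h + k) := by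
  unfold pl
  simp_rw [mono_add, sh_apply, Finset.sum_mul, Finset.mul_sum]
  rw [Finset.sum_comm]
  exact Finset.sum_congr rfl fun _ _ => Finset.sum_congr rfl fun _ _ => by ring

lemma pl_sh_sub (x y : Euc n) (c : V m n) : pl (sh x c) (y - x) = pl c y := by
  rw [pl_sh]; congr 1; abel

/-- MvPolynomial attached to a coefficient vector -/
def toMv (c : V m n) : MPoly n :=
  ∑ α : Ix m n, MvPolynomial.monomial (Finsupp.equivFunOnFinite.symm α.1) (c α)

lemma eval_monomial' (α : Fin n → ℕ) (t : ℝ) (h : Euc n) :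
    MvPolynomial.eval (fun i => h i) (MvPolynomial.monomial (Finsupp.equivFunOnFinite.symm α) t)
      = t * mono α h := by
  rw [MvPolynomial.eval_monomial, Finsupp.prod_fintype _ _ (by simp)]
  simp [mono]

lemma peval_toMv (c : V m n) : peval (toMv c) = pl c := by
  funext h
  simp only [peval, toMv, map_sum, eval_monomial', pl]

lemma coeff_toMv (c : V m n) (α : Ix m n) :
    (toMv c).coeff (Finsupp.equivFunOnFinite.symm α.1) = c α := by
  rw [toMv, MvPolynomial.coeff_sum, Finset.sum_eq_single α]
  · simp
  · intro b _ hb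
    rw [MvPolynomial.coeff_monomial, if_neg]
    intro h
    exact hb (Subtype.ext (Finsupp.equivFunOnFinite.symm.injective h))
  · simp

lemma pl_eq_zero_of_ball (c : V m n) (r : ℝ) (hr : 0 < r)
    (h : ∀ k : Euc n, ‖k‖ ≤ r → pl c k = 0) : c = 0 := by
  have key : toMv c = 0 := by
    refine MvPolynomial.funext_set (fun _ : Fin n => Set.Icc (0:ℝ) (r / (n + 1)))
      (fun i => Set.Icc_infinite (by positivity)) ?_
    intro v hv
    have : ‖(WithLp.toLp 2 v : Euc n)‖ ≤ r := by
      have h1 : (WithLp.toLp 2 v : Euc n) = ∑ i, EuclideanSpace.single i (v i) := by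
        ext j; simp [Finset.sum_apply, Pi.single_apply]
      rw [h1]
      refine (norm_sum_le _ _).trans ?_
      have : ∀ i ∈ Finset.univ, ‖(EuclideanSpace.single i (v i) : Euc n)‖ ≤ r / (n + 1) := by
        intro i _
        have := hv i (Set.mem_univ i)
        simp only [Set.mem_Icc] at this
        simp [abs_of_nonneg this.1, this.2]
      refine (Finset.sum_le_card_nsmul _ _ _ this).trans ?_
      simp only [Finset.card_univ, Fintype.card_fin, nsmul_eq_mul]
      rw [mul_div_assoc', div_le_iff₀ (by positivity)]
      nlinarith
    have h2 := h _ this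
    rw [← peval_toMv] at h2
    simpa [peval] using h2
  funext α
  rw [← coeff_toMv c α, key]
  simp

lemma pl_inj {c d : V m n} (h : ∀ k : Euc n, pl c k = pl d k) : c = d := by
  have := pl_eq_zero_of_ball (c - d) 1 one_pos (fun k _ => by rw [pl_sub, h k, sub_self])
  exact sub_eq_zero.mp this

lemma sh_sh (h k : Euc n) (c : V m n) : sh k (sh h c) = sh (h + k) c :=
  pl_inj fun l => by rw [pl_sh, pl_sh, pl_sh, add_assoc]

lemma sh_zero (c : V m n) : sh 0 c = c := pl_inj fun l => by rw [pl_sh, zero_add]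

lemma sh_neg_sh (h : Euc n) (c : V m n) : sh (-h) (sh h c) = c := by rw [sh_sh, add_neg_cancel, sh_zero]
lemma sh_sh_neg (h : Euc n) (c : V m n) : sh h (sh (-h) c) = c := by rw [sh_sh, neg_add_cancel, sh_zero]

/-- change of center -/
lemma co_change (x y : Euc n) (p : V m n) : sh y p = sh (y - x) (sh x p) := by
  rw [sh_sh, add_sub_cancel]

/-- scaled norm -/
def nm (δ : ℝ) (c : V m n) : ℝ := ∑ α, |c α| / δ ^ (m - deg α.1)

lemma nm_nonneg {δ : ℝ} (hδ : 0 < δ) (c : V m n) : 0 ≤ nm δ c :=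
  Finset.sum_nonneg fun _ _ => by positivity

lemma nm_add {δ : ℝ} (hδ : 0 < δ) (c d : V m n) : nm δ (c + d) ≤ nm δ c + nm δ d := by
  unfold nm
  rw [← Finset.sum_add_distrib]
  refine Finset.sum_le_sum fun α _ => ?_
  rw [← add_div]
  have := abs_add_le (c α) (d α)
  simp only [Pi.add_apply]; gcongr

lemma nm_smul {δ : ℝ} (t : ℝ) (c : V m n) : nm δ (t • c) = |t| * nm δ c := by
  simp only [nm, Pi.smul_apply, smul_eq_mul, abs_mul, Finset.mul_sum, mul_div_assoc]

lemma nm_neg {δ : ℝ} (c : V m n) : nm δ (-c) = nm δ c := by simp [nm]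

lemma nm_zero {δ : ℝ} : nm δ (0 : V m n) = 0 := by simp [nm]

lemma nm_sub_comm {δ : ℝ} (c d : V m n) : nm δ (c - d) = nm δ (d - c) := by
  rw [← nm_neg, neg_sub]

lemma nm_sub {δ : ℝ} (hδ : 0 < δ) (c d : V m n) : nm δ (c - d) ≤ nm δ c + nm δ d := by
  rw [sub_eq_add_neg, ← nm_neg d]; exact nm_add hδ _ _

lemma nm_tri {δ : ℝ} (hδ : 0 < δ) (c d e : V m n) : nm δ (c - e) ≤ nm δ (c - d) + nm δ (d - e) := by
  have := nm_add hδ (c - d) (d - e)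
  simpa using this

lemma nm_sum {ι : Type*} {δ : ℝ} (hδ : 0 < δ) (s : Finset ι) (c : ι → V m n) :
    nm δ (∑ i ∈ s, c i) ≤ ∑ i ∈ s, nm δ (c i) := by
  classical
  induction s using Finset.induction_on with
  | empty => simp [nm_zero]
  | insert a s ha ih =>
    rw [Finset.sum_insert ha, Finset.sum_insert ha]
    exact (nm_add hδ _ _).trans (by linarith)

lemma coef_le_nm {δ : ℝ} (hδ : 0 < δ) (c : V m n) (α : Ix m n) :
    |c α| ≤ nm δ c * δ ^ (m - deg α.1) := by
  rw [← div_le_iff₀ (by positivity)]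
  exact Finset.single_le_sum (f := fun α : Ix m n => |c α| / δ ^ (m - deg α.1))
    (fun _ _ => by positivity) (Finset.mem_univ α)

lemma nm_le_of_coef {δ B : ℝ} (hδ : 0 < δ) (c : V m n)
    (h : ∀ α : Ix m n, |c α| ≤ B * δ ^ (m - deg α.1)) : nm δ c ≤ Fintype.card (Ix m n) * B := by
  unfold nm
  refine (Finset.sum_le_card_nsmul _ _ B fun α _ => ?_).trans (by simp)
  rw [div_le_iff₀ (by positivity)]; exact h α

/-- (n1) -/
lemma nm_mono {δ δ' : ℝ} (hδ : 0 < δ) (h : δ ≤ δ') (c : V m n) : nm δ' c ≤ (δ / δ') * nm δ c := by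
  have hδ' : 0 < δ' := hδ.trans_le h
  unfold nm
  rw [Finset.mul_sum]
  refine Finset.sum_le_sum fun α _ => ?_
  have h1 : m - deg α.1 ≠ 0 := by have := α.2; omega
  rw [div_mul_div_comm, div_le_div_iff₀ (by positivity) (by positivity)]
  obtain ⟨k, hk⟩ := Nat.exists_eq_succ_of_ne_zero h1
  rw [hk, pow_succ, pow_succ]
  have : δ ^ k ≤ δ' ^ k := pow_le_pow_left₀ hδ.le h _
  calc |c α| * (δ' * (δ ^ k * δ)) = |c α| * δ' * δ * δ ^ k := by ring
    _ ≤ |c α| * δ' * δ * δ' ^ k := by gcongr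
    _ = _ := by ring

lemma nm_mono' {δ δ' : ℝ} (hδ : 0 < δ) (h : δ ≤ δ') (c : V m n) : nm δ' c ≤ nm δ c := by
  have hδ' : 0 < δ' := hδ.trans_le h
  refine (nm_mono hδ h c).trans ?_
  have : δ / δ' ≤ 1 := (div_le_one hδ').2 h
  nlinarith [nm_nonneg hδ c]

lemma nm_anti {δ δ' : ℝ} (hδ : 0 < δ) (h : δ ≤ δ') (c : V m n) :
    nm δ c ≤ (δ' / δ) ^ m * nm δ' c := by
  have hδ' : 0 < δ' := hδ.trans_le h
  have h1 : 1 ≤ δ' / δ := (one_le_div hδ).2 h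
  unfold nm
  rw [Finset.mul_sum]
  refine Finset.sum_le_sum fun α _ => ?_
  have : (δ' / δ) ^ (m - deg α.1) ≤ (δ' / δ) ^ m := pow_le_pow_right₀ h1 (by omega)
  calc |c α| / δ ^ (m - deg α.1) = (δ' / δ) ^ (m - deg α.1) * (|c α| / δ' ^ (m - deg α.1)) := by
        rw [div_pow]; field_simp
    _ ≤ _ := by gcongr

/-- the `N` form of the norm -/
def N (δ : ℝ) (c : V m n) : ℝ := ∑ α, |c α| * δ ^ deg α.1

lemma N_eq {δ : ℝ} (hδ : 0 < δ) (c : V m n) : N δ c = nm δ c * δ ^ m := by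
  unfold N nm
  rw [Finset.sum_mul]
  refine Finset.sum_congr rfl fun α _ => ?_
  have : δ ^ m = δ ^ (m - deg α.1) * δ ^ deg α.1 := by
    rw [← pow_add]; congr 1; have := α.2; omega
  rw [this]; field_simp

lemma N_nonneg {δ : ℝ} (hδ : 0 ≤ δ) (c : V m n) : 0 ≤ N δ c :=
  Finset.sum_nonneg fun _ _ => by positivity

lemma abs_pl_le (c : V m n) (h : Euc n) : |pl c h| ≤ N ‖h‖ c := by
  unfold pl N
  refine (Finset.abs_sum_le_sum_abs _ _).trans (Finset.sum_le_sum fun α _ => ?_)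
  rw [abs_mul]
  exact mul_le_mul_of_nonneg_left (abs_mono_le _ _) (abs_nonneg _)

lemma N_mono {δ δ' : ℝ} (hδ : 0 ≤ δ) (h : δ ≤ δ') (c : V m n) : N δ c ≤ N δ' c := by
  unfold N; gcongr

/-- near-identity of the shift -/
lemma sh_sub_le {δ ε : ℝ} (hδ : 0 < δ) (hε1 : ε ≤ 1) {h : Euc n} (hh : ‖h‖ ≤ ε * δ)
    (c : V m n) (α : Ix m n) :
    |sh h c α - c α| ≤ 2 ^ m * ε * nm δ c * δ ^ (m - deg α.1) := by
  have hε : 0 ≤ ε := by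
    by_contra hh'
    have := norm_nonneg h
    nlinarith
  classical
  have h1 : sh h c α - c α = ∑ β ∈ Finset.univ.erase α, bc α.1 β.1 h * c β := by
    rw [sh_apply, ← Finset.add_sum_erase _ _ (Finset.mem_univ α), bc_self]; ring
  rw [h1]
  refine (Finset.abs_sum_le_sum_abs _ _).trans ?_
  have h2 : ∀ β ∈ Finset.univ.erase α, |bc α.1 β.1 h * c β| ≤
      2 ^ m * ε * δ ^ (m - deg α.1) * (|c β| / δ ^ (m - deg β.1)) := by
    intro β hβ
    have hne : α ≠ β := (Finset.ne_of_mem_erase hβ).symm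
    by_cases hab : α.1 ≤ β.1
    · have hlt : deg α.1 < deg β.1 := deg_lt_of_ne hab (fun h => hne (Subtype.ext h))
      have hβ2 := β.2
      rw [abs_mul]
      have e1 : |bc α.1 β.1 h| ≤ 2 ^ m * (ε * δ ^ (deg β.1 - deg α.1)) := by
        refine (abs_bc_le h hab).trans ?_
        have : ‖h‖ ^ (deg β.1 - deg α.1) ≤ ε * δ ^ (deg β.1 - deg α.1) := by
          refine (pow_le_pow_left₀ (norm_nonneg _) hh _).trans ?_
          rw [mul_pow]
          have : ε ^ (deg β.1 - deg α.1) ≤ ε := pow_le_of_le_one hε hε1 (by omega)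
          gcongr
        have : (2:ℝ) ^ deg β.1 ≤ 2 ^ m := pow_le_pow_right₀ (by norm_num) hβ2.le
        gcongr
      have e2 : δ ^ (m - deg α.1) = δ ^ (deg β.1 - deg α.1) * δ ^ (m - deg β.1) := by
        rw [← pow_add]; congr 1; omega
      rw [e2]
      calc |bc α.1 β.1 h| * |c β| ≤ 2 ^ m * (ε * δ ^ (deg β.1 - deg α.1)) * |c β| := by gcongr
        _ = _ := by field_simp
    · rw [bc_eq_zero h hab]; simp; positivity
  refine (Finset.sum_le_sum h2).trans ?_
  rw [← Finset.mul_sum]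
  have : ∑ β ∈ Finset.univ.erase α, |c β| / δ ^ (m - deg β.1) ≤ nm δ c :=
    Finset.sum_le_sum_of_subset_of_nonneg (Finset.erase_subset _ _) fun _ _ _ => by positivity
  calc _ ≤ 2 ^ m * ε * δ ^ (m - deg α.1) * nm δ c := by gcongr
    _ = _ := by ring

/-- constant in (n2) -/
def Csh (m n : ℕ) : ℝ := 1 + Fintype.card (Ix m n) * 2 ^ m

lemma one_le_Csh : 1 ≤ Csh m n := by
  unfold Csh; have : (0:ℝ) ≤ Fintype.card (Ix m n) * 2 ^ m := by positivity
  linarith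

/-- (n2) -/
lemma nm_sh_le {δ : ℝ} (hδ : 0 < δ) {h : Euc n} (hh : ‖h‖ ≤ δ) (c : V m n) :
    nm δ (sh h c) ≤ Csh m n * nm δ c := by
  have h1 : nm δ (sh h c - c) ≤ Fintype.card (Ix m n) * (2 ^ m * nm δ c) := by
    refine nm_le_of_coef hδ _ fun α => ?_
    have := sh_sub_le (ε := 1) hδ le_rfl (by simpa using hh) c α
    simpa using this
  have h2 := nm_add hδ (sh h c - c) c
  rw [sub_add_cancel] at h2
  unfold Csh; nlinarith

/-- (n3), unit scale -/
lemma exists_C3 (m n : ℕ) : ∃ C : ℝ, 1 ≤ C ∧ ∀ (c : V m n) (B : ℝ), 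
    (∀ h : Euc n, ‖h‖ ≤ 1 → |pl c h| ≤ B) → (∑ α, |c α|) ≤ C * B := by
  let K := Metric.closedBall (0 : Euc n) 1
  have : CompactSpace K := isCompact_iff_compactSpace.mp (isCompact_closedBall _ _)
  let L : V m n →ₗ[ℝ] C(K, ℝ) :=
    { toFun := fun c => ⟨fun h => pl c h.1, (continuous_pl c).comp continuous_subtype_val⟩
      map_add' := fun c d => by ext h; exact pl_add c d h
      map_smul' := fun t c => by ext h; exact pl_smul t c h }
  have hL : LinearMap.ker L = ⊥ := by
    rw [LinearMap.ker_eq_bot']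
    intro c hc
    refine pl_eq_zero_of_ball c 1 one_pos fun k hk => ?_
    have := DFunLike.congr_fun hc (⟨k, by simpa [K] using hk⟩ : K)
    exact this
  obtain ⟨C, hC0, hC⟩ := L.exists_antilipschitzWith hL
  refine ⟨1 + Fintype.card (Ix m n) * C, by
    have : (0:ℝ) ≤ Fintype.card (Ix m n) * C := by positivity
    linarith, fun c B hB => ?_⟩
  have hB0 : 0 ≤ B := (abs_nonneg _).trans (hB 0 (by simp))
  have h1 : ‖L c‖ ≤ B := (ContinuousMap.norm_le _ hB0).2 fun h => by
    have h5 := hB h.1 (mem_closedBall_zero_iff.1 h.2)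
    exact h5
  have h2 : ‖c‖ ≤ C * ‖L c‖ := by
    simpa using hC.le_mul_dist c 0
  have h3 : ∑ α, |c α| ≤ Fintype.card (Ix m n) * ‖c‖ := by
    refine (Finset.sum_le_card_nsmul _ _ ‖c‖ fun α _ => ?_).trans (by simp)
    simpa using norm_le_pi_norm c α
  have : (C:ℝ) * ‖L c‖ ≤ C * B := by gcongr
  calc _ ≤ _ := h3
    _ ≤ Fintype.card (Ix m n) * (C * B) := by gcongr; linarith
    _ ≤ _ := by nlinarith

def C3 (m n : ℕ) : ℝ := (exists_C3 m n).choose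
lemma one_le_C3 : 1 ≤ C3 m n := (exists_C3 m n).choose_spec.1

/-- (n3) -/
lemma nm_le_of_ball {δ B : ℝ} (hδ : 0 < δ) (c : V m n)
    (h : ∀ k : Euc n, ‖k‖ ≤ δ → |pl c k| ≤ B * δ ^ m) : nm δ c ≤ C3 m n * B := by
  have := (exists_C3 m n).choose_spec.2 (fun α => c α / δ ^ (m - deg α.1)) B ?_
  · refine le_trans (le_of_eq ?_) this
    unfold nm
    refine Finset.sum_congr rfl fun α _ => ?_
    rw [abs_div, abs_of_pos (show 0 < δ ^ (m - deg α.1) by positivity)]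
  · intro k hk
    have h1 := h (δ • k) (by
      rw [norm_smul, Real.norm_of_nonneg hδ.le]; nlinarith)
    have h2 : pl c (δ • k) = δ ^ m * pl (fun α => c α / δ ^ (m - deg α.1)) k := by
      unfold pl
      rw [Finset.mul_sum]
      refine Finset.sum_congr rfl fun α _ => ?_
      have : δ ^ m = δ ^ (m - deg α.1) * δ ^ deg α.1 := by
        rw [← pow_add]; congr 1; have := α.2; omega
      rw [mono_smul, this]; field_simp
    rw [h2, abs_mul, abs_of_pos (show 0 < δ ^ m by positivity), mul_comm] at h1
    exact le_of_mul_le_mul_right h1 (by positivity)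

/-- uniqueness of the approximating polynomial -/
lemma pl_unique {c : V m n} {r M : ℝ} (hr : 0 < r)
    (h : ∀ k : Euc n, ‖k‖ ≤ r → |pl c k| ≤ M * ‖k‖ ^ m) : c = 0 := by
  have hM : ∀ δ, 0 < δ → δ ≤ r → nm δ c ≤ C3 m n * |M| := fun δ hδ hδr =>
    nm_le_of_ball hδ c fun k hk => (h k (hk.trans hδr)).trans (by
      have : ‖k‖ ^ m ≤ δ ^ m := pow_le_pow_left₀ (norm_nonneg _) hk _
      calc M * ‖k‖ ^ m ≤ |M| * ‖k‖ ^ m := by gcongr; exact le_abs_self M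
        _ ≤ _ := by gcongr)
  funext α
  by_contra hne
  have hpos : 0 < |c α| := abs_pos.2 hne
  have hk : m - deg α.1 ≠ 0 := by have := α.2; omega
  have hb : ∀ δ, 0 < δ → δ ≤ r → δ ≤ 1 → |c α| ≤ C3 m n * |M| * δ := fun δ hδ hδr hδ1 => by
    refine (coef_le_nm hδ c α).trans ?_
    have h1 := hM δ hδ hδr
    have h2 : δ ^ (m - deg α.1) ≤ δ := pow_le_of_le_one hδ.le hδ1 hk
    have := nm_nonneg hδ c
    have h3 : 0 ≤ C3 m n * |M| := this.trans h1
    gcongr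
  have hK : 0 ≤ C3 m n * |M| := mul_nonneg (by linarith [one_le_C3 (m := m) (n := n)]) (abs_nonneg _)
  set K := C3 m n * |M|
  have hq : 0 < |c α| / (2 * (K + 1)) := by positivity
  have := hb (min (min r 1) (|c α| / (2 * (K + 1)))) (by positivity)
    ((min_le_left _ _).trans (min_le_left _ _)) ((min_le_left _ _).trans (min_le_right _ _))
  have h2 : K * min (min r 1) (|c α| / (2 * (K + 1))) ≤ K * (|c α| / (2 * (K + 1))) := by
    gcongr; exact min_le_right _ _
  have h3 : K * (|c α| / (2 * (K + 1))) < |c α| := by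
    rw [mul_div_assoc', div_lt_iff₀ (by positivity)]; nlinarith
  linarith

end FP


namespace FP
variable {m n : ℕ}

/-- extension by zero of a coefficient vector -/
def cx (c : V m n) (α : Fin n → ℕ) : ℝ := if h : deg α < m then c ⟨α, h⟩ else 0

lemma cx_coe (c : V m n) (α : Ix m n) : cx c α.1 = c α := by
  unfold cx; rw [dif_pos α.2]

lemma cx_sum (c : V m n) (γ : Fin n → ℕ) :
    ∑ β : Ix m n, (if β.1 = γ then c β else 0) = cx c γ := by
  classical
  unfold cx
  split_ifs with h
  · rw [Finset.sum_eq_single ⟨γ, h⟩]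
    · simp
    · intro b _ hb
      rw [if_neg]; intro h'; exact hb (Subtype.ext h')
    · simp
  · refine Finset.sum_eq_zero fun b _ => ?_
    rw [if_neg]; intro h'; exact h (h' ▸ b.2)

/-- unit multi-index -/
def eI (i : Fin n) : Fin n → ℕ := Pi.single i 1

lemma deg_eI (i : Fin n) : deg (eI i) = 1 := by
  unfold deg eI
  simp

lemma deg_add_eI (α : Fin n → ℕ) (i : Fin n) : deg (α + eI i) = deg α + 1 := by
  rw [deg_add, deg_eI]

lemma eI_inj {i j : Fin n} (h : eI i = eI j) : i = j := by
  by_contra hne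
  have := congrFun h i
  simp [eI, hne] at this

/-- linear part -/
def linP (α : Fin n → ℕ) (c : V m n) : Euc n →L[ℝ] ℝ :=
  ∑ i, (((α i : ℝ) + 1) * cx c (α + eI i)) • (EuclideanSpace.proj i : Euc n →L[ℝ] ℝ)

lemma linP_apply (α : Fin n → ℕ) (c : V m n) (h : Euc n) :
    linP α c h = ∑ i, (((α i : ℝ) + 1) * cx c (α + eI i)) * h i := by
  simp [linP]

lemma eq_add_eI {α β : Fin n → ℕ} (h : α ≤ β) (hd : deg β = deg α + 1) : ∃ i, β = α + eI i := by
  obtain ⟨i, hi⟩ : ∃ i, α i < β i := by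
    by_contra! hh
    have := deg_mono (show β ≤ α from hh)
    omega
  refine ⟨i, ?_⟩
  have hle : α + eI i ≤ β := fun j => by
    have := h j
    by_cases hj : j = i
    · subst hj; simp [eI]; omega
    · simpa [eI, hj] using this
  by_contra hne
  have := deg_lt_of_ne hle (Ne.symm hne)
  rw [deg_add_eI] at this
  omega

lemma bc_add_eI (α : Fin n → ℕ) (i : Fin n) (h : Euc n) :
    bc α (α + eI i) h = ((α i : ℝ) + 1) * h i := by
  unfold bc
  rw [Finset.prod_eq_single i]
  · simp [eI]
  · intro j _ hj
    simp [eI, hj]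
  · simp

lemma bc_quad (α β : Fin n → ℕ) {h : Euc n} (hh : ‖h‖ ≤ 1) :
    |bc α β h - (if β = α then 1 else 0) - ∑ i, (if β = α + eI i then ((α i : ℝ) + 1) * h i else 0)|
      ≤ 2 ^ deg β * ‖h‖ ^ 2 := by
  by_cases hab : α ≤ β
  · by_cases he : β = α
    · subst he
      have : ∀ i, β ≠ β + eI i := fun i hi => by
        have := congrArg deg hi
        rw [deg_add_eI] at this; omega
      rw [bc_self]
      simp only [this, if_false]
      simp
    · have hlt := deg_lt_of_ne hab (Ne.symm he)
      by_cases hd : deg β = deg α + 1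
      · obtain ⟨i, hi⟩ := eq_add_eI hab hd
        have : ∑ j, (if β = α + eI j then ((α j : ℝ) + 1) * h j else 0) = ((α i : ℝ) + 1) * h i := by
          rw [Finset.sum_eq_single i]
          · simp [hi]
          · intro j _ hj
            rw [if_neg]; intro h'
            rw [hi] at h'
            exact hj (eI_inj (add_left_cancel h')).symm
          · simp
        rw [this, if_neg he, hi, bc_add_eI]
        simp
      · have : ∀ i, β ≠ α + eI i := fun i hi => hd (by rw [hi, deg_add_eI])
        simp only [this, if_false, if_neg he]
        simp only [Finset.sum_const_zero, sub_zero]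
        refine (abs_bc_le h hab).trans ?_
        have : ‖h‖ ^ (deg β - deg α) ≤ ‖h‖ ^ 2 :=
          pow_le_pow_of_le_one (norm_nonneg _) hh (by omega)
        gcongr
  · have h1 : β ≠ α := fun h' => hab (h' ▸ le_rfl)
    have h2 : ∀ i, β ≠ α + eI i := fun i hi => hab (hi ▸ le_self_add)
    simp only [h1, h2, if_false, bc_eq_zero h hab]
    simp

lemma sh_quad (c : V m n) (α : Ix m n) {h : Euc n} (hh : ‖h‖ ≤ 1) :
    |sh h c α - c α - linP α.1 c h| ≤ (∑ β, |c β| * 2 ^ m) * ‖h‖ ^ 2 := by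
  classical
  have e1 : c α = ∑ β : Ix m n, (if β.1 = α.1 then 1 else 0) * c β := by
    rw [← cx_coe c α, ← cx_sum]
    exact Finset.sum_congr rfl fun β _ => by split_ifs <;> simp
  have e2 : linP α.1 c h =
      ∑ β : Ix m n, (∑ i, (if β.1 = α.1 + eI i then ((α.1 i : ℝ) + 1) * h i else 0)) * c β := by
    rw [linP_apply]
    simp_rw [← cx_sum, Finset.sum_mul, Finset.mul_sum, Finset.sum_mul]
    rw [Finset.sum_comm]
    exact Finset.sum_congr rfl fun β _ => Finset.sum_congr rfl fun i _ => by
      split_ifs <;> ring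
  have e3 : sh h c α - c α - linP α.1 c h = sh h c α - (∑ β : Ix m n, (if β.1 = α.1 then 1 else 0) * c β) - linP α.1 c h := by
    rw [← e1]
  rw [e3, e2, sh_apply, ← Finset.sum_sub_distrib, ← Finset.sum_sub_distrib]
  refine (Finset.abs_sum_le_sum_abs _ _).trans ?_
  rw [Finset.sum_mul]
  refine Finset.sum_le_sum fun β _ => ?_
  rw [← sub_mul, ← sub_mul, abs_mul]
  have := bc_quad α.1 β.1 hh
  have h2 : (2:ℝ) ^ deg β.1 ≤ 2 ^ m := pow_le_pow_right₀ (by norm_num) β.2.le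
  calc _ ≤ 2 ^ deg β.1 * ‖h‖ ^ 2 * |c β| := by gcongr
    _ ≤ 2 ^ m * ‖h‖ ^ 2 * |c β| := by gcongr
    _ = _ := by ring

/-- formal Taylor fields -/
def IsField (c : Euc n → V m n) : Prop :=
  ∀ α : Ix m n, deg α.1 + 1 < m → ∀ z, HasFDerivAt (fun z => c z α) (linP α.1 (c z)) z

lemma isField_of_approx (c : Euc n → V m n)
    (h : ∀ x, ∃ r > 0, ∃ K : ℝ, ∀ z, ‖z - x‖ ≤ r → ∀ α : Ix m n,
      |c z α - sh (z - x) (c x) α| ≤ K * ‖z - x‖ ^ (m - deg α.1)) : IsField c := by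
  intro α hα x
  obtain ⟨r, hr, K, hK⟩ := h x
  rw [hasFDerivAt_iff_isLittleO]
  have hO : (fun z => c z α - c x α - linP α.1 (c x) (z - x)) =O[nhds x] fun z => ‖z - x‖ ^ 2 := by
    refine Asymptotics.IsBigO.of_bound (|K| + ∑ β, |c x β| * 2 ^ m) ?_
    have : Metric.ball x (min r 1) ∈ nhds x := Metric.ball_mem_nhds _ (by positivity)
    filter_upwards [this] with z hz
    rw [Metric.mem_ball, dist_eq_norm] at hz
    have hz1 : ‖z - x‖ ≤ r := (hz.trans_le (min_le_left _ _)).le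
    have hz2 : ‖z - x‖ ≤ 1 := (hz.trans_le (min_le_right _ _)).le
    have a1 := hK z hz1 α
    have a2 := sh_quad (c x) α hz2
    have a3 : ‖z - x‖ ^ (m - deg α.1) ≤ ‖z - x‖ ^ 2 :=
      pow_le_pow_of_le_one (norm_nonneg _) hz2 (by omega)
    have a4 : K * ‖z - x‖ ^ (m - deg α.1) ≤ |K| * ‖z - x‖ ^ 2 := by
      calc _ ≤ |K| * ‖z - x‖ ^ (m - deg α.1) := by gcongr; exact le_abs_self K
        _ ≤ _ := by gcongr
    rw [Real.norm_eq_abs, Real.norm_of_nonneg (by positivity), add_mul]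
    calc _ = |(c z α - sh (z - x) (c x) α) + (sh (z - x) (c x) α - c x α - linP α.1 (c x) (z - x))| := by
          congr 1; ring
      _ ≤ _ := (abs_add_le _ _).trans (by linarith)
  refine hO.trans_isLittleO ?_
  have h1 : (fun z : Euc n => ‖z - x‖ ^ 2) =o[nhds x] fun z => ‖z - x‖ := by
    have : Filter.Tendsto (fun z : Euc n => ‖z - x‖) (nhds x) (nhds 0) := by
      have : Continuous (fun z : Euc n => ‖z - x‖) := by fun_prop
      simpa using this.tendsto x
    exact (Asymptotics.isLittleO_pow_id (one_lt_two)).comp_tendsto this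
  exact h1.trans_isBigO (Asymptotics.isBigO_norm_left.2 (Asymptotics.isBigO_refl _ _))

lemma isField_sh (p : V m n) : IsField (fun z => sh z p) := by
  refine isField_of_approx _ fun x => ⟨1, one_pos, 0, fun z _ α => ?_⟩
  rw [← co_change]; simp

lemma IsField.contDiff_aux {c : Euc n → V m n} (hc : IsField c)
    (htop : ∀ α : Ix m n, deg α.1 + 1 = m → Continuous fun z => c z α) (k : ℕ) :
    ∀ α : Ix m n, deg α.1 + k + 1 = m → ContDiff ℝ k (fun z => c z α) := by
  induction k with
  | zero =>
    intro α hα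
    simpa [contDiff_zero] using htop α (by omega)
  | succ k ih =>
    intro α hα
    have : ((k + 1 : ℕ) : WithTop ℕ∞) = (k : WithTop ℕ∞) + 1 := by simp
    rw [this, contDiff_succ_iff_hasFDerivAt]
    refine ⟨fun z => linP α.1 (c z), ?_, fun z => hc α (by omega) z⟩
    unfold linP
    refine ContDiff.sum fun i _ => ?_
    have hd : deg (α.1 + eI i) < m := by rw [deg_add_eI]; omega
    have h1 := ih ⟨α.1 + eI i, hd⟩ (by simp only [deg_add_eI]; omega)
    have e : (fun z => cx (c z) (α.1 + eI i)) = fun z => c z ⟨α.1 + eI i, hd⟩ := by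
      funext z; unfold cx; rw [dif_pos hd]
    have h2 : ContDiff ℝ k (fun z => ((α.1 i : ℝ) + 1) * cx (c z) (α.1 + eI i)) := by
      refine contDiff_const.mul ?_
      rw [e]; exact h1
    exact h2.smul contDiff_const

lemma count_list (α : Fin n → ℕ) (i : Fin n) :
    ((List.finRange n).flatMap fun i => List.replicate (α i) i).count i = α i := by
  rw [List.count_flatMap]
  have : (List.map (List.count i ∘ fun i => List.replicate (α i) i) (List.finRange n)) =
      List.map (fun j => if j = i then α j else 0) (List.finRange n) := by
    refine List.map_congr_left fun j _ => ?_
    simp [List.count_replicate]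
  rw [this]
  have := (List.sum_ofFn (f := fun j => if j = i then α j else 0))
  rw [List.ofFn_eq_map] at this
  rw [this]; simp

lemma deg_count (l : List (Fin n)) : deg (fun i => l.count i) = l.length := by
  unfold deg
  induction l with
  | nil => simp
  | cons a l ih =>
    simp only [List.count_cons, Finset.sum_add_distrib, ih, List.length_cons]
    simp

lemma count_cons_eq (a : Fin n) (l : List (Fin n)) :
    (fun i => (a :: l).count i) = (fun i => l.count i) + eI a := by
  funext i
  simp only [List.count_cons, Pi.add_apply, eI, Pi.single_apply]
  by_cases h : i = a
  · simp [h]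
  · simp [h, Ne.symm h]

/-- multi-factorial -/
def mf (α : Fin n → ℕ) : ℝ := ∏ i, ((α i).factorial : ℝ)

lemma one_le_mf (α : Fin n → ℕ) : 1 ≤ mf α := by
  unfold mf
  have : ∏ i : Fin n, (1:ℝ) ≤ ∏ i, ((α i).factorial : ℝ) :=
    Finset.prod_le_prod (by simp) fun i _ => by exact_mod_cast Nat.one_le_iff_ne_zero.2 (Nat.factorial_ne_zero _)
  simpa using this

lemma mf_pos (α : Fin n → ℕ) : 0 < mf α := by linarith [one_le_mf α]

lemma mf_zero : mf (0 : Fin n → ℕ) = 1 := by simp [mf]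

lemma mf_add_eI (α : Fin n → ℕ) (i : Fin n) : mf (α + eI i) = ((α i : ℝ) + 1) * mf α := by
  classical
  unfold mf
  rw [← Finset.mul_prod_erase _ _ (Finset.mem_univ i), ← Finset.mul_prod_erase _ (fun j => ((α j).factorial : ℝ)) (Finset.mem_univ i)]
  have : ∏ x ∈ Finset.univ.erase i, (((α + eI i) x).factorial : ℝ) =
      ∏ x ∈ Finset.univ.erase i, ((α x).factorial : ℝ) := by
    refine Finset.prod_congr rfl fun j hj => ?_
    have := Finset.ne_of_mem_erase hj
    simp [eI, this]
  rw [this]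
  simp only [Pi.add_apply, eI, Pi.single_eq_same, Nat.factorial_succ]
  push_cast; ring

lemma mf_le (α : Fin n → ℕ) : mf α ≤ ((deg α).factorial : ℝ) := by
  unfold mf deg
  have : ∏ i, (α i).factorial ∣ (∑ i, α i).factorial := Nat.prod_factorial_dvd_factorial_sum _ _
  exact_mod_cast Nat.le_of_dvd (Nat.factorial_pos _) this

lemma linP_single (α : Fin n → ℕ) (c : V m n) (i : Fin n) :
    linP α c (EuclideanSpace.single i 1) = ((α i : ℝ) + 1) * cx c (α + eI i) := by
  rw [linP_apply]
  simp

lemma IsField.foldr {c : Euc n → V m n} (hc : IsField c) (l : List (Fin n)) (hl : l.length < m) :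
    l.foldr pD (fun z => cx (c z) 0) =
      fun z => mf (fun i => l.count i) * cx (c z) (fun i => l.count i) := by
  induction l with
  | nil =>
    funext z
    have : (fun i : Fin n => ([] : List (Fin n)).count i) = 0 := by funext i; simp
    rw [this, mf_zero]; simp
  | cons a l ih =>
    simp only [List.length_cons] at hl
    rw [List.foldr_cons, ih (by omega)]
    funext z
    have hd : deg (fun i => l.count i) < m := by rw [deg_count]; omega
    have h1 := hc ⟨_, hd⟩ (by simp only [deg_count]; omega) z
    have h2 : HasFDerivAt (fun z => mf (fun i => l.count i) * cx (c z) (fun i => l.count i))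
        (mf (fun i => l.count i) • linP (fun i => l.count i) (c z)) z := by
      have := h1.const_mul (mf (fun i => l.count i))
      have e : (fun z => mf (fun i => l.count i) * cx (c z) (fun i => l.count i)) =
          fun z => mf (fun i => l.count i) * c z ⟨_, hd⟩ := by
        funext z; unfold cx; rw [dif_pos hd]
      rw [e]; exact this
    unfold pD
    rw [h2.fderiv, count_cons_eq, mf_add_eI, _root_.smul_apply, linP_single]
    simp only [smul_eq_mul]; ring

lemma IsField.mD_eq {c : Euc n → V m n} (hc : IsField c) (α : Ix m n) (z : Euc n) :
    mD α.1 (fun z => cx (c z) 0) z = mf α.1 * c z α := by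
  unfold mD
  have hct : (fun i => (((List.finRange n).flatMap fun i => List.replicate (α.1 i) i)).count i) = α.1 :=
    funext fun i => count_list α.1 i
  rw [hc.foldr, hct]
  · simp only [cx_coe]
  rw [← deg_count, hct]
  exact α.2

lemma sh_eq_pl (h : Euc n) (c : V m n) : cx (sh h c) 0 = pl c h := by
  unfold cx
  split_ifs with h0
  · rw [sh_apply]; unfold pl
    refine Finset.sum_congr rfl fun β _ => ?_
    simp [bc, mono, mul_comm]
  · have : IsEmpty (Ix m n) := ⟨fun α => h0 (lt_of_le_of_lt (by simp [deg]) α.2)⟩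
    simp [pl]

lemma mD_pl (p : V m n) (α : Ix m n) (z : Euc n) : mD α.1 (pl p) z = mf α.1 * sh z p α := by
  rw [← (isField_sh p).mD_eq α z]
  congr 1
  funext z; rw [sh_eq_pl]

/-- Taylor constant -/
def CT (m n : ℕ) (k : ℕ) : ℝ := (n * m : ℝ) ^ k

lemma IsField.taylor {c : Euc n → V m n} (hc : IsField c) {K : ℝ} (hK : 0 ≤ K)
    (htop : ∀ α : Ix m n, deg α.1 + 1 = m → ∀ y z, |c y α - c z α| ≤ K * ‖y - z‖) (x : Euc n) (k : ℕ) :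
    ∀ α : Ix m n, deg α.1 + k + 1 = m → ∀ y, |c y α - sh (y - x) (c x) α| ≤
      CT m n k * K * ‖y - x‖ ^ (k + 1) := by
  induction k with
  | zero =>
    intro α hα y
    have : sh (y - x) (c x) α = c x α := by
      rw [sh_apply, Finset.sum_eq_single α, bc_self, one_mul]
      · intro β _ hβ
        by_cases hab : α.1 ≤ β.1
        · have := deg_lt_of_ne hab (fun h => hβ (Subtype.ext h.symm))
          have := β.2
          omega
        · rw [bc_eq_zero _ hab, zero_mul]
      · simp
    rw [this]
    simpa [CT] using htop α (by omega) y x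
  | succ k ih =>
    intro α hα y
    set p := sh (-x) (c x) with hp
    have hpx : ∀ y, sh (y - x) (c x) = sh y p := fun y => by
      rw [hp, sh_sh]; congr 1; rw [neg_add_eq_sub]
    have hder : ∀ z, HasFDerivAt (fun z => c z α - sh z p α) (linP α.1 (c z) - linP α.1 (sh z p)) z :=
      fun z => (hc α (by omega) z).sub (isField_sh p α (by omega) z)
    have hbound : ∀ z, ‖z - x‖ ≤ ‖y - x‖ → ‖linP α.1 (c z) - linP α.1 (sh z p)‖ ≤
        CT m n (k + 1) * K * ‖y - x‖ ^ (k + 1) := by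
      intro z hz
      have e : linP α.1 (c z) - linP α.1 (sh z p) = ∑ i, (((α.1 i : ℝ) + 1) *
          (cx (c z) (α.1 + eI i) - cx (sh z p) (α.1 + eI i))) • (EuclideanSpace.proj i : Euc n →L[ℝ] ℝ) := by
        unfold linP
        rw [← Finset.sum_sub_distrib]
        refine Finset.sum_congr rfl fun i _ => ?_
        ext h; simp; ring
      rw [e]
      refine (norm_sum_le _ _).trans ?_
      have : ∀ i ∈ Finset.univ, ‖(((α.1 i : ℝ) + 1) *
          (cx (c z) (α.1 + eI i) - cx (sh z p) (α.1 + eI i))) • (EuclideanSpace.proj i : Euc n →L[ℝ] ℝ)‖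
          ≤ m * (CT m n k * K * ‖y - x‖ ^ (k + 1)) := by
        intro i _
        have hd : deg (α.1 + eI i) < m := by rw [deg_add_eI]; omega
        have h1 := ih ⟨α.1 + eI i, hd⟩ (by simp only [deg_add_eI]; omega) z
        rw [hpx, ← cx_coe (c z), ← cx_coe (sh z p)] at h1
        have h2 : ‖(EuclideanSpace.proj i : Euc n →L[ℝ] ℝ)‖ ≤ 1 :=
          ContinuousLinearMap.opNorm_le_bound _ zero_le_one fun h => by
            simpa using abs_coord_le h i
        rw [norm_smul, norm_mul, Real.norm_eq_abs, Real.norm_eq_abs]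
        have h3 : |(α.1 i : ℝ) + 1| ≤ m := by
          rw [abs_of_nonneg (by positivity)]
          have := le_deg α.1 i
          exact_mod_cast (by omega : α.1 i + 1 ≤ m)
        have h4 : CT m n k * K * ‖z - x‖ ^ (k + 1) ≤ CT m n k * K * ‖y - x‖ ^ (k + 1) := by
          have : 0 ≤ CT m n k := by unfold CT; positivity
          gcongr
        calc _ ≤ (m * (CT m n k * K * ‖y - x‖ ^ (k + 1))) * 1 := by
              have := h1.trans h4
              have h0 := (abs_nonneg _).trans this
              gcongr
          _ = _ := mul_one _
      refine (Finset.sum_le_card_nsmul _ _ _ this).trans ?_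
      simp only [Finset.card_univ, Fintype.card_fin, nsmul_eq_mul]
      apply le_of_eq; unfold CT; ring
    have hmv := Convex.norm_image_sub_le_of_norm_hasFDerivWithin_le (𝕜 := ℝ) (s := Metric.closedBall x ‖y - x‖)
      (f := fun z => c z α - sh z p α) (x := x) (y := y)
      (fun z _ => (hder z).hasFDerivWithinAt) (fun z hz => hbound z (by simpa [dist_eq_norm] using hz))
      (convex_closedBall _ _) (by simp) (by simp [dist_eq_norm])
    have h0 : c x α - sh x p α = 0 := by
      rw [← hpx x, sub_self, sh_zero, sub_self]
    rw [h0, sub_zero] at hmv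
    rw [hpx y]
    calc _ ≤ _ := hmv
      _ = _ := by rw [pow_succ _ (k+1)]; ring

end FP


namespace FP
variable {m n : ℕ}

lemma pD_contDiff {k : ℕ} {F : Euc n → ℝ} (hF : ContDiff ℝ (k + 1 : ℕ) F) (i : Fin n) :
    ContDiff ℝ k (pD i F) := by
  unfold pD
  have : ContDiff ℝ k (fderiv ℝ F) := hF.fderiv_right (by norm_cast)
  exact this.clm_apply contDiff_const

lemma pD_comm {F : Euc n → ℝ} (hF : ContDiff ℝ (2 : ℕ) F) (i j : Fin n) :
    pD i (pD j F) = pD j (pD i F) := by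
  have h1 : Differentiable ℝ (fderiv ℝ F) := by
    have : ContDiff ℝ (1 : ℕ) (fderiv ℝ F) := hF.fderiv_right (by norm_cast)
    exact this.differentiable (by simp)
  have key : ∀ v w : Euc n, ∀ x, fderiv ℝ (fun x => fderiv ℝ F x v) x w = fderiv ℝ (fderiv ℝ F) x w v := by
    intro v w x
    have := ((h1 x).hasFDerivAt.clm_apply (hasFDerivAt_const v x)).fderiv
    rw [this]; simp
  funext x
  unfold pD
  rw [key, key]
  exact (hF.contDiffAt.isSymmSndFDerivAt (by simp)) _ _

lemma foldr_contDiff (l : List (Fin n)) : ∀ (k : ℕ) {F : Euc n → ℝ}, ContDiff ℝ (l.length + k : ℕ) F →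
    ContDiff ℝ k (l.foldr pD F) := by
  induction l with
  | nil => intro k F hF; simpa using hF
  | cons a l ih =>
    intro k F hF
    rw [List.foldr_cons]
    refine pD_contDiff (ih (k + 1) ?_) a
    convert hF using 2
    simp only [List.length_cons]; ring

lemma foldr_perm {l l' : List (Fin n)} (h : l.Perm l') {F : Euc n → ℝ} (hF : ContDiff ℝ (l.length : ℕ) F) :
    l.foldr pD F = l'.foldr pD F := by
  induction h with
  | nil => rfl
  | cons a _ ih =>
    rw [List.foldr_cons, List.foldr_cons, ih]
    exact hF.of_le (by simp)
  | swap a b l =>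
    simp only [List.foldr_cons]
    refine pD_comm (foldr_contDiff l 2 ?_) _ _
    exact hF
  | trans h1 _ ih1 ih2 =>
    rw [ih1 hF, ih2]
    rw [← h1.length_eq]; exact hF

/-- list of a multi-index -/
def lst (α : Fin n → ℕ) : List (Fin n) := (List.finRange n).flatMap fun i => List.replicate (α i) i

lemma length_lst (α : Fin n → ℕ) : (lst α).length = deg α := by
  rw [← deg_count]; congr 1; funext i; exact count_list α i

lemma mD_add_eI {F : Euc n → ℝ} (α : Fin n → ℕ) (i : Fin n) (hF : ContDiff ℝ (deg α + 1 : ℕ) F) :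
    mD (α + eI i) F = pD i (mD α F) := by
  have : (lst (α + eI i)).Perm (i :: lst α) := by
    rw [List.perm_iff_count]
    intro j
    have h := congrFun (count_cons_eq i (lst α)) j
    rw [h, Pi.add_apply]
    unfold lst
    rw [count_list, count_list]; rfl
  have := foldr_perm (F := F) this (by rw [length_lst, deg_add_eI]; exact hF)
  exact this

lemma mD_contDiff {F : Euc n → ℝ} (α : Fin n → ℕ) (k : ℕ) (hF : ContDiff ℝ (deg α + k : ℕ) F) :
    ContDiff ℝ k (mD α F) := by
  refine foldr_contDiff (lst α) k ?_
  rw [length_lst]; exact hF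

lemma mD_zero (F : Euc n → ℝ) : mD 0 F = F := by
  unfold mD
  have : (lst (0 : Fin n → ℕ)) = [] := by
    rw [← List.length_eq_zero_iff, length_lst]; simp [deg]
  unfold lst at this
  rw [this]; rfl

/-- Taylor coefficients of a function -/
def tc (m : ℕ) {n : ℕ} (F : Euc n → ℝ) (z : Euc n) : V m n := fun α => mD α.1 F z / mf α.1

lemma isField_tc {F : Euc n → ℝ} (hF : ContDiff ℝ (m - 1 : ℕ) F) : IsField (tc m F) := by
  intro α hα z
  have h1 : ContDiff ℝ (1 : ℕ) (mD α.1 F) := mD_contDiff α.1 1 (hF.of_le (by norm_cast; omega))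
  have h2 := (h1.differentiable (by simp) z).hasFDerivAt
  have h3 := h2.const_mul (mf α.1)⁻¹
  unfold tc
  have e : linP α.1 (fun α : Ix m n => mD α.1 F z / mf α.1) = (mf α.1)⁻¹ • fderiv ℝ (mD α.1 F) z := by
    ext h
    have hs : h = ∑ i, h i • (EuclideanSpace.single i (1:ℝ) : Euc n) := by
      ext j; simp [Pi.single_apply]
    rw [linP_apply]
    conv_rhs => rw [hs]
    rw [_root_.smul_apply, map_sum, Finset.smul_sum]
    refine Finset.sum_congr rfl fun i _ => ?_
    have hd : deg (α.1 + eI i) < m := by rw [deg_add_eI]; omega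
    unfold cx
    rw [dif_pos hd]
    simp only []
    rw [mD_add_eI α.1 i (hF.of_le (by norm_cast; omega)), mf_add_eI, map_smul]
    unfold pD
    have := mf_pos α.1
    simp only [smul_eq_mul]
    field_simp
  rw [e]
  have e2 : (fun z => mD α.1 F z / mf α.1) = fun z => (mf α.1)⁻¹ * mD α.1 F z := by
    funext z; rw [div_eq_inv_mul]
  rw [e2]; exact h3

lemma axis_lip {g : Euc n → ℝ} {M : ℝ}
    (h : ∀ i : Fin n, ∀ x : Euc n, ∀ t : ℝ, |g (x + t • EuclideanSpace.single i (1 : ℝ)) - g x| ≤ M * |t|)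
    (x y : Euc n) : |g y - g x| ≤ n * M * ‖y - x‖ := by
  classical
  rcases Nat.eq_zero_or_pos n with h0 | hn
  · subst h0
    have : y = x := Subsingleton.elim _ _
    simp [this]
  have hM : 0 ≤ M := by
    have := h ⟨0, hn⟩ 0 1
    have h2 := (abs_nonneg _).trans this
    simpa using h2
  have key : ∀ s : Finset (Fin n), |g (x + ∑ i ∈ s, (y - x) i • EuclideanSpace.single i (1:ℝ)) - g x|
      ≤ s.card * (M * ‖y - x‖) := by
    intro s
    induction s using Finset.induction_on with
    | empty => simp
    | insert a s ha ih =>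
      rw [Finset.sum_insert ha, Finset.card_insert_of_notMem ha]
      have h1 := h a (x + ∑ i ∈ s, (y - x) i • EuclideanSpace.single i (1:ℝ)) ((y - x) a)
      have h2 : M * |(y - x) a| ≤ M * ‖y - x‖ := by gcongr; exact abs_coord_le _ _
      rw [add_comm (((y - x) a) • _), ← add_assoc]
      have h3 := abs_sub_le (g (x + ∑ i ∈ s, (y - x) i • EuclideanSpace.single i (1:ℝ) + (y - x) a • EuclideanSpace.single a (1:ℝ))) (g (x + ∑ i ∈ s, (y - x) i • EuclideanSpace.single i (1:ℝ))) (g x)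
      push_cast
      linarith
  have h1 := key Finset.univ
  have hs : x + ∑ i, (y - x) i • (EuclideanSpace.single i (1:ℝ) : Euc n) = y := by
    ext j; simp [Pi.single_apply]
  rw [hs] at h1
  simp only [Finset.card_univ, Fintype.card_fin] at h1
  linarith

/-- local-to-global Lipschitz -/
lemma lip_of_local {g : Euc n → ℝ} {K : ℝ}
    (h : ∀ x, ∃ r > 0, ∀ z, ‖z - x‖ ≤ r → |g z - g x| ≤ K * ‖z - x‖) (hK : 0 ≤ K) (x y : Euc n) :
    |g y - g x| ≤ K * ‖y - x‖ := by
  have hcont : Continuous g := by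
    rw [Metric.continuous_iff]
    intro b ε hε
    obtain ⟨r, hr, h1⟩ := h b
    refine ⟨min r (ε / (K + 1)), by positivity, fun a ha => ?_⟩
    rw [dist_eq_norm] at ha ⊢
    have h2 := h1 a (ha.le.trans (min_le_left _ _))
    have h3 := ha.le.trans (min_le_right _ _)
    rw [Real.norm_eq_abs]
    calc _ ≤ _ := h2
      _ ≤ K * (ε / (K + 1)) := by gcongr
      _ < ε := by rw [mul_div_assoc', div_lt_iff₀ (by positivity)]; nlinarith
  set γ : ℝ → Euc n := fun t => x + t • (y - x) with hγ
  have hγc : Continuous γ := by fun_prop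
  let s : Set ℝ := {t | |g (γ t) - g x| ≤ K * (t * ‖y - x‖)}
  have hs : IsClosed s := isClosed_le (by fun_prop) (by fun_prop)
  have hsub : Set.Icc (0:ℝ) 1 ⊆ s := by
    refine IsClosed.Icc_subset_of_forall_exists_gt (hs.inter isClosed_Icc) ?_ ?_
    · simp [s, hγ]
    · rintro t ⟨ht, ht0, ht1⟩ u hu
      obtain ⟨r, hr, h1⟩ := h (γ t)
      rw [Set.mem_Ioi] at hu
      have hpos : 0 < r / (‖y - x‖ + 1) := by positivity
      refine ⟨min u (t + r / (‖y - x‖ + 1)), ?_, ?_⟩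
      · set v := min u (t + r / (‖y - x‖ + 1)) with hv
        have hvt : t < v := lt_min hu (by linarith)
        have hd : γ v - γ t = (v - t) • (y - x) := by simp only [hγ]; module
        have hn : ‖γ v - γ t‖ = (v - t) * ‖y - x‖ := by
          rw [hd, norm_smul, Real.norm_of_nonneg (by linarith)]
        have hr' : ‖γ v - γ t‖ ≤ r := by
          rw [hn]
          have : v - t ≤ r / (‖y - x‖ + 1) := by
            have := min_le_right u (t + r / (‖y - x‖ + 1)); linarith
          calc _ ≤ r / (‖y - x‖ + 1) * ‖y - x‖ := by gcongr
            _ ≤ r := by rw [div_mul_eq_mul_div, div_le_iff₀ (by positivity)]; nlinarith [norm_nonneg (y - x)]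
        have h2 := h1 _ hr'
        rw [hn] at h2
        change |g (γ t) - g x| ≤ K * (t * ‖y - x‖) at ht
        change |g (γ v) - g x| ≤ K * (v * ‖y - x‖)
        have := abs_sub_le (g (γ v)) (g (γ t)) (g x)
        nlinarith
      · exact ⟨lt_min hu (by linarith), min_le_left _ _⟩
  have := hsub (Set.right_mem_Icc.2 zero_le_one)
  simpa [s, hγ] using this

/-- overall Taylor constant -/
def CTm (m n : ℕ) : ℝ := 1 + ∑ k ∈ Finset.range m, CT m n k

lemma CT_le {k : ℕ} (hk : k < m) : CT m n k ≤ CTm m n := by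
  unfold CTm
  have := Finset.single_le_sum (f := fun k => CT m n k) (s := Finset.range m) (fun i _ => by unfold CT; positivity)
    (Finset.mem_range.2 hk)
  linarith

lemma one_le_CTm : 1 ≤ CTm m n := by
  unfold CTm
  have : 0 ≤ ∑ k ∈ Finset.range m, CT m n k := Finset.sum_nonneg fun i _ => by unfold CT; positivity
  linarith

lemma IsField.taylor' {c : Euc n → V m n} (hc : IsField c) {K : ℝ} (hK : 0 ≤ K)
    (htop : ∀ α : Ix m n, deg α.1 + 1 = m → ∀ y z, |c y α - c z α| ≤ K * ‖y - z‖) (x y : Euc n)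
    (α : Ix m n) : |c y α - sh (y - x) (c x) α| ≤ CTm m n * K * ‖y - x‖ ^ (m - deg α.1) := by
  have hα := α.2
  have := hc.taylor hK htop x (m - deg α.1 - 1) α (by omega) y
  have e : m - deg α.1 - 1 + 1 = m - deg α.1 := by omega
  rw [e] at this
  refine this.trans ?_
  have := CT_le (m := m) (n := n) (k := m - deg α.1 - 1) (by omega)
  gcongr

lemma IsField.taylor0 (hm : 0 < m) {c : Euc n → V m n} (hc : IsField c) {K : ℝ} (hK : 0 ≤ K)
    (htop : ∀ α : Ix m n, deg α.1 + 1 = m → ∀ y z, |c y α - c z α| ≤ K * ‖y - z‖) (x y : Euc n) :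
    |cx (c y) 0 - pl (c x) (y - x)| ≤ CTm m n * K * ‖y - x‖ ^ m := by
  have h0 : deg (0 : Fin n → ℕ) = 0 := by simp [deg]
  have := hc.taylor' hK htop x y ⟨0, by rw [h0]; exact hm⟩
  rw [← cx_coe (c y), ← cx_coe (sh (y - x) (c x)), sh_eq_pl] at this
  simpa [h0] using this

/-- T1 -/
lemma T1 (hm : 0 < m) {F : Euc n → ℝ} {M : ℝ} (hF : CmLipNormLe m n F M) (x y : Euc n) :
    |F y - pl (tc m F x) (y - x)| ≤ CTm m n * (n * M) * ‖y - x‖ ^ m := by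
  have hM : 0 ≤ M := (abs_nonneg _).trans (hF.2.1 0 (by simp [deg]) 0)
  have h1 := (isField_tc (m := m) hF.1).taylor0 hm (K := n * M) (by positivity) ?_ x y
  · have : cx (tc m F y) 0 = F y := by
      unfold cx
      rw [dif_pos (by simpa [deg] using hm)]
      unfold tc
      rw [mD_zero, mf_zero, div_one]
    rwa [this] at h1
  · intro α hα y z
    unfold tc
    rw [← sub_div, abs_div, abs_of_pos (mf_pos α.1)]
    refine (div_le_self (abs_nonneg _) (one_le_mf _)).trans ?_
    exact axis_lip (hF.2.2 α.1 (by omega)) z y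

lemma tc_le {F : Euc n → ℝ} {M : ℝ} (hF : CmLipNormLe m n F M) (x : Euc n) (α : Ix m n) :
    |tc m F x α| ≤ M := by
  unfold tc
  rw [abs_div, abs_of_pos (mf_pos α.1)]
  have := α.2
  exact (div_le_self (abs_nonneg _) (one_le_mf _)).trans (hF.2.1 α.1 (by omega) x)

/-- constant for local expansions -/
def CL (m n : ℕ) : ℝ := C3 m n * (1 + 2 ^ m)
lemma one_le_CL : 1 ≤ CL m n := by
  unfold CL
  have := one_le_C3 (m := m) (n := n)
  have : (0:ℝ) ≤ 2 ^ m := by positivity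
  nlinarith

lemma loc_compare {F : Euc n → ℝ} {M : ℝ} {c d : V m n} {z x : Euc n} {δ : ℝ} (hδ : 0 < δ) (hzx : ‖z - x‖ ≤ δ)
    (hc : ∀ y, ‖y - z‖ ≤ δ → |F y - pl c (y - z)| ≤ M * ‖y - z‖ ^ m)
    (hd : ∀ y, ‖y - z‖ ≤ δ → |F y - pl d (y - x)| ≤ M * ‖y - x‖ ^ m) (hM : 0 ≤ M) :
    nm δ (c - sh (z - x) d) ≤ CL m n * M := by
  have := nm_le_of_ball (B := (1 + 2 ^ m) * M) hδ (c - sh (z - x) d) fun k hk => ?_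
  · refine this.trans (le_of_eq ?_); unfold CL; ring
  · have h1 := hc (z + k) (by simpa using hk)
    have h2 := hd (z + k) (by simpa using hk)
    have e1 : z + k - z = k := by abel
    have e2 : z + k - x = z - x + k := by abel
    rw [e1] at h1
    rw [e2, ← pl_sh] at h2
    rw [pl_sub]
    have h3 : ‖k‖ ^ m ≤ δ ^ m := pow_le_pow_left₀ (norm_nonneg _) hk _
    have h4 : ‖z - x + k‖ ^ m ≤ (2 * δ) ^ m := pow_le_pow_left₀ (norm_nonneg _) ((norm_add_le _ _).trans (by linarith)) _
    rw [mul_pow] at h4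
    have h5 : M * ‖k‖ ^ m ≤ M * δ ^ m := by gcongr
    have h6 : M * ‖z - x + k‖ ^ m ≤ M * (2 ^ m * δ ^ m) := by gcongr
    rw [abs_le] at *
    constructor <;> linarith

/-- local uniform expansions imply global Taylor field (LG ⇒ G), with smoothness -/
lemma local_to_global (hm : 0 < m) {F : Euc n → ℝ} {M : ℝ} (hM : 0 ≤ M)
    (h : ∀ x0, ∃ r > 0, ∀ z, ‖z - x0‖ ≤ r → ∃ c : V m n, (∀ α, |c α| ≤ M) ∧
      ∀ y, ‖y - x0‖ ≤ r → |F y - pl c (y - z)| ≤ M * ‖y - z‖ ^ m) :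
    ∃ c : Euc n → V m n, (∀ z α, |c z α| ≤ M) ∧ IsField c ∧ (∀ z, cx (c z) 0 = F z) ∧
      (∀ α : Ix m n, deg α.1 + 1 = m → ∀ y z, |c y α - c z α| ≤ CL m n * M * ‖y - z‖) ∧
      (∀ y z, |F y - pl (c z) (y - z)| ≤ CTm m n * (CL m n * M) * ‖y - z‖ ^ m) := by
  choose r hr hex using h
  choose c hcM hcy using fun z => hex z z (by simpa using (hr z).le)
  have hCL := one_le_CL (m := m) (n := n)
  -- expansion near x0
  have hexp : ∀ x0 z y, ‖z - x0‖ ≤ r x0 / 2 → ‖y - x0‖ ≤ r x0 → |F y - pl (c z) (y - z)| ≤ M * ‖y - z‖ ^ m := by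
    intro x0 z y hz hy
    have hrx := hr x0
    obtain ⟨d, -, hd⟩ := hex x0 z (by linarith)
    have : c z - d = 0 := by
      refine pl_unique (r := min (r z) (r x0 / 2)) (M := 2 * M) (lt_min (hr z) (by linarith)) fun k hk => ?_
      have a1 := hcy z (z + k) (by simpa using hk.trans (min_le_left _ _))
      have a2 := hd (z + k) (by
        have e : z + k - x0 = (z - x0) + k := by abel
        rw [e]
        have := hk.trans (min_le_right _ _)
        exact (norm_add_le _ _).trans (by linarith))
      have e1 : z + k - z = k := by abel
      rw [e1] at a1 a2
      rw [pl_sub]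
      rw [abs_le] at *
      constructor <;> linarith
    rw [sub_eq_zero.1 this]
    exact hd y hy
  have hF0 : ∀ z, cx (c z) 0 = F z := by
    intro z
    have := hcy z z (by simpa using (hr z).le)
    rw [sub_self, norm_zero, zero_pow hm.ne', mul_zero] at this
    have h2 := abs_nonpos_iff.1 this
    rw [← sh_eq_pl, sh_zero] at h2
    linarith
  have happ : ∀ x z, ‖z - x‖ ≤ r x / 4 → ∀ α : Ix m n,
      |c z α - sh (z - x) (c x) α| ≤ CL m n * M * ‖z - x‖ ^ (m - deg α.1) := by
    intro x z hz α
    have hrx := hr x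
    rcases eq_or_ne z x with rfl | hne
    · rw [sub_self, sh_zero]; simp; positivity
    have hδ : 0 < ‖z - x‖ := norm_pos_iff.2 (sub_ne_zero.2 hne)
    have hy2 : ∀ y, ‖y - z‖ ≤ ‖z - x‖ → ‖y - x‖ ≤ r x := fun y hy => by
      have e : y - x = (y - z) + (z - x) := by abel
      rw [e]; exact (norm_add_le _ _).trans (by linarith)
    have := loc_compare hδ le_rfl (c := c z) (d := c x) (M := M) (F := F)
      (fun y hy => hexp x z y (by linarith) (hy2 y hy))
      (fun y hy => hexp x x y (by simpa using (by linarith)) (hy2 y hy)) hM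
    have h2 := coef_le_nm hδ (c z - sh (z - x) (c x)) α
    calc _ ≤ _ := h2
      _ ≤ _ := by gcongr
  have hfield : IsField c := isField_of_approx c fun x =>
    ⟨r x / 4, by linarith [hr x], CL m n * M, fun z hz α => happ x z hz α⟩
  have htop : ∀ α : Ix m n, deg α.1 + 1 = m → ∀ y z, |c y α - c z α| ≤ CL m n * M * ‖y - z‖ := by
    intro α hα y z
    refine lip_of_local (g := fun z => c z α) (fun x => ⟨r x / 4, by linarith [hr x], fun z hz => ?_⟩) (by positivity) z y
    have := happ x z hz α
    have e1 : m - deg α.1 = 1 := by omega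
    have e2 : sh (z - x) (c x) α = c x α := by
      rw [sh_apply, Finset.sum_eq_single α, bc_self, one_mul]
      · intro β _ hβ
        by_cases hab : α.1 ≤ β.1
        · have := deg_lt_of_ne hab (fun h => hβ (Subtype.ext h.symm))
          have := β.2
          omega
        · rw [bc_eq_zero _ hab, zero_mul]
      · simp
    rwa [e1, e2, pow_one] at this
  refine ⟨c, hcM, hfield, hF0, htop, fun y z => ?_⟩
  have := hfield.taylor0 hm (by positivity) htop z y
  rwa [hF0] at this

/-- T2: smoothness from a global field -/
lemma T2 (hm : 0 < m) {F : Euc n → ℝ} {M : ℝ} (hM : 0 ≤ M)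
    (h : ∀ z, ∃ c : V m n, (∀ α, |c α| ≤ M) ∧ ∀ y, |F y - pl c (y - z)| ≤ M * ‖y - z‖ ^ m) :
    CmLipNormLe m n F (m.factorial * CL m n * M) := by
  obtain ⟨c, hcM, hfield, hF0, htop, -⟩ := local_to_global hm hM (F := F) (fun x0 =>
    ⟨1, one_pos, fun z _ => by
      obtain ⟨c, h1, h2⟩ := h z
      exact ⟨c, h1, fun y _ => h2 y⟩⟩)
  have hFe : (fun z => cx (c z) 0) = F := funext hF0
  have hCL := one_le_CL (m := m) (n := n)
  have hmf : ∀ α : Ix m n, mf α.1 ≤ m.factorial := fun α => (mf_le α.1).trans (by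
    exact_mod_cast Nat.factorial_le α.2.le)
  refine ⟨?_, ?_, ?_⟩
  · have h0 : deg (0 : Fin n → ℕ) = 0 := by simp [deg]
    have := hfield.contDiff_aux (fun α hα => ?_) (m - 1) ⟨0, by rw [h0]; exact hm⟩ (by
      simp only [h0]; omega)
    · have e : (fun z => c z ⟨0, by rw [h0]; exact hm⟩) = F := by
        rw [← hFe]; funext z; rw [← cx_coe (c z)]
      rw [e] at this
      exact_mod_cast this
    · have : LipschitzWith (CL m n * M).toNNReal (fun z => c z α) := by
        refine LipschitzWith.of_dist_le_mul fun y z => ?_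
        rw [Real.dist_eq, dist_eq_norm, Real.coe_toNNReal _ (by positivity)]
        exact htop α hα y z
      exact this.continuous
  · intro α hα x
    have e := hfield.mD_eq ⟨α, by omega⟩ x
    rw [hFe] at e
    simp only at e
    rw [e, abs_mul, abs_of_pos (mf_pos α)]
    have h1 := hmf ⟨α, by omega⟩
    have h2 := hcM x ⟨α, by omega⟩
    have h3 := mf_pos α
    have : M ≤ CL m n * M := by nlinarith
    calc _ ≤ (m.factorial : ℝ) * M := by gcongr
      _ ≤ m.factorial * (CL m n * M) := by gcongr
      _ = _ := by ring
  · intro α hα i x t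
    have e := hfield.mD_eq ⟨α, by omega⟩
    rw [hFe] at e
    simp only at e
    rw [e, e, ← mul_sub, abs_mul, abs_of_pos (mf_pos α)]
    have h1 := hmf ⟨α, by omega⟩
    have h2 := htop ⟨α, by omega⟩ (by simp only; omega) (x + t • EuclideanSpace.single i 1) x
    have h4 : ‖x + t • EuclideanSpace.single i (1:ℝ) - x‖ = |t| := by
      rw [add_sub_cancel_left, norm_smul]; simp
    rw [h4] at h2
    have h3 := mf_pos α
    calc _ ≤ (m.factorial : ℝ) * (CL m n * M * |t|) := by gcongr
      _ = _ := by ring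

end FP


namespace FP
variable {m n : ℕ}

/-- number of multi-indices -/
def DD (m n : ℕ) : ℝ := Fintype.card (Ix m n)
lemma DD_nonneg : 0 ≤ DD m n := by unfold DD; positivity

/-- centered jets -/
def JC (F : Euc n → ℝ) (z : Euc n) (c : V m n) (M : ℝ) : Prop :=
  (∀ α, |c α| ≤ M) ∧ ∀ y, |F y - pl c (y - z)| ≤ M * ‖y - z‖ ^ m

def JetAt (F : Euc n → ℝ) (x : Euc n) (p : V m n) (M : ℝ) : Prop := JC F x (sh x p) M

def Good (m : ℕ) (F : Euc n → ℝ) (M : ℝ) : Prop := ∀ z, ∃ c : V m n, JC F z c M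

lemma JC.nonneg {F : Euc n → ℝ} {z : Euc n} {c : V m n} {M : ℝ} (hm : 0 < m) (h : JC F z c M) : 0 ≤ M :=
  (abs_nonneg _).trans (h.1 ⟨0, by simpa [deg] using hm⟩)

lemma JC.mono {F : Euc n → ℝ} {z : Euc n} {c : V m n} {M M' : ℝ} (h : JC F z c M) (hM : M ≤ M') :
    JC F z c M' :=
  ⟨fun α => (h.1 α).trans hM, fun y => (h.2 y).trans (by gcongr)⟩

lemma Good.mono {F : Euc n → ℝ} {M M' : ℝ} (h : Good m F M) (hM : M ≤ M') : Good m F M' := fun z => by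
  obtain ⟨c, hc⟩ := h z
  exact ⟨c, hc.mono hM⟩

lemma JC.add {F G : Euc n → ℝ} {z : Euc n} {c d : V m n} {M M' : ℝ} (h : JC F z c M) (h' : JC G z d M') :
    JC (fun y => F y + G y) z (c + d) (M + M') := by
  refine ⟨fun α => (abs_add_le _ _).trans (add_le_add (h.1 α) (h'.1 α)), fun y => ?_⟩
  rw [pl_add, add_mul]
  have e : F y + G y - (pl c (y - z) + pl d (y - z)) = (F y - pl c (y - z)) + (G y - pl d (y - z)) := by ring
  rw [e]
  exact (abs_add_le _ _).trans (add_le_add (h.2 y) (h'.2 y))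

lemma JC.smul {F : Euc n → ℝ} {z : Euc n} {c : V m n} {M : ℝ} (t : ℝ) (h : JC F z c M) :
    JC (fun y => t * F y) z (t • c) (|t| * M) := by
  refine ⟨fun α => ?_, fun y => ?_⟩
  · simp only [Pi.smul_apply, smul_eq_mul, abs_mul]
    gcongr; exact h.1 α
  · rw [pl_smul, ← mul_sub, abs_mul, mul_assoc]
    gcongr; exact h.2 y

lemma JC.congr {F G : Euc n → ℝ} {z : Euc n} {c d : V m n} {M M' : ℝ} (h : JC F z c M) (h1 : F = G) (h2 : c = d)
    (h3 : M = M') : JC G z d M' := by subst h1 h2 h3; exact h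

lemma JC.sub {F G : Euc n → ℝ} {z : Euc n} {c d : V m n} {M M' : ℝ} (h : JC F z c M) (h' : JC G z d M') :
    JC (fun y => F y - G y) z (c - d) (M + M') :=
  (h.add (h'.smul (-1))).congr (by funext y; ring) (by module) (by simp)

lemma JC.convex {F G : Euc n → ℝ} {z : Euc n} {c d : V m n} {M : ℝ} {s t : ℝ} (hs : 0 ≤ s) (ht : 0 ≤ t)
    (hst : s + t = 1) (h : JC F z c M) (h' : JC G z d M) :
    JC (fun y => s * F y + t * G y) z (s • c + t • d) M :=
  ((h.smul s).add (h'.smul t)).congr rfl rfl (by rw [abs_of_nonneg hs, abs_of_nonneg ht, ← add_mul, hst, one_mul])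

lemma JC.unique {F : Euc n → ℝ} {z : Euc n} {c d : V m n} {M M' r : ℝ} (hr : 0 < r)
    (h : ∀ y, ‖y - z‖ ≤ r → |F y - pl c (y - z)| ≤ M * ‖y - z‖ ^ m)
    (h' : ∀ y, ‖y - z‖ ≤ r → |F y - pl d (y - z)| ≤ M' * ‖y - z‖ ^ m) : c = d := by
  refine sub_eq_zero.1 (pl_unique (M := M + M') hr fun k hk => ?_)
  have a1 := h (z + k) (by simpa using hk)
  have a2 := h' (z + k) (by simpa using hk)
  rw [add_sub_cancel_left] at a1 a2
  rw [pl_sub, add_mul]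
  rw [abs_le] at *
  constructor <;> linarith

/-- constant in `good_of_local` -/
def CG (m n : ℕ) : ℝ := CTm m n * CL m n
lemma one_le_CG : 1 ≤ CG m n := by
  unfold CG; nlinarith [one_le_CTm (m := m) (n := n), one_le_CL (m := m) (n := n)]

lemma good_of_local (hm : 0 < m) {F : Euc n → ℝ} {M : ℝ} (hM : 0 ≤ M)
    (h : ∀ x0, ∃ r > 0, ∀ z, ‖z - x0‖ ≤ r → ∃ c : V m n, (∀ α, |c α| ≤ M) ∧
      ∀ y, ‖y - x0‖ ≤ r → |F y - pl c (y - z)| ≤ M * ‖y - z‖ ^ m) : Good m F (CG m n * M) := by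
  obtain ⟨c, h1, -, -, -, h2⟩ := local_to_global hm hM h
  intro z
  refine ⟨c z, fun α => (h1 z α).trans ?_, fun y => (h2 y z).trans (le_of_eq ?_)⟩
  · nlinarith [one_le_CG (m := m) (n := n)]
  · unfold CG; ring

/-- compatibility of jets of the same function -/
lemma JC.compat {F : Euc n → ℝ} {x y : Euc n} {c d : V m n} {M δ : ℝ} (hδ : 0 < δ) (hxy : ‖x - y‖ ≤ δ)
    (hM : 0 ≤ M) (h : JC F x c M) (h' : JC F y d M) : nm δ (c - sh (x - y) d) ≤ CL m n * M :=
  loc_compare hδ hxy (fun w _ => h.2 w) (fun w _ => h'.2 w) hM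

lemma JetAt.compat {F : Euc n → ℝ} {x y : Euc n} {p q : V m n} {M δ : ℝ} (hδ : 0 < δ) (hxy : ‖x - y‖ ≤ δ)
    (hM : 0 ≤ M) (h : JetAt F x p M) (h' : JetAt F y q M) : nm δ (sh x (p - q)) ≤ CL m n * M := by
  have := JC.compat hδ hxy hM h h'
  rwa [← co_change, ← map_sub] at this

lemma Good.jetAt {F : Euc n → ℝ} {M : ℝ} (h : Good m F M) (x : Euc n) : ∃ p : V m n, JetAt F x p M := by
  obtain ⟨c, hc⟩ := h x
  exact ⟨sh (-x) c, by unfold JetAt; rwa [sh_sh_neg]⟩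

/-! truncated products -/

def tmul (c d : V m n) : V m n := fun α => ∑ β : Ix m n, ∑ γ : Ix m n,
  if β.1 + γ.1 = α.1 then c β * d γ else 0

lemma sum_ix_ite (γ : Fin n → ℕ) (t : ℝ) (f : (Fin n → ℕ) → ℝ) :
    ∑ α : Ix m n, (if γ = α.1 then t else 0) * f α.1 = if deg γ < m then t * f γ else 0 := by
  classical
  split_ifs with h
  · rw [Finset.sum_eq_single ⟨γ, h⟩]
    · simp
    · intro b _ hb
      rw [if_neg, zero_mul]; intro h'; exact hb (Subtype.ext h'.symm)
    · simp
  · refine Finset.sum_eq_zero fun b _ => ?_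
    rw [if_neg, zero_mul]; intro h'; exact h (h' ▸ b.2)

lemma sum_tmul (c d : V m n) (f : (Fin n → ℕ) → ℝ) :
    ∑ α : Ix m n, tmul c d α * f α.1 = ∑ β : Ix m n, ∑ γ : Ix m n,
      if deg (β.1 + γ.1) < m then c β * d γ * f (β.1 + γ.1) else 0 := by
  unfold tmul
  simp_rw [Finset.sum_mul]
  rw [Finset.sum_comm]
  refine Finset.sum_congr rfl fun β _ => ?_
  rw [Finset.sum_comm]
  refine Finset.sum_congr rfl fun γ _ => ?_
  exact sum_ix_ite _ _ _

lemma N_tmul {s : ℝ} (hs : 0 ≤ s) (c d : V m n) : N s (tmul c d) ≤ N s c * N s d := by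
  have h1 : N s (tmul c d) ≤ ∑ α : Ix m n, tmul (fun β => |c β|) (fun γ => |d γ|) α * s ^ deg α.1 := by
    unfold N
    refine Finset.sum_le_sum fun α _ => ?_
    gcongr
    unfold tmul
    refine (Finset.abs_sum_le_sum_abs _ _).trans (Finset.sum_le_sum fun β _ => ?_)
    refine (Finset.abs_sum_le_sum_abs _ _).trans (Finset.sum_le_sum fun γ _ => ?_)
    split_ifs <;> simp [abs_mul]
  refine h1.trans ?_
  rw [sum_tmul _ _ (fun α => s ^ deg α)]
  unfold N
  rw [Finset.sum_mul_sum]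
  refine Finset.sum_le_sum fun β _ => Finset.sum_le_sum fun γ _ => ?_
  split_ifs
  · rw [deg_add, pow_add]; apply le_of_eq; ring
  · positivity

lemma pl_tmul {s : ℝ} (hs : 0 < s) (c d : V m n) {h : Euc n} (hh : ‖h‖ ≤ s) :
    |pl c h * pl d h - pl (tmul c d) h| ≤ N s c * N s d * (‖h‖ / s) ^ m := by
  have e1 : pl c h * pl d h = ∑ β : Ix m n, ∑ γ : Ix m n, c β * d γ * mono (β.1 + γ.1) h := by
    unfold pl
    rw [Finset.sum_mul_sum]
    exact Finset.sum_congr rfl fun β _ => Finset.sum_congr rfl fun γ _ => by rw [mono_add_idx]; ring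
  have e2 : pl (tmul c d) h = _ := sum_tmul c d (fun α => mono α h)
  have hr : ‖h‖ / s ≤ 1 := (div_le_one hs).2 hh
  rw [e1, e2, ← Finset.sum_sub_distrib]
  unfold N
  rw [Finset.sum_mul_sum, Finset.sum_mul]
  refine (Finset.abs_sum_le_sum_abs _ _).trans (Finset.sum_le_sum fun β _ => ?_)
  rw [← Finset.sum_sub_distrib, Finset.sum_mul]
  refine (Finset.abs_sum_le_sum_abs _ _).trans (Finset.sum_le_sum fun γ _ => ?_)
  split_ifs with hd
  · rw [sub_self, abs_zero]; positivity
  · rw [sub_zero, abs_mul, abs_mul]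
    have h1 := abs_mono_le (β.1 + γ.1) h
    have h2 : ‖h‖ ^ deg (β.1 + γ.1) ≤ s ^ deg β.1 * s ^ deg γ.1 * (‖h‖ / s) ^ m := by
      have : ‖h‖ ^ deg (β.1 + γ.1) = s ^ deg β.1 * s ^ deg γ.1 * (‖h‖ / s) ^ deg (β.1 + γ.1) := by
        rw [div_pow, deg_add, pow_add s]; field_simp
      rw [this]
      have : (‖h‖ / s) ^ deg (β.1 + γ.1) ≤ (‖h‖ / s) ^ m :=
        pow_le_pow_of_le_one (by positivity) hr (by omega)
      gcongr
    calc _ ≤ |c β| * |d γ| * (s ^ deg β.1 * s ^ deg γ.1 * (‖h‖ / s) ^ m) := by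
          gcongr; exact h1.trans h2
      _ = _ := by ring

lemma N_scale {s t : ℝ} (hs : 0 ≤ s) (ht : 1 ≤ t) (c : V m n) : N (t * s) c ≤ t ^ m * N s c := by
  unfold N
  rw [Finset.mul_sum]
  refine Finset.sum_le_sum fun α _ => ?_
  have : t ^ deg α.1 ≤ t ^ m := pow_le_pow_right₀ ht α.2.le
  rw [mul_pow]
  calc |c α| * (t ^ deg α.1 * s ^ deg α.1) = t ^ deg α.1 * (|c α| * s ^ deg α.1) := by ring
    _ ≤ _ := by gcongr

/-! normalized expansions -/

def JA (ψ : Euc n → ℝ) (z : Euc n) (c : V m n) (s K : ℝ) : Prop :=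
  N s c ≤ K ∧ ∀ y, |ψ y - pl c (y - z)| ≤ K * (‖y - z‖ / s) ^ m

lemma JA.nonneg {ψ : Euc n → ℝ} {z : Euc n} {c : V m n} {s K : ℝ} (hs : 0 ≤ s) (h : JA ψ z c s K) : 0 ≤ K :=
  (N_nonneg hs c).trans h.1

lemma JA.at_center (hm : 0 < m) {ψ : Euc n → ℝ} {z : Euc n} {c : V m n} {s K : ℝ} (hs : 0 ≤ s)
    (h : JA ψ z c s K) : |ψ z| ≤ K := by
  have h1 := h.2 z
  rw [sub_self, norm_zero, zero_div, zero_pow hm.ne', mul_zero] at h1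
  have h2 := abs_pl_le c (0 : Euc n)
  rw [norm_zero] at h2
  have h3 := N_mono le_rfl hs c
  have : ψ z = pl c 0 := by
    have := abs_nonpos_iff.1 h1; linarith
  rw [this]; linarith [h.1]

lemma JA.mul {ψ G : Euc n → ℝ} {z : Euc n} {c d : V m n} {s K1 K2 : ℝ} (hs : 0 < s)
    (hψ : ∀ y, |ψ y| ≤ K1) (h1 : JA ψ z c s K1) (h2 : JA G z d s K2) :
    JA (fun y => ψ y * G y) z (tmul c d) s (4 * K1 * K2) := by
  have hK1 := h1.nonneg hs.le
  have hK2 := h2.nonneg hs.le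
  have hN : N s (tmul c d) ≤ K1 * K2 :=
    (N_tmul hs.le c d).trans (mul_le_mul h1.1 h2.1 (N_nonneg hs.le _) hK1)
  refine ⟨hN.trans (by nlinarith [mul_nonneg hK1 hK2]), fun y => ?_⟩
  set h := y - z
  set t := ‖h‖ / s with ht
  have ht0 : 0 ≤ t := by positivity
  have hhs : ‖h‖ = t * s := by rw [ht]; field_simp
  rcases le_or_gt t 1 with ht1 | ht1
  · have hle : ‖h‖ ≤ s := by rw [hhs]; nlinarith
    have a1 := h1.2 y
    have a2 := h2.2 y
    have a3 := pl_tmul hs c d hle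
    have a4 : |pl c h| ≤ K1 := (abs_pl_le c h).trans ((N_mono (norm_nonneg _) hle c).trans h1.1)
    have a5 : |pl d h| ≤ K2 := (abs_pl_le d h).trans ((N_mono (norm_nonneg _) hle d).trans h2.1)
    have htm : t ^ m ≤ 1 := pow_le_one₀ ht0 ht1
    have htm0 : 0 ≤ t ^ m := by positivity
    have a6 : |G y| ≤ 2 * K2 := by
      have : G y = (G y - pl d h) + pl d h := by ring
      rw [this]
      refine (abs_add_le _ _).trans ?_
      have : K2 * t ^ m ≤ K2 := by nlinarith
      linarith
    have e : ψ y * G y - pl (tmul c d) h = (ψ y - pl c h) * G y + pl c h * (G y - pl d h)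
        + (pl c h * pl d h - pl (tmul c d) h) := by ring
    rw [e]
    refine (abs_add_three _ _ _).trans ?_
    rw [abs_mul, abs_mul]
    have b1 : |ψ y - pl c h| * |G y| ≤ (K1 * t ^ m) * (2 * K2) := by gcongr
    have b2 : |pl c h| * |G y - pl d h| ≤ K1 * (K2 * t ^ m) := by gcongr
    have b3 : N s c * N s d * t ^ m ≤ K1 * K2 * t ^ m := by
      have := N_nonneg hs.le d
      gcongr
      exacts [h1.1, h2.1]
    nlinarith
  · have a2 := h2.2 y
    have htm0 : 0 ≤ t ^ m := by positivity
    have hd : |pl d h| ≤ t ^ m * K2 := by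
      refine (abs_pl_le d h).trans ?_
      rw [hhs]
      refine (N_scale hs.le ht1.le d).trans ?_
      gcongr; exact h2.1
    have hcd : |pl (tmul c d) h| ≤ t ^ m * (K1 * K2) := by
      refine (abs_pl_le _ h).trans ?_
      rw [hhs]
      refine (N_scale hs.le ht1.le _).trans ?_
      gcongr
    have hG : |G y| ≤ 2 * K2 * t ^ m := by
      have : G y = (G y - pl d h) + pl d h := by ring
      rw [this]
      refine (abs_add_le _ _).trans ?_
      linarith
    have hp : |ψ y * G y| ≤ K1 * (2 * K2 * t ^ m) := by
      rw [abs_mul]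
      exact mul_le_mul (hψ y) hG (abs_nonneg _) hK1
    refine (abs_sub _ _).trans ?_
    nlinarith [mul_nonneg (mul_nonneg hK1 hK2) htm0]

def SG (m : ℕ) (ψ : Euc n → ℝ) (s K : ℝ) : Prop := ∀ z, ∃ c : V m n, JA ψ z c s K

lemma SG.bound (hm : 0 < m) {ψ : Euc n → ℝ} {s K : ℝ} (hs : 0 ≤ s) (h : SG m ψ s K) (y : Euc n) : |ψ y| ≤ K := by
  obtain ⟨c, hc⟩ := h y
  exact hc.at_center hm hs

lemma SG.nonneg {ψ : Euc n → ℝ} {s K : ℝ} (hs : 0 ≤ s) (h : SG m ψ s K) : 0 ≤ K := by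
  obtain ⟨c, hc⟩ := h 0
  exact hc.nonneg hs

lemma SG.mul (hm : 0 < m) {ψ φ : Euc n → ℝ} {s K1 K2 : ℝ} (hs : 0 < s) (h : SG m ψ s K1) (h' : SG m φ s K2) :
    SG m (fun y => ψ y * φ y) s (4 * K1 * K2) := fun z => by
  obtain ⟨c, hc⟩ := h z
  obtain ⟨d, hd⟩ := h' z
  exact ⟨_, hc.mul hs (h.bound hm hs.le) hd⟩

lemma SG.mono {ψ : Euc n → ℝ} {s K K' : ℝ} (hs : 0 ≤ s) (h : SG m ψ s K) (hK : K ≤ K') : SG m ψ s K' := fun z => by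
  obtain ⟨c, hc⟩ := h z
  exact ⟨c, hc.1.trans hK, fun y => (hc.2 y).trans (by gcongr)⟩

lemma SG.rescale {ψ : Euc n → ℝ} {s s' K : ℝ} (hs : 0 < s') (hss : s' ≤ s) (h : SG m ψ s K) : SG m ψ s' K :=
  fun z => by
  obtain ⟨c, hc⟩ := h z
  have hK := hc.nonneg (hs.le.trans hss)
  have hs' : 0 < s := hs.trans_le hss
  exact ⟨c, (N_mono hs.le hss c).trans hc.1, fun y => (hc.2 y).trans (by gcongr)⟩

lemma N_add {s : ℝ} (hs : 0 ≤ s) (c d : V m n) : N s (c + d) ≤ N s c + N s d := by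
  unfold N
  rw [← Finset.sum_add_distrib]
  refine Finset.sum_le_sum fun α _ => ?_
  rw [← add_mul]
  have := abs_add_le (c α) (d α)
  simp only [Pi.add_apply]; gcongr

lemma N_neg {s : ℝ} (c : V m n) : N s (-c) = N s c := by simp [N]

lemma SG.one_sub (hm : 0 < m) {ψ : Euc n → ℝ} {s K : ℝ} (hs : 0 < s) (h : SG m ψ s K) :
    SG m (fun y => 1 - ψ y) s (1 + K) := fun z => by
  classical
  obtain ⟨c, hc⟩ := h z
  have hK := hc.nonneg hs.le
  set o : Ix m n := ⟨0, by simpa [deg] using hm⟩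
  have ho : deg o.1 = 0 := by simp [o, deg]
  have hN : N s (Pi.single o 1 : V m n) = 1 := by
    unfold N
    rw [Finset.sum_eq_single o]
    · simp [ho]
    · intro b _ hb; simp [hb]
    · simp
  have hpl : ∀ h : Euc n, pl (Pi.single o 1 : V m n) h = 1 := by
    intro h
    unfold pl
    rw [Finset.sum_eq_single o]
    · simp [o, FP.mono]
    · intro b _ hb; simp [hb]
    · simp
  refine ⟨Pi.single o 1 + -c, ?_, fun y => ?_⟩
  · refine (N_add hs.le _ _).trans ?_
    rw [hN, N_neg]; linarith [hc.1]
  · rw [← sub_eq_add_neg, pl_sub, hpl]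
    have := hc.2 y
    have e : 1 - ψ y - (1 - pl c (y - z)) = -(ψ y - pl c (y - z)) := by ring
    rw [e, abs_neg]
    refine this.trans ?_
    gcongr; linarith

lemma SG.finset_prod (hm : 0 < m) {ι : Type*} {s K : ℝ} (hs : 0 < s) (T : Finset ι) (φ : Euc n → ℝ)
    (θ : ι → Euc n → ℝ)
    (hφ : SG m φ s K) (h : ∀ i ∈ T, SG m (θ i) s K) :
    SG m (fun y => φ y * ∏ i ∈ T, θ i y) s ((4 * K) ^ T.card * K) := by
  classical
  induction T using Finset.induction_on with
  | empty => simpa using hφ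
  | insert a T ha ih =>
    have h1 := ih fun i hi => h i (Finset.mem_insert_of_mem hi)
    have h2 := (h a (Finset.mem_insert_self _ _)).mul hm hs h1
    rw [Finset.card_insert_of_notMem ha]
    convert h2 using 1
    · funext y; rw [Finset.prod_insert ha]; ring
    · ring

/-- product of a normalized cutoff with a jet -/
lemma JA.mulJC {ψ G : Euc n → ℝ} {z : Euc n} {c d : V m n} {s K M : ℝ} (hs : 0 < s) (hm : 0 < m)
    (hψ : ∀ y, |ψ y| ≤ K) (h1 : JA ψ z c s K) (h2 : JC G z d M) (h3 : nm s d ≤ M) :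
    JC (fun y => ψ y * G y) z (tmul c d) (4 * (DD m n + 1) * K * M) := by
  have hK := h1.nonneg hs.le
  have hM := h2.nonneg hm
  have hD := DD_nonneg (m := m) (n := n)
  have hJ : JA G z d s (M * s ^ m) := by
    refine ⟨?_, fun y => (h2.2 y).trans (le_of_eq ?_)⟩
    · rw [N_eq hs]; gcongr
    · rw [div_pow]; field_simp
  have hp := h1.mul hs hψ hJ
  have hKM : 0 ≤ K * M := mul_nonneg hK hM
  refine ⟨fun α => ?_, fun y => (hp.2 y).trans ?_⟩
  · have hα := α.2
    rcases le_total s 1 with hs1 | hs1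
    · have a1 : |tmul c d α| * s ^ deg α.1 ≤ 4 * K * (M * s ^ m) :=
        (Finset.single_le_sum (f := fun α : Ix m n => |tmul c d α| * s ^ deg α.1)
          (fun _ _ => by positivity) (Finset.mem_univ α)).trans hp.1
      have a2 : s ^ m ≤ s ^ deg α.1 := pow_le_pow_of_le_one hs.le hs1 hα.le
      have a3 : |tmul c d α| * s ^ deg α.1 ≤ (4 * K * M) * s ^ deg α.1 := by
        refine a1.trans ?_
        calc _ = 4 * K * M * s ^ m := by ring
          _ ≤ _ := by gcongr
      have := le_of_mul_le_mul_right a3 (by positivity)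
      nlinarith
    · have a1 : |tmul c d α| ≤ N 1 (tmul c d) := by
        have := Finset.single_le_sum (f := fun α : Ix m n => |tmul c d α| * (1:ℝ) ^ deg α.1)
          (fun _ _ => by positivity) (Finset.mem_univ α)
        simpa [N] using this
      have a2 := N_tmul zero_le_one c d
      have a3 : N 1 c ≤ K := (N_mono zero_le_one hs1 c).trans h1.1
      have a4 : N 1 d ≤ DD m n * M := by
        unfold N
        refine (Finset.sum_le_card_nsmul _ _ M fun α _ => ?_).trans (by simp [DD])
        simpa using h2.1 α
      have a5 : N 1 c * N 1 d ≤ K * (DD m n * M) := by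
        have := N_nonneg zero_le_one d
        gcongr
      have : |tmul c d α| ≤ DD m n * (K * M) := by linarith
      nlinarith [mul_nonneg hD hKM]
  · rw [div_pow]
    have : 4 * K * (M * s ^ m) * (‖y - z‖ ^ m / s ^ m) = 4 * K * M * ‖y - z‖ ^ m := by field_simp
    rw [this]
    have : 0 ≤ ‖y - z‖ ^ m := by positivity
    gcongr
    nlinarith

/-! bumps -/

lemma hasCompactSupport_foldr (l : List (Fin n)) {F : Euc n → ℝ} (hF : HasCompactSupport F) :
    HasCompactSupport (l.foldr pD F) := by
  induction l with
  | nil => exact hF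
  | cons a l ih =>
    rw [List.foldr_cons]
    exact ih.fderiv_apply (𝕜 := ℝ) _

lemma cmLip_of_smooth (hm : 0 < m) {F : Euc n → ℝ} (hF : ContDiff ℝ m F) (hc : HasCompactSupport F) :
    ∃ M : ℝ, CmLipNormLe m n F M := by
  have h1 : ∀ α : Ix m n, ContDiff ℝ (1 : ℕ) (mD α.1 F) := fun α =>
    mD_contDiff α.1 1 (hF.of_le (by norm_cast; exact α.2))
  have h2 : ∀ α : Ix m n, HasCompactSupport (mD α.1 F) := fun α => hasCompactSupport_foldr _ hc
  have h3 : ∀ α : Ix m n, ∃ C : ℝ, 0 ≤ C ∧ ∀ x, |mD α.1 F x| ≤ C := fun α => by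
    obtain ⟨C, hC⟩ := (h1 α).continuous.bounded_above_of_compact_support (h2 α)
    exact ⟨C, (norm_nonneg _).trans (hC 0), fun x => hC x⟩
  have h4 : ∀ α : Ix m n, ∃ C : NNReal, LipschitzWith C (mD α.1 F) := fun α =>
    (h1 α).lipschitzWith_of_hasCompactSupport (h2 α) (by simp)
  choose C hC0 hC using h3
  choose K hK using h4
  refine ⟨∑ α, C α + ∑ α, (K α : ℝ), ?_, ?_, ?_⟩
  · exact_mod_cast hF.of_le (by norm_cast; omega)
  · intro α hα x
    have := Finset.single_le_sum (f := C) (fun i _ => hC0 i) (Finset.mem_univ ⟨α, by omega⟩)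
    have h5 : 0 ≤ ∑ α, (K α : ℝ) := by positivity
    have := hC ⟨α, by omega⟩ x
    linarith
  · intro α hα i x t
    have h6 := Finset.single_le_sum (f := fun α => (K α : ℝ)) (fun i _ => by positivity) (Finset.mem_univ ⟨α, by omega⟩)
    have h5 : 0 ≤ ∑ α, C α := Finset.sum_nonneg fun i _ => hC0 i
    have h7 := (hK ⟨α, by omega⟩).dist_le_mul (x + t • EuclideanSpace.single i 1) x
    rw [Real.dist_eq, dist_eq_norm, add_sub_cancel_left, norm_smul] at h7
    simp only [EuclideanSpace.norm_single, norm_one, mul_one, Real.norm_eq_abs] at h7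
    refine h7.trans ?_
    gcongr
    linarith

lemma sg_of_smooth (hm : 0 < m) {F : Euc n → ℝ} (hF : ContDiff ℝ m F) (hc : HasCompactSupport F) :
    ∃ K : ℝ, 1 ≤ K ∧ SG m F 1 K := by
  obtain ⟨M, hM⟩ := cmLip_of_smooth hm hF hc
  have hM0 : 0 ≤ M := (abs_nonneg _).trans (hM.2.1 0 (by simp [deg]) 0)
  have hCT := one_le_CTm (m := m) (n := n)
  refine ⟨1 + DD m n * M + CTm m n * (n * M), ?_, fun z => ⟨tc m F z, ?_, fun y => ?_⟩⟩
  · have : 0 ≤ DD m n * M := mul_nonneg DD_nonneg hM0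
    have : 0 ≤ CTm m n * (n * M) := by positivity
    linarith
  · have : N 1 (tc m F z) ≤ DD m n * M := by
      unfold N
      refine (Finset.sum_le_card_nsmul _ _ M fun α _ => ?_).trans (by simp [DD])
      simpa using tc_le hM z α
    have : 0 ≤ CTm m n * (n * M) := by positivity
    linarith
  · refine (T1 hm hM z y).trans ?_
    rw [div_one]
    have : 0 ≤ DD m n * M := mul_nonneg DD_nonneg hM0
    gcongr
    linarith

lemma SG.scale {ψ : Euc n → ℝ} {K δ : ℝ} (hδ : 0 < δ) (h : SG m ψ 1 K) (x : Euc n) :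
    SG m (fun y => ψ (δ⁻¹ • (y - x))) δ K := fun z => by
  obtain ⟨c, hc⟩ := h (δ⁻¹ • (z - x))
  refine ⟨fun α => c α / δ ^ deg α.1, ?_, fun y => ?_⟩
  · refine le_trans (le_of_eq ?_) hc.1
    unfold N
    refine Finset.sum_congr rfl fun α _ => ?_
    rw [abs_div, abs_of_pos (show 0 < δ ^ deg α.1 by positivity)]
    field_simp; simp
  · have e : δ⁻¹ • (y - x) - δ⁻¹ • (z - x) = δ⁻¹ • (y - z) := by rw [← smul_sub]; congr 1; abel
    have h1 := hc.2 (δ⁻¹ • (y - x))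
    have e2 : pl (fun α : Ix m n => c α / δ ^ deg α.1) (y - z) = pl c (δ⁻¹ • (y - z)) := by
      unfold pl
      refine Finset.sum_congr rfl fun α _ => ?_
      rw [mono_smul, inv_pow]; field_simp
    rw [e, ← e2, div_one, norm_smul, Real.norm_of_nonneg (by positivity)] at h1
    rw [div_eq_inv_mul]; exact h1

end FP


namespace FP
variable {m n : ℕ}

/-- unit coefficient vector -/
def ev (γ : Ix m n) : V m n := fun α => if α = γ then 1 else 0

lemma pl_ev (γ : Ix m n) (h : Euc n) : pl (ev γ) h = mono γ.1 h := by
  classical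
  unfold pl
  rw [Finset.sum_eq_single γ]
  · simp [ev]
  · intro b _ hb; simp [ev, hb]
  · simp

/-- truncated multiplication by the normalized monomial `((·-x)/δ)^γ` -/
def mulX (x : Euc n) (δ : ℝ) (γ : Ix m n) (q : V m n) : V m n :=
  (δ ^ deg γ.1)⁻¹ • sh (-x) (tmul (ev γ) (sh x q))

def c0 (m : ℕ) : ℝ := (1 / 2) ^ (m + 1)
lemma c0_pos : 0 < c0 m := by unfold c0; positivity

lemma exists_cut (hm : 0 < m) : ∃ K : ℝ, 1 ≤ K ∧ ∀ γ : Ix m n, ∃ φ : Euc n → ℝ, SG m φ 1 K ∧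
    (∀ y, |φ y| ≤ 1 / 2) ∧ (∀ y, 2 ≤ ‖y‖ → φ y = 0) ∧ (∀ y, ‖y‖ ≤ 1 → φ y = c0 m * mono γ.1 y) := by
  classical
  have key : ∀ γ : Ix m n, ∃ K : ℝ, 1 ≤ K ∧ ∃ φ : Euc n → ℝ, SG m φ 1 K ∧
    (∀ y, |φ y| ≤ 1 / 2) ∧ (∀ y, 2 ≤ ‖y‖ → φ y = 0) ∧ (∀ y, ‖y‖ ≤ 1 → φ y = c0 m * mono γ.1 y) := by
    intro γ
    let χ : ContDiffBump (0 : Euc n) := ⟨1, 2, by norm_num, by norm_num⟩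
    let φ : Euc n → ℝ := fun y => χ y * (c0 m * mono γ.1 y)
    have hmono : ContDiff ℝ m (fun y : Euc n => c0 m * mono γ.1 y) := by
      unfold mono; fun_prop
    have hs : ContDiff ℝ m φ := χ.contDiff.mul hmono
    have hc : HasCompactSupport φ := χ.hasCompactSupport.mul_right
    have h0 : ∀ y, 2 ≤ ‖y‖ → φ y = 0 := fun y hy => by
      simp only [φ]; rw [χ.zero_of_le_dist (by simpa [χ] using hy), zero_mul]
    obtain ⟨K, hK, hSG⟩ := sg_of_smooth hm hs hc
    refine ⟨K, hK, φ, hSG, fun y => ?_, h0, fun y hy => ?_⟩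
    · rcases le_or_gt 2 ‖y‖ with h | h
      · rw [h0 y h]; norm_num
      · simp only [φ]
        rw [abs_mul, abs_mul, abs_of_pos c0_pos, abs_of_nonneg χ.nonneg]
        have h1 : |mono γ.1 y| ≤ 2 ^ m := by
          refine (abs_mono_le _ _).trans ?_
          calc ‖y‖ ^ deg γ.1 ≤ 2 ^ deg γ.1 := by gcongr
            _ ≤ 2 ^ m := pow_le_pow_right₀ (by norm_num) γ.2.le
        calc χ y * (c0 m * |mono γ.1 y|) ≤ 1 * (c0 m * 2 ^ m) := by
              have := c0_pos (m := m)
              gcongr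
              exact χ.le_one
          _ = 1 / 2 := by
              unfold c0; rw [pow_succ, one_mul, mul_right_comm, ← mul_pow]; norm_num
    · simp only [φ]
      rw [χ.one_of_mem_closedBall (by simpa [χ] using hy), one_mul]
  choose K hK φ hφ using key
  refine ⟨1 + ∑ γ, K γ, ?_, fun γ => ⟨φ γ, (hφ γ).1.mono zero_le_one ?_, (hφ γ).2⟩⟩
  · have : 0 ≤ ∑ γ, K γ := Finset.sum_nonneg fun i _ => zero_le_one.trans (hK i)
    linarith
  · have := Finset.single_le_sum (f := K) (fun i _ => zero_le_one.trans (hK i)) (Finset.mem_univ γ)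
    linarith

lemma mult_fun (hm : 0 < m) : ∃ C : ℝ, 1 ≤ C ∧ ∀ (F1 F2 : Euc n → ℝ) (M δ : ℝ) (x : Euc n) (p1 p2 : V m n)
    (γ : Ix m n), 0 < δ → (∀ y, 0 ≤ F1 y) → (∀ y, 0 ≤ F2 y) → Good m F1 M → Good m F2 M →
    JetAt F1 x p1 M → JetAt F2 x p2 M → nm δ (sh x (p1 - p2)) ≤ M →
    ∃ F : Euc n → ℝ, (∀ y, 0 ≤ F y) ∧ Good m F (C * M) ∧ (∀ y, F1 y = F2 y → F y = F1 y) ∧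
      JetAt F x ((1 / 2 : ℝ) • (p1 + p2) + c0 m • mulX x δ γ (p1 - p2)) (C * M) := by
  obtain ⟨K, hK, hcut⟩ := exists_cut (n := n) hm
  have hCL := one_le_CL (m := m) (n := n)
  have hCs := one_le_Csh (m := m) (n := n)
  have hD := DD_nonneg (m := m) (n := n)
  set A : ℝ := 4 ^ m * (CL m n * 2 + Csh m n) with hA
  have h4 : (1:ℝ) ≤ 4 ^ m := one_le_pow₀ (by norm_num)
  have hA2 : 2 ≤ A := by rw [hA]; nlinarith
  set B : ℝ := 4 * (DD m n + 1) * K * A + 4 with hB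
  have hB0 : 0 ≤ 4 * (DD m n + 1) * K * A := by positivity
  refine ⟨1 + B, by linarith, ?_⟩
  intro F1 F2 M δ x p1 p2 γ hδ hF1 hF2 hG1 hG2 hJ1 hJ2 hn
  have hM : 0 ≤ M := hJ1.nonneg hm
  obtain ⟨φ, hSG, hb, h0, h1⟩ := hcut γ
  set ψ : Euc n → ℝ := fun y => φ (δ⁻¹ • (y - x)) with hψ
  have hψS : SG m ψ δ K := hSG.scale hδ x
  have hψb : ∀ y, |ψ y| ≤ 1 / 2 := fun y => hb _
  have hψb' : ∀ y, |ψ y| ≤ K := fun y => (hψb y).trans (by linarith)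
  have hnorm : ∀ y, ‖δ⁻¹ • (y - x)‖ = ‖y - x‖ / δ := fun y => by
    rw [norm_smul, Real.norm_of_nonneg (by positivity), inv_mul_eq_div]
  have hψ0 : ∀ y, 2 * δ ≤ ‖y - x‖ → ψ y = 0 := fun y hy => h0 _ (by
    rw [hnorm, le_div_iff₀ hδ]; exact hy)
  set G : Euc n → ℝ := fun y => F1 y - F2 y with hG
  set d : V m n := sh x (p1 - p2) with hd
  have hGx : JC G x d (M + M) := by rw [hd, map_sub]; exact hJ1.sub hJ2
  -- ψ G at points near x
  have near : ∀ z, ‖z - x‖ ≤ 4 * δ → ∀ dz c : V m n, JC G z dz (M + M) → JA ψ z c δ K →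
      JC (fun y => ψ y * G y) z (tmul c dz) (B * M) := by
    intro z hz dz c hdz hc
    have hδ4 : 0 < 4 * δ := by positivity
    have a1 : nm (4 * δ) (dz - sh (z - x) d) ≤ CL m n * (M + M) :=
      JC.compat hδ4 hz (by linarith) hdz hGx
    have a2 : nm (4 * δ) (sh (z - x) d) ≤ Csh m n * M :=
      (nm_sh_le hδ4 hz d).trans (by
        have := nm_mono' hδ (show δ ≤ 4 * δ by linarith) d
        gcongr; linarith)
    have a3 : nm (4 * δ) dz ≤ CL m n * (M + M) + Csh m n * M := by
      have := nm_add hδ4 (dz - sh (z - x) d) (sh (z - x) d)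
      rw [sub_add_cancel] at this; linarith
    have a4 : nm δ dz ≤ A * M := by
      refine (nm_anti hδ (show δ ≤ 4 * δ by linarith) dz).trans ?_
      rw [mul_div_assoc, div_self hδ.ne', mul_one]
      calc (4:ℝ) ^ m * nm (4 * δ) dz ≤ 4 ^ m * (CL m n * (M + M) + Csh m n * M) := by gcongr
        _ = A * M := by rw [hA]; ring
    have := JA.mulJC hδ hm hψb' hc (hdz.mono (show M + M ≤ A * M by nlinarith)) a4
    exact this.mono (by rw [hB]; nlinarith)
  have hjet0 : ∀ c : V m n, JA ψ x c δ K → c = (c0 m * (δ ^ deg γ.1)⁻¹) • ev γ := by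
    intro c hc
    refine JC.unique (F := ψ) (z := x) (M := K / δ ^ m) (M' := 0) hδ (fun y _ => ?_) (fun y hy => ?_)
    · refine (hc.2 y).trans (le_of_eq ?_); rw [div_pow]; ring
    · rw [pl_smul, pl_ev]
      have : ψ y = c0 m * mono γ.1 (δ⁻¹ • (y - x)) := h1 _ (by rw [hnorm, div_le_one hδ]; exact hy)
      rw [this, mono_smul, inv_pow]
      rw [mul_assoc, sub_self]; simp
  have hψG : Good m (fun y => ψ y * G y) (B * M) := by
    intro z
    obtain ⟨c1, hc1⟩ := hG1 z
    obtain ⟨c2, hc2⟩ := hG2 z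
    obtain ⟨c, hc⟩ := hψS z
    rcases le_or_gt ‖z - x‖ (4 * δ) with hz | hz
    · exact ⟨_, near z hz _ c (hc1.sub hc2) hc⟩
    · refine ⟨0, fun α => by simp; positivity, fun y => ?_⟩
      have : pl (0 : V m n) (y - z) = 0 := by simp [pl]
      rw [this, sub_zero]
      show |ψ y * G y| ≤ _
      rcases le_or_gt (2 * δ) ‖y - x‖ with hy | hy
      · rw [hψ0 y hy, zero_mul, abs_zero]; positivity
      · have hyz : 2 * δ ≤ ‖y - z‖ := by
          have := norm_sub_le_norm_sub_add_norm_sub z y x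
          rw [norm_sub_rev z y] at this; linarith
        have g1 := hGx.2 y
        have g2 : |pl d (y - x)| ≤ M * (2 * δ) ^ m := by
          refine (abs_pl_le _ _).trans ((N_mono (norm_nonneg _) hy.le d).trans ?_)
          rw [N_eq (by positivity)]
          gcongr
          exact (nm_mono' hδ (by linarith) d).trans hn
        have g3 : ‖y - x‖ ^ m ≤ (2 * δ) ^ m := by gcongr
        have g4 : |G y| ≤ 3 * M * (2 * δ) ^ m := by
          have e : G y = (G y - pl d (y - x)) + pl d (y - x) := by ring
          rw [e]
          refine (abs_add_le _ _).trans ?_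
          nlinarith
        have g5 : (2 * δ) ^ m ≤ ‖y - z‖ ^ m := by gcongr
        rw [abs_mul]
        calc |ψ y| * |G y| ≤ 1 * (3 * M * (2 * δ) ^ m) := by
              gcongr
              linarith [hψb y]
          _ ≤ (3 * M) * ‖y - z‖ ^ m := by rw [one_mul]; gcongr
          _ ≤ _ := by
              gcongr
              linarith
  have hfun : ∀ y, 1 / 2 * F1 y + 1 / 2 * F2 y + ψ y * G y = (1 / 2 + ψ y) * F1 y + (1 / 2 - ψ y) * F2 y :=
    fun y => by simp only [hG]; ring
  have h12 : (0:ℝ) ≤ 1 / 2 := by norm_num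
  refine ⟨fun y => 1 / 2 * F1 y + 1 / 2 * F2 y + ψ y * G y, fun y => ?_, fun z => ?_, fun y hy => ?_, ?_⟩
  · simp only []
    rw [hfun]
    have := abs_le.1 (hψb y)
    have b1 : 0 ≤ 1 / 2 + ψ y := by linarith
    have b2 : 0 ≤ 1 / 2 - ψ y := by linarith
    have := hF1 y
    have := hF2 y
    positivity
  · obtain ⟨c1, hc1⟩ := hG1 z
    obtain ⟨c2, hc2⟩ := hG2 z
    obtain ⟨c, hc⟩ := hψG z
    exact ⟨_, ((JC.convex h12 h12 (by norm_num) hc1 hc2).add hc).congr rfl rfl (by ring)⟩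
  · simp only [hG]; rw [hy]; ring
  · obtain ⟨c, hc⟩ := hψS x
    have hn := near x (by simp; positivity) d c hGx hc
    rw [hjet0 c hc] at hn
    refine ((JC.convex h12 h12 (by norm_num) hJ1 hJ2).add hn).congr rfl ?_ (by ring)
    have e1 : tmul ((c0 m * (δ ^ deg γ.1)⁻¹) • ev γ) d = (c0 m * (δ ^ deg γ.1)⁻¹) • tmul (ev γ) d := by
      funext α
      simp only [tmul, Pi.smul_apply, smul_eq_mul, Finset.mul_sum, mul_ite, mul_zero]
      simp only [mul_assoc]
    rw [e1]
    simp only [map_add, map_smul, mulX, sh_sh_neg, ← hd]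
    module

end FP


namespace FP
variable {m n : ℕ}

lemma JC.sum {ι : Type*} (T : Finset ι) {F : ι → Euc n → ℝ} {z : Euc n} {c : ι → V m n} {M : ℝ}
    (h : ∀ i ∈ T, JC (F i) z (c i) M) : JC (fun y => ∑ i ∈ T, F i y) z (∑ i ∈ T, c i) (T.card * M) := by
  classical
  induction T using Finset.induction_on with
  | empty => simp [JC, pl]
  | insert a T ha ih =>
    have h1 := ih fun i hi => h i (Finset.mem_insert_of_mem hi)
    refine ((h a (Finset.mem_insert_self _ _)).add h1).congr ?_ ?_ ?_
    · funext y; rw [Finset.sum_insert ha]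
    · rw [Finset.sum_insert ha]
    · rw [Finset.card_insert_of_notMem ha]; push_cast; ring

lemma nm_tmul {s : ℝ} (hs : 0 < s) (c d : V m n) : nm s (tmul c d) ≤ N s c * nm s d := by
  have := N_tmul hs.le c d
  rw [N_eq hs (tmul c d), N_eq hs d, ← mul_assoc] at this
  exact le_of_mul_le_mul_right this (by positivity)

section theta
variable {ι : Type} [LinearOrder ι]

/-- ordered partition of unity -/
def theta (φ : ι → Euc n → ℝ) (T : Finset ι) (i : ι) (y : Euc n) : ℝ :=
  φ i y * ∏ j ∈ T with j < i, (1 - φ j y)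

lemma theta_sum {φ : ι → Euc n → ℝ} {T : Finset ι} {y : Euc n} (h : ∃ i ∈ T, φ i y = 1) :
    ∑ i ∈ T, theta φ T i y = 1 := by
  obtain ⟨i, hi, h1⟩ := h
  have := Finset.prod_one_sub_ordered T (fun i => φ i y)
  rw [Finset.prod_eq_zero hi (by rw [h1, sub_self])] at this
  unfold theta; linarith

lemma theta_nonneg {φ : ι → Euc n → ℝ} (hφ : ∀ i y, 0 ≤ φ i y ∧ φ i y ≤ 1) (T : Finset ι) (i : ι) (y : Euc n) :
    0 ≤ theta φ T i y :=
  mul_nonneg (hφ i y).1 (Finset.prod_nonneg fun j _ => by linarith [(hφ j y).2])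

lemma theta_filter (φ F : ι → Euc n → ℝ) (T : Finset ι) (y : Euc n) :
    ∑ i ∈ T, theta φ T i y * F i y =
      ∑ i ∈ T.filter (fun i => φ i y ≠ 0), theta φ (T.filter (fun i => φ i y ≠ 0)) i y * F i y := by
  have h1 : ∀ i, theta φ T i y = theta φ (T.filter (fun i => φ i y ≠ 0)) i y := by
    intro i
    unfold theta
    congr 1
    symm
    refine Finset.prod_subset (Finset.filter_subset_filter _ (Finset.filter_subset _ _)) ?_
    intro j hj hj'
    simp only [Finset.mem_filter, not_and] at hj hj'
    have : φ j y = 0 := by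
      by_contra h; exact hj' ⟨hj.1, h⟩ hj.2
    rw [this, sub_zero]
  simp_rw [← h1]
  symm
  refine Finset.sum_subset (Finset.filter_subset _ _) ?_
  intro j hj hj'
  have : φ j y = 0 := by
    by_contra h; exact hj' (Finset.mem_filter.2 ⟨hj, h⟩)
  unfold theta; rw [this]; ring

lemma theta_indep (φ F : ι → Euc n → ℝ) (T T' : Finset ι) (y : Euc n) (h : ∀ i, φ i y ≠ 0 → i ∈ T)
    (h' : ∀ i, φ i y ≠ 0 → i ∈ T') : ∑ i ∈ T, theta φ T i y * F i y = ∑ i ∈ T', theta φ T' i y * F i y := by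
  rw [theta_filter φ F T, theta_filter φ F T']
  have : T.filter (fun i => φ i y ≠ 0) = T'.filter (fun i => φ i y ≠ 0) := by
    ext i; simp only [Finset.mem_filter]
    exact ⟨fun hh => ⟨h' i hh.2, hh.2⟩, fun hh => ⟨h i hh.2, hh.2⟩⟩
  rw [this]
end theta

lemma glue (hm : 0 < m) (Nn : ℕ) (K : ℝ) (hK : 1 ≤ K) : ∃ C : ℝ, 1 ≤ C ∧ ∀ (ι : Type) [LinearOrder ι]
    (φ F : ι → Euc n → ℝ) (J : Euc n → Finset ι) (s r : Euc n → ℝ) (M : ℝ), 0 ≤ M → (∀ x, 0 < r x) →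
    (∀ x, r x ≤ s x) → (∀ x, (J x).card ≤ Nn) → (∀ x y, ‖y - x‖ ≤ r x → ∀ i, φ i y ≠ 0 → i ∈ J x) →
    (∀ y, ∃ i, φ i y = 1) → (∀ i y, 0 ≤ φ i y ∧ φ i y ≤ 1) → (∀ x, ∀ i ∈ J x, SG m (φ i) (s x) K) →
    (∀ x, ∀ i ∈ J x, (∀ y, 0 ≤ F i y) ∧ Good m (F i) M) →
    (∀ x, ∀ i ∈ J x, ∀ j ∈ J x, ∀ c d : V m n, JC (F i) x c M → JC (F j) x d M → nm (s x) (c - d) ≤ M) →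
    ∃ G : Euc n → ℝ, (∀ y, 0 ≤ G y) ∧ Good m G (C * M) ∧ (∀ y t, (∀ i, φ i y ≠ 0 → F i y = t) → G y = t) ∧
      ∀ x, ∀ i ∈ J x, ∀ c d : V m n, JC G x c (C * M) → JC (F i) x d M → nm (s x) (c - d) ≤ C * M := by
  have hCL := one_le_CL (m := m) (n := n)
  have hCs := one_le_Csh (m := m) (n := n)
  have hCG := one_le_CG (m := m) (n := n)
  have hD := DD_nonneg (m := m) (n := n)
  set Kθ : ℝ := (4 * (1 + K)) ^ Nn * (1 + K) with hKθ
  set A : ℝ := CL m n * 2 + Csh m n with hA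
  set B : ℝ := 4 * (DD m n + 1) * Kθ * A with hB
  have hKθ1 : 1 ≤ Kθ := by
    rw [hKθ]
    have : 1 ≤ (4 * (1 + K)) ^ Nn := one_le_pow₀ (by linarith)
    nlinarith
  have hA1 : 2 ≤ A := by rw [hA]; linarith
  have hB0 : 0 ≤ B := by rw [hB]; positivity
  set C1 : ℝ := 1 + Nn * B with hC1
  have hC10 : 1 ≤ C1 := by
    have : 0 ≤ Nn * B := by positivity
    linarith
  refine ⟨CG m n * C1 + Nn * Kθ, ?_, ?_⟩
  · have : 0 ≤ Nn * Kθ := by positivity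
    nlinarith
  intro ι _ φ F J s r M hM hr hrs hcard hloc hone hφ hSG hF hcomp
  set G : Euc n → ℝ := fun y => ∑ i ∈ J y, theta φ (J y) i y * F i y with hG
  have hself : ∀ y, ∀ i, φ i y ≠ 0 → i ∈ J y := fun y i hi => hloc y y (by simpa using (hr y).le) i hi
  have hGJ : ∀ x y, ‖y - x‖ ≤ r x → G y = ∑ i ∈ J x, theta φ (J x) i y * F i y := fun x y hxy =>
    theta_indep φ F _ _ y (hself y) (hloc x y hxy)
  have hsum1 : ∀ x y, ‖y - x‖ ≤ r x → ∑ i ∈ J x, theta φ (J x) i y = 1 := fun x y hxy => by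
    obtain ⟨i, hi⟩ := hone y
    exact theta_sum ⟨i, hloc x y hxy i (by rw [hi]; exact one_ne_zero), hi⟩
  have hGJ' : ∀ x, ∀ i0 ∈ J x, ∀ y, ‖y - x‖ ≤ r x → G y = F i0 y +
      ∑ i ∈ J x, theta φ (J x) i y * (F i y - F i0 y) := fun x i0 _ y hxy => by
    simp_rw [mul_sub]
    rw [Finset.sum_sub_distrib, ← Finset.sum_mul, hsum1 x y hxy, ← hGJ x y hxy]; ring
  have hθS : ∀ x, ∀ i ∈ J x, SG m (theta φ (J x) i) (s x) Kθ := by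
    intro x i hi
    have hs := (hr x).trans_le (hrs x)
    have h1 := SG.finset_prod (K := 1 + K) hm hs ((J x).filter (fun j => j < i)) (φ i) (fun j y => 1 - φ j y)
      ((hSG x i hi).mono hs.le (by linarith))
      (fun j hj => (hSG x j (Finset.mem_filter.1 hj).1).one_sub hm hs)
    refine SG.mono hs.le h1 ?_
    rw [hKθ]
    gcongr
    · linarith
    · exact (Finset.card_filter_le _ _).trans (hcard x)
  -- local jets
  have hjet : ∀ x, ∀ i0 ∈ J x, ∀ z, ‖z - x‖ ≤ r x → ∀ d : V m n, JC (F i0) z d M →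
      ∃ c : V m n, JC (fun y => F i0 y + ∑ i ∈ J x, theta φ (J x) i y * (F i y - F i0 y)) z c (C1 * M) ∧
        (z = x → nm (s x) (c - d) ≤ (Nn * Kθ) * M) := by
    intro x i0 hi0 z hz d hd
    have hs := (hr x).trans_le (hrs x)
    have hex : ∀ i, ∃ p : V m n × V m n × V m n, i ∈ J x → JC (F i) x p.1 M ∧ JC (F i) z p.2.1 M ∧
        JA (theta φ (J x) i) z p.2.2 (s x) Kθ := by
      intro i
      by_cases hi : i ∈ J x
      · obtain ⟨a, ha⟩ := (hF x i hi).2 x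
        obtain ⟨b, hb⟩ := (hF x i hi).2 z
        obtain ⟨e, he⟩ := hθS x i hi z
        exact ⟨(a, b, e), fun _ => ⟨ha, hb, he⟩⟩
      · exact ⟨0, fun h => absurd h hi⟩
    choose p hp using hex
    have hterm : ∀ i ∈ J x, nm (s x) ((p i).2.1 - d) ≤ A * M := by
      intro i hi
      have k1 := hcomp x i hi i0 hi0 _ _ (hp i hi).1 (hp i0 hi0).1
      have hzs := hz.trans (hrs x)
      have k2 := JC.compat hs hzs hM (hp i hi).2.1 (hp i hi).1
      have k3 := JC.compat hs hzs hM hd (hp i0 hi0).1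
      have k4 := nm_sh_le hs hzs ((p i).1 - (p i0).1)
      have e : (p i).2.1 - d = ((p i).2.1 - sh (z - x) (p i).1) - (d - sh (z - x) (p i0).1) +
        sh (z - x) ((p i).1 - (p i0).1) := by rw [map_sub]; abel
      rw [e]
      refine (nm_add hs _ _).trans ?_
      have k5 := nm_sub hs ((p i).2.1 - sh (z - x) (p i).1) (d - sh (z - x) (p i0).1)
      have k6 : Csh m n * nm (s x) ((p i).1 - (p i0).1) ≤ Csh m n * M := by gcongr
      rw [hA]; nlinarith
    refine ⟨d + ∑ i ∈ J x, tmul (p i).2.2 ((p i).2.1 - d), ?_, ?_⟩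
    · have hS : JC (fun y => ∑ i ∈ J x, theta φ (J x) i y * (F i y - F i0 y)) z
          (∑ i ∈ J x, tmul (p i).2.2 ((p i).2.1 - d)) ((J x).card * (B * M)) := by
        refine JC.sum _ fun i hi => ?_
        have := JA.mulJC hs hm ((hθS x i hi).bound hm hs.le) (hp i hi).2.2
          (((hp i hi).2.1.sub hd).mono (show M + M ≤ A * M by nlinarith)) (hterm i hi)
        exact this.mono (by rw [hB]; apply le_of_eq; ring)
      refine (hd.add hS).mono ?_
      have : ((J x).card : ℝ) ≤ Nn := by exact_mod_cast hcard x
      have h2 : (J x).card * (B * M) ≤ Nn * (B * M) := by gcongr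
      rw [hC1]; linarith
    · rintro rfl
      rw [add_sub_cancel_left]
      refine (nm_sum hs _ _).trans ?_
      refine (Finset.sum_le_card_nsmul _ _ (Kθ * M) fun i hi => ?_).trans ?_
      · refine (nm_tmul hs _ _).trans ?_
        have k1 := hcomp z i hi i0 hi0 _ _ (hp i hi).2.1 hd
        have := nm_nonneg hs ((p i).2.1 - d)
        have h2 := (hp i hi).2.2.1
        gcongr
      · have e : Nn * Kθ * M = Nn * (Kθ * M) := by ring
        rw [nsmul_eq_mul, e]
        have : ((J z).card : ℝ) ≤ Nn := by exact_mod_cast hcard z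
        gcongr
  have hex0 : ∀ x, ∃ i0, i0 ∈ J x := fun x => by
    obtain ⟨i, hi⟩ := hone x
    exact ⟨i, hself x i (by rw [hi]; exact one_ne_zero)⟩
  have hC1M : 0 ≤ C1 * M := by positivity
  have hgood : Good m G (CG m n * (C1 * M)) := by
    refine good_of_local hm hC1M fun x => ⟨r x, hr x, fun z hz => ?_⟩
    obtain ⟨i0, hi0⟩ := hex0 x
    obtain ⟨d, hd⟩ := (hF x i0 hi0).2 z
    obtain ⟨c, hc, -⟩ := hjet x i0 hi0 z hz d hd
    exact ⟨c, hc.1, fun y hy => by rw [hGJ' x i0 hi0 y hy]; exact hc.2 y⟩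
  refine ⟨G, fun y => ?_, hgood.mono ?_, fun y t ht => ?_, ?_⟩
  · exact Finset.sum_nonneg fun i hi => mul_nonneg (theta_nonneg hφ _ _ _) ((hF y i hi).1 y)
  · have : 0 ≤ Nn * Kθ * M := by positivity
    linarith
  · have h1 : G y = ∑ i ∈ J y, theta φ (J y) i y * t := by
      refine Finset.sum_congr rfl fun i hi => ?_
      by_cases h : φ i y = 0
      · unfold theta; rw [h]; ring
      · rw [ht i h]
    rw [h1, ← Finset.sum_mul, hsum1 y y (by simpa using (hr y).le), one_mul]
  · intro x i hi c d hc hd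
    obtain ⟨c', hc', hc''⟩ := hjet x i hi x (by simpa using (hr x).le) d hd
    have : c = c' := JC.unique (F := G) (hr x) (fun y _ => hc.2 y) (fun y hy => by
      rw [hGJ' x i hi y hy]; exact hc'.2 y)
    rw [this]
    refine (hc'' rfl).trans ?_
    have : 0 ≤ CG m n * C1 * M := by positivity
    linarith

end FP


namespace FP
variable {m n : ℕ}

lemma norm_le_of_coord {h : Euc n} {b : ℝ} (hb : ∀ l, |h l| ≤ b) : ‖h‖ ≤ n * b := by
  have h1 : h = ∑ l, h l • EuclideanSpace.single l (1 : ℝ) := by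
    ext i; simp [Pi.single_apply]
  calc ‖h‖ = ‖∑ l, h l • EuclideanSpace.single l (1 : ℝ)‖ := by rw [← h1]
    _ ≤ ∑ l, ‖h l • EuclideanSpace.single l (1 : ℝ)‖ := norm_sum_le _ _
    _ ≤ ∑ _l : Fin n, b := by
        refine Finset.sum_le_sum fun l _ => ?_
        rw [norm_smul]; simpa using hb l
    _ = n * b := by simp

/-- lattice point -/
def lat (i : ℤ × (Fin n → ℤ)) : Euc n := WithLp.toLp 2 (fun l => (2:ℝ) ^ i.1 * (i.2 l : ℝ))
lemma lat_apply (i : ℤ × (Fin n → ℤ)) (l : Fin n) : lat i l = (2:ℝ) ^ i.1 * (i.2 l : ℝ) := rfl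

lemma whitney (hm : 0 < m) (hn : 0 < n) : ∃ K : ℝ, 1 ≤ K ∧ ∃ Nn : ℕ, ∀ Λ : ℝ, 6 * (n : ℝ) ≤ Λ →
    ∀ r0 : Euc n → ℝ, (∀ x, 0 < r0 x) → (∀ x y, r0 x ≤ r0 y + ‖x - y‖) →
    ∃ (ι : Type) (_ : LinearOrder ι) (c : ι → Euc n) (ρ : ι → ℝ) (φ : ι → Euc n → ℝ) (J : Euc n → Finset ι),
      (∀ x, (J x).card ≤ Nn) ∧ (∀ x y, ‖y - x‖ ≤ r0 x / (10 * Λ) → ∀ i, φ i y ≠ 0 → i ∈ J x) ∧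
      (∀ y, ∃ i, φ i y = 1) ∧ (∀ i y, 0 ≤ φ i y ∧ φ i y ≤ 1) ∧ (∀ x, ∀ i ∈ J x, SG m (φ i) (r0 x / (9 * Λ)) K) ∧
      (∀ i y, φ i y ≠ 0 → ‖y - c i‖ < 2 * n * ρ i) ∧
      (∀ x, ∀ i ∈ J x, 0 < ρ i ∧ Λ * ρ i ≤ r0 (c i) ∧ r0 (c i) ≤ 8 * Λ * ρ i ∧ ‖x - c i‖ ≤ 3 * n * ρ i) := by
  classical
  have hn1 : (1:ℝ) ≤ n := by exact_mod_cast hn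
  let χ : ContDiffBump (0 : Euc n) := ⟨n, 2 * n, by linarith, by linarith⟩
  obtain ⟨K, hK, hSG⟩ := sg_of_smooth hm (χ.contDiff (n := m)) χ.hasCompactSupport
  refine ⟨K, hK, 6 * (6 * n + 2) ^ n, ?_⟩
  intro Λ hΛ r0 hr0 hlip
  have hΛ0 : 0 < Λ := by linarith
  have hΛ6 : 6 ≤ Λ := by linarith
  let I : ℤ × (Fin n → ℤ) → Prop := fun i => Λ * (2:ℝ) ^ i.1 ≤ r0 (lat i) ∧ r0 (lat i) < 8 * Λ * (2:ℝ) ^ i.1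
  let φ : ℤ × (Fin n → ℤ) → Euc n → ℝ := fun i y => if I i then χ (((2:ℝ) ^ i.1)⁻¹ • (y - lat i)) else 0
  have hk0 : ∀ x, ∃ k : ℤ, r0 x / (9 * Λ) ∈ Set.Ico ((2:ℝ) ^ k) (2 ^ (k + 1)) := fun x =>
    exists_mem_Ico_zpow (div_pos (hr0 x) (by positivity)) (by norm_num)
  choose k0 hk0 using hk0
  let J0 : Euc n → Finset (ℤ × (Fin n → ℤ)) := fun x => (Finset.Icc (k0 x) (k0 x + 5)).biUnion fun k =>
    (Fintype.piFinset fun l : Fin n => Finset.Icc (⌊x l / (2:ℝ) ^ k⌋ - 3 * n) (⌊x l / (2:ℝ) ^ k⌋ + 3 * n + 1)).image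
      fun j => (k, j)
  have hJ0card : ∀ x, (J0 x).card ≤ 6 * (6 * n + 2) ^ n := by
    intro x
    refine Finset.card_biUnion_le.trans ?_
    refine (Finset.sum_le_card_nsmul _ _ ((6 * n + 2) ^ n) fun k _ => ?_).trans (le_of_eq ?_)
    · refine Finset.card_image_le.trans ?_
      rw [Fintype.card_piFinset]
      refine (Finset.prod_le_pow_card _ _ (6 * n + 2) fun l _ => ?_).trans (by simp)
      rw [Int.card_Icc]; omega
    · rw [Int.card_Icc, show (k0 x + 5 + 1 - k0 x).toNat = 6 by omega, smul_eq_mul]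
  -- geometric facts for cells close to x
  have geo : ∀ x i, I i → ‖x - lat i‖ ≤ 3 * n * (2:ℝ) ^ i.1 →
      r0 x ≤ 9 * Λ * (2:ℝ) ^ i.1 ∧ Λ * (2:ℝ) ^ i.1 ≤ 2 * r0 x := by
    intro x i hi hx
    have hp : (0:ℝ) < (2:ℝ) ^ i.1 := by positivity
    have h1 := hlip x (lat i)
    have h2 := hlip (lat i) x
    rw [norm_sub_rev] at h2
    have h3 : 6 * n * (2:ℝ) ^ i.1 ≤ Λ * (2:ℝ) ^ i.1 := by gcongr
    have h4 := hi.1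
    have h5 := hi.2
    constructor <;> nlinarith
  have hJ0 : ∀ x i, I i → ‖x - lat i‖ ≤ 3 * n * (2:ℝ) ^ i.1 → i ∈ J0 x := by
    intro x i hi hx
    obtain ⟨g1, g2⟩ := geo x i hi hx
    have hp : (0:ℝ) < (2:ℝ) ^ i.1 := by positivity
    obtain ⟨b1, b2⟩ := hk0 x
    have e1 : r0 x / (9 * Λ) ≤ (2:ℝ) ^ i.1 := by
      rw [div_le_iff₀ (by positivity)]; linarith
    have e2 : (2:ℝ) ^ i.1 ≤ 18 * (r0 x / (9 * Λ)) := by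
      rw [show 18 * (r0 x / (9 * Λ)) = 2 * r0 x / Λ by rw [eq_div_iff hΛ0.ne']; field_simp; ring, le_div_iff₀ hΛ0]; linarith
    simp only [J0, Finset.mem_biUnion, Finset.mem_image, Finset.mem_Icc, Fintype.mem_piFinset]
    refine ⟨i.1, ⟨?_, ?_⟩, i.2, fun l => ?_, rfl⟩
    · exact (zpow_le_zpow_iff_right₀ (by norm_num : (1:ℝ) < 2)).1 (b1.trans e1)
    · have : (2:ℝ) ^ i.1 < 2 ^ (k0 x + 6) := by
        calc (2:ℝ) ^ i.1 ≤ 18 * (r0 x / (9 * Λ)) := e2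
          _ < 32 * 2 ^ (k0 x + 1) := by nlinarith [hr0 x, zpow_pos (show (0:ℝ) < 2 by norm_num) (k0 x + 1)]
          _ = 2 ^ (k0 x + 6) := by
            rw [show k0 x + 6 = 5 + (k0 x + 1) by ring, zpow_add₀ (by norm_num : (2:ℝ) ≠ 0) 5]; norm_num
      have := (zpow_lt_zpow_iff_right₀ (by norm_num : (1:ℝ) < 2)).1 this
      omega
    · have h1 := (abs_coord_le (x - lat i) l).trans hx
      have h2 : |x l / (2:ℝ) ^ i.1 - i.2 l| ≤ 3 * n := by
        have : x l / (2:ℝ) ^ i.1 - i.2 l = (x - lat i) l / (2:ℝ) ^ i.1 := by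
          rw [PiLp.sub_apply, lat_apply]; field_simp
        rw [this, abs_div, abs_of_pos hp, div_le_iff₀ hp]; exact h1
      rw [abs_le] at h2
      have f1 := Int.floor_le (x l / (2:ℝ) ^ i.1)
      have f2 := Int.lt_floor_add_one (x l / (2:ℝ) ^ i.1)
      constructor
      · have : ((⌊x l / (2:ℝ) ^ i.1⌋ - 3 * n : ℤ) : ℝ) ≤ i.2 l := by push_cast; linarith
        exact_mod_cast this
      · have : (i.2 l : ℝ) ≤ ((⌊x l / (2:ℝ) ^ i.1⌋ + 3 * n + 1 : ℤ) : ℝ) := by push_cast; linarith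
        exact_mod_cast this
  let J : Euc n → Finset (ℤ × (Fin n → ℤ)) := fun x =>
    (J0 x).filter fun i => I i ∧ ‖x - lat i‖ ≤ 3 * n * (2:ℝ) ^ i.1
  have hJ : ∀ x i, i ∈ J x ↔ I i ∧ ‖x - lat i‖ ≤ 3 * n * (2:ℝ) ^ i.1 := fun x i => by
    simp only [J, Finset.mem_filter]
    exact ⟨fun h => h.2, fun h => ⟨hJ0 x i h.1 h.2, h⟩⟩
  have hφne : ∀ i y, φ i y ≠ 0 → I i ∧ ‖y - lat i‖ < 2 * n * (2:ℝ) ^ i.1 := by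
    intro i y h
    by_cases hi : I i
    · refine ⟨hi, ?_⟩
      by_contra hlt
      push Not at hlt
      apply h
      simp only [φ]
      rw [if_pos hi]
      apply χ.zero_of_le_dist
      rw [dist_zero_right, norm_smul, Real.norm_of_nonneg (by positivity)]
      show (2 * n : ℝ) ≤ _
      rw [inv_mul_eq_div, le_div_iff₀ (by positivity)]; exact hlt
    · exact absurd (by simp [φ, hi]) h
  refine ⟨ℤ × (Fin n → ℤ), LinearOrder.lift' Encodable.encode Encodable.encode_injective, lat, fun i => (2:ℝ) ^ i.1,
    φ, J, fun x => (Finset.card_filter_le _ _).trans (hJ0card x), ?_, ?_, ?_, ?_, fun i y h => (hφne i y h).2, ?_⟩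
  · intro x y hxy i hi
    obtain ⟨hI, hlt⟩ := hφne i y hi
    refine (hJ x i).2 ⟨hI, ?_⟩
    have hp : (0:ℝ) < (2:ℝ) ^ i.1 := by positivity
    have h1 := hlip x y
    have h2 := hlip y (lat i)
    have h3 : 6 * n * (2:ℝ) ^ i.1 ≤ Λ * (2:ℝ) ^ i.1 := by gcongr
    have h4 := hI.2
    rw [norm_sub_rev] at h1
    have h5 : r0 x ≤ 9 * Λ * (2:ℝ) ^ i.1 + r0 x / (10 * Λ) := by nlinarith
    have h6 : r0 x / (10 * Λ) ≤ r0 x / 10 := by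
      have := hr0 x
      gcongr; linarith
    have h7 : r0 x / (10 * Λ) ≤ (2:ℝ) ^ i.1 := by
      rw [div_le_iff₀ (by positivity)]; nlinarith
    have h8 := norm_sub_le_norm_sub_add_norm_sub x y (lat i)
    rw [norm_sub_rev x y] at h8
    nlinarith
  · intro y
    obtain ⟨k, hk1, hk2⟩ := exists_mem_Ico_zpow (x := r0 y / (2 * Λ)) (div_pos (hr0 y) (by positivity))
      (y := (2:ℝ)) (by norm_num)
    have hp : (0:ℝ) < (2:ℝ) ^ k := by positivity
    rw [le_div_iff₀ (by positivity)] at hk1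
    rw [zpow_add_one₀ (by norm_num), div_lt_iff₀ (by positivity)] at hk2
    let i : ℤ × (Fin n → ℤ) := (k, fun l => round (y l / (2:ℝ) ^ k))
    have hd : ‖y - lat i‖ ≤ n * (2:ℝ) ^ k := by
      refine norm_le_of_coord fun l => ?_
      have h1 := abs_sub_round (y l / (2:ℝ) ^ k)
      have : (y - lat i) l = (2:ℝ) ^ k * (y l / (2:ℝ) ^ k - round (y l / (2:ℝ) ^ k)) := by
        rw [PiLp.sub_apply, lat_apply]; simp only [i]; field_simp
      rw [this, abs_mul, abs_of_pos hp]
      nlinarith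
    have h1 := hlip y (lat i)
    have h2 := hlip (lat i) y
    rw [norm_sub_rev] at h2
    have h3 : 6 * n * (2:ℝ) ^ k ≤ Λ * (2:ℝ) ^ k := by gcongr
    have hI : I i := by
      constructor
      · show Λ * (2:ℝ) ^ k ≤ _
        nlinarith
      · show _ < 8 * Λ * (2:ℝ) ^ k
        nlinarith
    refine ⟨i, ?_⟩
    simp only [φ]
    rw [if_pos hI]
    apply χ.one_of_mem_closedBall
    rw [mem_closedBall_zero_iff, norm_smul, Real.norm_of_nonneg (by positivity), inv_mul_eq_div,
      div_le_iff₀ (by positivity)]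
    exact hd
  · intro i y
    simp only [φ]
    split_ifs
    · exact ⟨χ.nonneg, χ.le_one⟩
    · simp
  · intro x i hi
    obtain ⟨hI, hd⟩ := (hJ x i).1 hi
    have h1 : SG m (φ i) ((2:ℝ) ^ i.1) K := by
      have := hSG.scale (show (0:ℝ) < (2:ℝ) ^ i.1 by positivity) (lat i)
      simp only [φ]
      simpa only [if_pos hI] using this
    refine h1.rescale (div_pos (hr0 x) (by positivity)) ?_
    rw [div_le_iff₀ (by positivity)]
    linarith [(geo x i hI hd).1]
  · intro x i hi
    obtain ⟨hI, hd⟩ := (hJ x i).1 hi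
    exact ⟨by positivity, hI.1, hI.2.le, hd⟩

end FP


namespace FP
variable {m n : ℕ}

set_option maxHeartbeats 1000000 in
lemma GT (hm : 0 < m) (hn : 0 < n) (L : ℝ) (hL : 1 ≤ L) : ∃ C : ℝ, 1 ≤ C ∧ ∀ (E : Set (Euc n)) (f τ : Euc n → ℝ)
    (P : Euc n → V m n) (M : ℝ), 0 ≤ M → E.Finite → E.Nonempty → (∀ z ∈ E, 0 < τ z) →
    (∀ z ∈ E, ∀ s > 0, ∃ G : Euc n → ℝ, (∀ y, 0 ≤ G y) ∧ Good m G M ∧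
      (∃ q, JetAt G z q M ∧ nm s (sh z (q - P z)) ≤ M) ∧ (s * L ≤ τ z → ∀ e ∈ E, ‖e - z‖ < 2 * s → G e = f e)) →
    (∀ z ∈ E, ∀ y ∈ E, ∀ s > 0, ‖z - y‖ ≤ s → τ y ≤ s → nm s (sh y (P z - P y)) ≤ M) →
    ∃ F : Euc n → ℝ, (∀ y, 0 ≤ F y) ∧ Good m F (C * M) ∧ (∀ e ∈ E, F e = f e) ∧
      ∀ x, ∀ y ∈ E, ∀ s, τ y + ‖x - y‖ ≤ s → ∀ p, JetAt F x p (C * M) → nm s (sh x (p - P y)) ≤ C * M := by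
  classical
  obtain ⟨K, hK, Nn, hW⟩ := whitney (n := n) hm hn
  obtain ⟨Cg, hCg, hglue⟩ := glue (n := n) hm Nn K hK
  have hCL := one_le_CL (m := m) (n := n)
  have hCs := one_le_Csh (m := m) (n := n)
  have hn1 : (1:ℝ) ≤ n := by exact_mod_cast hn
  set Λ : ℝ := 6 * n * L with hΛ
  have hΛ6 : 6 * (n:ℝ) ≤ Λ := by rw [hΛ]; nlinarith
  have hΛ0 : 0 < Λ := by linarith
  set A : ℝ := CL m n + 2 * Csh m n with hA
  have hA1 : 3 ≤ A := by rw [hA]; linarith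
  set B : ℝ := (36 * Λ) ^ m * (2 * A) with hB
  have hp1 : (1:ℝ) ≤ (36 * Λ) ^ m := one_le_pow₀ (by linarith)
  have hB1 : 1 ≤ B := by rw [hB]; nlinarith
  have h4 : (1:ℝ) ≤ 4 ^ m := one_le_pow₀ (by norm_num)
  set Cf : ℝ := 4 ^ m * (Cg * B + A + Csh m n) with hCf
  have hCB1 : 1 ≤ Cg * B := by nlinarith
  have hCfB : Cg * B ≤ Cf := by
    have h0 : 0 ≤ Cg * B + A + Csh m n := by linarith
    have : 1 * (Cg * B + A + Csh m n) ≤ Cf := by rw [hCf]; gcongr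
    linarith
  refine ⟨Cf, hCB1.trans hCfB, ?_⟩
  intro E f τ P M hM hE hne hτ hloc hcomp
  -- minimizers
  have hmin : ∀ x, ∃ y ∈ E, ∀ z ∈ E, τ y + ‖x - y‖ ≤ τ z + ‖x - z‖ := fun x =>
    Set.exists_min_image E (fun z => τ z + ‖x - z‖) hE hne
  choose y0 hy0E hy0 using hmin
  set r0 : Euc n → ℝ := fun x => τ (y0 x) + ‖x - y0 x‖ with hr0
  have hr0pos : ∀ x, 0 < r0 x := fun x => add_pos_of_pos_of_nonneg (hτ _ (hy0E x)) (norm_nonneg _)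
  have hlip : ∀ x y, r0 x ≤ r0 y + ‖x - y‖ := fun x y => by
    have h1 := hy0 x (y0 y) (hy0E y)
    have h2 := norm_sub_le_norm_sub_add_norm_sub x y (y0 y)
    simp only [hr0]; linarith
  obtain ⟨ι, hι, c, ρ, φ, J, hcard, hnear, hone, hφ, hSG, hsupp, hJ⟩ := hW Λ hΛ6 r0 hr0pos hlip
  -- choose functions
  have hch : ∀ i, ∃ z ∈ E, (‖z - c i‖ < 2 * n * ρ i ∨ (∀ e ∈ E, 2 * n * ρ i ≤ ‖e - c i‖) ∧ z = y0 (c i)) := by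
    intro i
    by_cases h : ∃ z ∈ E, ‖z - c i‖ < 2 * n * ρ i
    · obtain ⟨z, hz, h⟩ := h; exact ⟨z, hz, Or.inl h⟩
    · push Not at h; exact ⟨y0 (c i), hy0E _, Or.inr ⟨h, rfl⟩⟩
  choose zz hzE hzz using hch
  have hFex : ∀ i, ∃ G : Euc n → ℝ, 0 < ρ i → ((∀ y, 0 ≤ G y) ∧ Good m G M ∧
      (∃ q, JetAt G (zz i) q M ∧ nm (2 * n * ρ i) (sh (zz i) (q - P (zz i))) ≤ M) ∧
      ((2 * n * ρ i) * L ≤ τ (zz i) → ∀ e ∈ E, ‖e - zz i‖ < 2 * (2 * n * ρ i) → G e = f e)) := by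
    intro i
    by_cases h : 0 < ρ i
    · obtain ⟨G, hG⟩ := hloc (zz i) (hzE i) (2 * n * ρ i) (by positivity)
      exact ⟨G, fun _ => hG⟩
    · exact ⟨0, fun h' => absurd h' h⟩
  choose F hF using hFex
  -- jets of F_i at x compared with P (y0 x)
  have hcmp : ∀ x, ∀ i ∈ J x, ∀ d : V m n, JC (F i) x d M → nm (4 * r0 x) (d - sh x (P (y0 x))) ≤ A * M := by
    intro x i hi d hd
    obtain ⟨hρ, j1, j2, j3⟩ := hJ x i hi
    obtain ⟨-, -, ⟨q, hq1, hq2⟩, -⟩ := hF i hρ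
    have hs : 0 < 4 * r0 x := by have := hr0pos x; positivity
    have hl1 := hlip (c i) x
    rw [norm_sub_rev] at hl1
    have h6 : 6 * n * ρ i ≤ Λ * ρ i := by gcongr
    have hnρ : 0 < n * ρ i := by positivity
    have hρr : 3 * n * ρ i ≤ r0 x := by nlinarith
    have hxz : ‖x - zz i‖ ≤ 3 * r0 x := by
      have t := norm_sub_le_norm_sub_add_norm_sub x (c i) (zz i)
      rw [norm_sub_rev (c i)] at t
      rcases hzz i with h | ⟨-, h⟩
      · nlinarith
      · have : ‖zz i - c i‖ ≤ r0 (c i) := by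
          rw [h, norm_sub_rev]; simp only [hr0]; linarith [hτ _ (hy0E (c i))]
        linarith
    have hxy : ‖x - y0 x‖ ≤ r0 x := by simp only [hr0]; linarith [hτ _ (hy0E x)]
    have hτy : τ (y0 x) ≤ r0 x := by simp only [hr0]; linarith [norm_nonneg (x - y0 x)]
    have hzy : ‖zz i - y0 x‖ ≤ 4 * r0 x := by
      have t := norm_sub_le_norm_sub_add_norm_sub (zz i) x (y0 x)
      rw [norm_sub_rev (zz i) x] at t; linarith
    have hr := hr0pos x
    have k1 := JC.compat hs (show ‖x - zz i‖ ≤ 4 * r0 x by linarith) hM hd hq1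
    have k2 := nm_sh_le hs (show ‖x - zz i‖ ≤ 4 * r0 x by linarith) (sh (zz i) (q - P (zz i)))
    have k3 : nm (4 * r0 x) (sh (zz i) (q - P (zz i))) ≤ M :=
      (nm_mono' (show 0 < 2 * n * ρ i by positivity) (by nlinarith) _).trans hq2
    have k4 := nm_sh_le hs (show ‖x - y0 x‖ ≤ 4 * r0 x by linarith) (sh (y0 x) (P (zz i) - P (y0 x)))
    have k5 := hcomp (zz i) (hzE i) (y0 x) (hy0E x) (4 * r0 x) hs hzy (by linarith)
    have e : d - sh x (P (y0 x)) = (d - sh (x - zz i) (sh (zz i) q)) + sh (x - zz i) (sh (zz i) (q - P (zz i)))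
        + sh (x - y0 x) (sh (y0 x) (P (zz i) - P (y0 x))) := by
      simp only [← co_change, map_sub]; abel
    rw [e]
    refine (nm_add hs _ _).trans ?_
    have k6 := nm_add hs (d - sh (x - zz i) (sh (zz i) q)) (sh (x - zz i) (sh (zz i) (q - P (zz i))))
    have k7 : Csh m n * nm (4 * r0 x) (sh (zz i) (q - P (zz i))) ≤ Csh m n * M := by gcongr
    have k8 : Csh m n * nm (4 * r0 x) (sh (y0 x) (P (zz i) - P (y0 x))) ≤ Csh m n * M := by gcongr
    rw [hA]; linarith
  have hMB : M ≤ B * M := by nlinarith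
  have hdown : ∀ x, ∀ i ∈ J x, ∀ d : V m n, JC (F i) x d (B * M) → JC (F i) x d M := by
    intro x i hi d hd
    obtain ⟨d', hd'⟩ := (hF i (hJ x i hi).1).2.1 x
    have : d = d' := JC.unique (F := F i) one_pos (fun y _ => hd.2 y) (fun y _ => hd'.2 y)
    rw [this]; exact hd'
  obtain ⟨G, hG0, hGgood, hGval, hGjet⟩ := hglue ι φ F J (fun x => r0 x / (9 * Λ)) (fun x => r0 x / (10 * Λ)) (B * M)
    (by positivity) (fun x => div_pos (hr0pos x) (by positivity)) (fun x => by
      have := hr0pos x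
      gcongr; norm_num) hcard hnear hone hφ hSG
    (fun x i hi => ⟨(hF i (hJ x i hi).1).1, (hF i (hJ x i hi).1).2.1.mono hMB⟩)
    (fun x i hi j hj c' d hc hd => by
      have a1 := hcmp x i hi c' (hdown x i hi _ hc)
      have a2 := hcmp x j hj d (hdown x j hj _ hd)
      have hr := hr0pos x
      have hs : 0 < 4 * r0 x := by positivity
      rw [nm_sub_comm] at a2
      have a3 := nm_tri hs c' (sh x (P (y0 x))) d
      have hle : r0 x / (9 * Λ) ≤ 4 * r0 x := by
        rw [div_le_iff₀ (by positivity)]; nlinarith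
      refine (nm_anti (div_pos hr (by positivity)) hle _).trans ?_
      have e : 4 * r0 x / (r0 x / (9 * Λ)) = 36 * Λ := by field_simp; norm_num
      rw [e]
      calc (36 * Λ) ^ m * nm (4 * r0 x) (c' - d) ≤ (36 * Λ) ^ m * (2 * A * M) := by
            gcongr; linarith
        _ = B * M := by rw [hB]; ring)
  have hCM : Cg * (B * M) ≤ Cf * M := by rw [← mul_assoc]; gcongr
  refine ⟨G, hG0, hGgood.mono hCM, fun e he => hGval e (f e) fun i hi => ?_, ?_⟩
  · have hiJ : i ∈ J e := hnear e e (by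
      rw [sub_self, norm_zero]; exact (div_pos (hr0pos e) (by positivity)).le) i hi
    obtain ⟨hρ, j1, j2, j3⟩ := hJ e i hiJ
    have h1 := hsupp i e hi
    have hz : ‖zz i - c i‖ < 2 * n * ρ i := by
      rcases hzz i with h | ⟨h, -⟩
      · exact h
      · exact absurd h1 (not_lt.2 (h e he))
    refine (hF i hρ).2.2.2 ?_ e he ?_
    · have h2 := hy0 (c i) (zz i) (hzE i)
      have h3 : r0 (c i) ≤ τ (zz i) + ‖c i - zz i‖ := h2
      rw [norm_sub_rev] at h3
      have hnρ : 0 < n * ρ i := by positivity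
      have : Λ * ρ i = 6 * (n * ρ i) * L := by rw [hΛ]; ring
      have h5 : 0 ≤ (n * ρ i) * (L - 1) := mul_nonneg hnρ.le (by linarith)
      linarith
    · have t := norm_sub_le_norm_sub_add_norm_sub e (c i) (zz i)
      rw [norm_sub_rev (c i)] at t; linarith
  · intro x y hy s hs p hp
    obtain ⟨i, hi⟩ := hone x
    have hiJ : i ∈ J x := hnear x x (by
      rw [sub_self, norm_zero]; exact (div_pos (hr0pos x) (by positivity)).le) i (by rw [hi]; exact one_ne_zero)
    obtain ⟨d, hd⟩ := (hF i (hJ x i hiJ).1).2.1 x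
    have hr := hr0pos x
    have hrs : r0 x ≤ s := (hy0 x y hy).trans hs
    have hs0 : 0 < s := hr.trans_le hrs
    have hs4 : 0 < 4 * s := by positivity
    obtain ⟨p', hp'⟩ := hGgood.jetAt x
    have hpp : sh x p = sh x p' := JC.unique (F := G) one_pos (fun y _ => hp.2 y) (fun y _ => hp'.2 y)
    have a1 := hGjet x i hiJ (sh x p') d hp' (hd.mono hMB)
    rw [← hpp] at a1
    have hle : r0 x / (9 * Λ) ≤ 4 * s := by
      rw [div_le_iff₀ (by positivity)]; nlinarith
    have a2 : nm (4 * s) (sh x p - d) ≤ Cg * (B * M) :=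
      (nm_mono' (div_pos hr (by positivity)) hle _).trans a1
    have a3 : nm (4 * s) (d - sh x (P (y0 x))) ≤ A * M :=
      (nm_mono' (by positivity) (by linarith) _).trans (hcmp x i hiJ d hd)
    have hxy : ‖x - y0 x‖ ≤ r0 x := by simp only [hr0]; linarith [hτ _ (hy0E x)]
    have hτy : τ (y0 x) ≤ r0 x := by simp only [hr0]; linarith [norm_nonneg (x - y0 x)]
    have hyy : ‖y - y0 x‖ ≤ 4 * s := by
      have t := norm_sub_le_norm_sub_add_norm_sub y x (y0 x)
      rw [norm_sub_rev y x] at t; linarith [hτ y hy]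
    have a4 := hcomp y hy (y0 x) (hy0E x) (4 * s) hs4 hyy (by linarith)
    have a5 := nm_sh_le hs4 (show ‖x - y0 x‖ ≤ 4 * s by linarith) (sh (y0 x) (P y - P (y0 x)))
    have e : sh x (p - P y) = (sh x p - d) + (d - sh x (P (y0 x))) - sh (x - y0 x) (sh (y0 x) (P y - P (y0 x))) := by
      simp only [← co_change, map_sub]; abel
    have a6 : nm (4 * s) (sh x (p - P y)) ≤ Cg * (B * M) + A * M + Csh m n * M := by
      rw [e]
      refine (nm_sub hs4 _ _).trans ?_
      have k6 := nm_add hs4 (sh x p - d) (d - sh x (P (y0 x)))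
      have k8 : Csh m n * nm (4 * s) (sh (y0 x) (P y - P (y0 x))) ≤ Csh m n * M := by gcongr
      linarith
    refine (nm_anti hs0 (show s ≤ 4 * s by linarith) _).trans ?_
    rw [mul_div_assoc, div_self hs0.ne', mul_one]
    calc (4:ℝ) ^ m * nm (4 * s) (sh x (p - P y)) ≤ 4 ^ m * (Cg * (B * M) + A * M + Csh m n * M) := by gcongr
      _ = Cf * M := by rw [hCf]; ring

end FP


namespace FP
variable {m n : ℕ}

/-- the sets `Γ` -/
def Gam (E : Set (Euc n)) (f : Euc n → ℝ) (k : ℕ) (x : Euc n) (M : ℝ) : Set (V m n) :=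
  {p | ∀ S : Finset (Euc n), (S : Set (Euc n)) ⊆ E → S.card ≤ k →
    ∃ F : Euc n → ℝ, (∀ y, 0 ≤ F y) ∧ Good m F M ∧ (∀ y ∈ S, F y = f y) ∧ JetAt F x p M}

variable {E E' : Set (Euc n)} {f : Euc n → ℝ} {k k' : ℕ} {x y : Euc n} {M M' δ : ℝ}

lemma Gam.mono {p : V m n} (h : p ∈ Gam E f k x M) (hE : E' ⊆ E) (hk : k' ≤ k) (hM : M ≤ M') :
    p ∈ Gam E' f k' x M' := fun S hS hc => by
  obtain ⟨F, h0, h1, h2, h3⟩ := h S (hS.trans hE) (hc.trans hk)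
  exact ⟨F, h0, h1.mono hM, h2, h3.mono hM⟩

lemma Good.convex {F G : Euc n → ℝ} {s t : ℝ} (hs : 0 ≤ s) (ht : 0 ≤ t) (hst : s + t = 1) (h : Good m F M)
    (h' : Good m G M) : Good m (fun y => s * F y + t * G y) M := fun z => by
  obtain ⟨c, hc⟩ := h z
  obtain ⟨d, hd⟩ := h' z
  exact ⟨_, JC.convex hs ht hst hc hd⟩

lemma JetAt.convex {F G : Euc n → ℝ} {p q : V m n} {s t : ℝ} (hs : 0 ≤ s) (ht : 0 ≤ t) (hst : s + t = 1)
    (h : JetAt F x p M) (h' : JetAt G x q M) : JetAt (fun y => s * F y + t * G y) x (s • p + t • q) M :=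
  (JC.convex hs ht hst h h').congr rfl (by simp) rfl

lemma Gam.convex : Convex ℝ (Gam E f k x M : Set (V m n)) := by
  intro p hp q hq s t hs ht hst S hS hc
  obtain ⟨F, h0, h1, h2, h3⟩ := hp S hS hc
  obtain ⟨G, g0, g1, g2, g3⟩ := hq S hS hc
  refine ⟨fun y => s * F y + t * G y, fun y => ?_, h1.convex hs ht hst g1, fun y hy => ?_, h3.convex hs ht hst g3⟩
  · have := h0 y
    have := g0 y
    positivity
  · simp only []
    rw [h2 y hy, g2 y hy, ← add_mul, hst, one_mul]

/-- Helly number -/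
def hN (m n : ℕ) : ℕ := Fintype.card (Ix m n) + 1

lemma helly_core (hE : E.Finite) (Q : (Euc n → ℝ) → Prop)
    (hQ : ∀ F G s t, 0 ≤ s → 0 ≤ t → s + t = 1 → Q F → Q G → Q (fun y => s * F y + t * G y))
    (h : ∀ S : Finset (Euc n), (S : Set (Euc n)) ⊆ E → S.card ≤ hN m n * k →
      ∃ F : Euc n → ℝ, (∀ y, 0 ≤ F y) ∧ Good m F M ∧ (∀ y ∈ S, F y = f y) ∧ Q F) (x : Euc n) :
    ∃ p : V m n, ∀ S : Finset (Euc n), (S : Set (Euc n)) ⊆ E → S.card ≤ k →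
      ∃ F : Euc n → ℝ, (∀ y, 0 ≤ F y) ∧ Good m F M ∧ (∀ y ∈ S, F y = f y) ∧ Q F ∧ JetAt F x p M := by
  classical
  let fam : Finset (Finset (Euc n)) := hE.toFinset.powerset.filter fun S => S.card ≤ k
  let KK : Finset (Euc n) → Set (V m n) := fun S => {p | ∃ F : Euc n → ℝ, (∀ y, 0 ≤ F y) ∧ Good m F M ∧
    (∀ y ∈ S, F y = f y) ∧ Q F ∧ JetAt F x p M}
  have hfam : ∀ S : Finset (Euc n), S ∈ fam ↔ (S : Set (Euc n)) ⊆ E ∧ S.card ≤ k := by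
    intro S
    simp only [fam, Finset.mem_filter, Finset.mem_powerset]
    rw [← Finset.coe_subset, hE.coe_toFinset]
  have key : (⋂ S ∈ fam, KK S).Nonempty := by
    refine Convex.helly_theorem' (𝕜 := ℝ) (fun S _ => ?_) (fun I hI hcard => ?_)
    · rintro p ⟨F, h0, h1, h2, h3, h4⟩ q ⟨G, g0, g1, g2, g3, g4⟩ s t hs ht hst
      refine ⟨fun y => s * F y + t * G y, fun y => ?_, h1.convex hs ht hst g1, fun y hy => ?_,
        hQ F G s t hs ht hst h3 g3, h4.convex hs ht hst g4⟩
      · have := h0 y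
        have := g0 y
        positivity
      · simp only []
        rw [h2 y hy, g2 y hy, ← add_mul, hst, one_mul]
    · have hc : (I.biUnion id).card ≤ hN m n * k := by
        refine Finset.card_biUnion_le.trans ((Finset.sum_le_card_nsmul _ _ k fun S hS => ?_).trans ?_)
        · exact ((hfam S).1 (hI hS)).2
        · rw [smul_eq_mul]
          have : I.card ≤ hN m n := by
            refine hcard.trans (le_of_eq ?_)
            simp [hN, V]
          gcongr
      have hs : ((I.biUnion id : Finset (Euc n)) : Set (Euc n)) ⊆ E := by
        intro y hy
        simp only [Finset.coe_biUnion, Set.mem_iUnion] at hy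
        obtain ⟨S, hS, hy⟩ := hy
        exact ((hfam S).1 (hI hS)).1 hy
      obtain ⟨F, h0, h1, h2, h3⟩ := h _ hs hc
      obtain ⟨p, hp⟩ := h1.jetAt x
      refine ⟨p, Set.mem_iInter₂.2 fun S hS => ⟨F, h0, h1, fun y hy => h2 y ?_, h3, hp⟩⟩
      exact Finset.mem_biUnion.2 ⟨S, hS, hy⟩
  obtain ⟨p, hp⟩ := key
  exact ⟨p, fun S hS hc => Set.mem_iInter₂.1 hp S ((hfam S).2 ⟨hS, hc⟩)⟩

lemma pair (hm : 0 < m) (hE : E.Finite) {p : V m n} (hk : hN m n * k ≤ k') (hp : p ∈ Gam E f k' x M) (y : Euc n) :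
    ∃ p' ∈ Gam E f k y M, ∀ δ, 0 < δ → ‖x - y‖ ≤ δ → nm δ (sh x (p - p')) ≤ CL m n * M := by
  obtain ⟨p', hp'⟩ := helly_core (k := k) hE (fun F => JetAt F x p M)
    (fun F G s t hs ht hst h1 h2 => by
      have := h1.convex hs ht hst h2
      rwa [← add_smul, hst, one_smul] at this)
    (fun S hS hc => hp S hS (hc.trans hk)) y
  refine ⟨p', fun S hS hc => ?_, fun δ hδ hxy => ?_⟩
  · obtain ⟨F, h0, h1, h2, h3, h4⟩ := hp' S hS hc
    exact ⟨F, h0, h1, h2, h4⟩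
  · obtain ⟨F, h0, h1, h2, h3, h4⟩ := hp' ∅ (by simp) (by simp)
    exact h3.compat hδ hxy (h3.nonneg hm) h4

/-! normalized coordinates -/

def nrm (x : Euc n) (δ : ℝ) (p : V m n) : V m n := fun α => sh x p α / δ ^ (m - deg α.1)
def un (x : Euc n) (δ : ℝ) (c : V m n) : V m n := sh (-x) (fun α => c α * δ ^ (m - deg α.1))

lemma nrm_add (p q : V m n) : nrm x δ (p + q) = nrm x δ p + nrm x δ q := by
  funext α; simp [nrm, add_div]
lemma nrm_sub (p q : V m n) : nrm x δ (p - q) = nrm x δ p - nrm x δ q := by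
  funext α; simp [nrm, sub_div]
lemma nrm_smul (t : ℝ) (p : V m n) : nrm x δ (t • p) = t • nrm x δ p := by
  funext α; simp [nrm, mul_div_assoc]
lemma un_add (p q : V m n) : un x δ (p + q) = un x δ p + un x δ q := by
  unfold un; rw [← map_add]; congr 1; funext α; simp [add_mul]
lemma un_smul (t : ℝ) (p : V m n) : un x δ (t • p) = t • un x δ p := by
  unfold un; rw [← map_smul]; congr 1; funext α; simp [mul_assoc]
lemma un_sub (p q : V m n) : un x δ (p - q) = un x δ p - un x δ q := by
  unfold un; rw [← map_sub]; congr 1; funext α; simp [sub_mul]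
lemma un_nrm (hδ : 0 < δ) (p : V m n) : un x δ (nrm x δ p) = p := by
  unfold un nrm
  have : (fun α : Ix m n => sh x p α / δ ^ (m - deg α.1) * δ ^ (m - deg α.1)) = sh x p := by
    funext α; field_simp
  rw [this, sh_neg_sh]
lemma nrm_un (hδ : 0 < δ) (c : V m n) : nrm x δ (un x δ c) = c := by
  unfold un nrm
  rw [sh_sh_neg]
  funext α; field_simp
lemma sh_un (c : V m n) (α : Ix m n) : sh x (un x δ c) α = c α * δ ^ (m - deg α.1) := by
  unfold un; rw [sh_sh_neg]

lemma nm_eq_sum (hδ : 0 < δ) (p : V m n) : nm δ (sh x p) = ∑ α, |nrm x δ p α| := by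
  unfold nm nrm
  refine Finset.sum_congr rfl fun α _ => ?_
  rw [abs_div, abs_of_pos (show 0 < δ ^ (m - deg α.1) by positivity)]

lemma nrm_le (hδ : 0 < δ) (p : V m n) (α : Ix m n) : |nrm x δ p α| ≤ nm δ (sh x p) := by
  rw [nm_eq_sum hδ]
  exact Finset.single_le_sum (f := fun α => |nrm x δ p α|) (fun _ _ => abs_nonneg _) (Finset.mem_univ α)

lemma nm_le_nrm (hδ : 0 < δ) (p : V m n) {R : ℝ} (h : ∀ α, |nrm x δ p α| ≤ R) : nm δ (sh x p) ≤ DD m n * R := by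
  rw [nm_eq_sum hδ]
  exact (Finset.sum_le_card_nsmul _ _ R fun α _ => h α).trans (by simp [DD])

/-! shifts -/

def S (γ : Ix m n) (c : V m n) : V m n := tmul (ev γ) c

lemma S_apply (γ α : Ix m n) (c : V m n) : S γ c α = ∑ β : Ix m n, if γ.1 + β.1 = α.1 then c β else 0 := by
  unfold S tmul
  rw [Finset.sum_eq_single γ]
  · simp [ev]
  · intro b _ hb; simp [ev, hb]
  · simp

lemma S_cases (γ α : Ix m n) : (∃ β : Ix m n, γ.1 + β.1 = α.1 ∧ ∀ c : V m n, S γ c α = c β) ∨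
    ((∀ β : Ix m n, γ.1 + β.1 ≠ α.1) ∧ ∀ c : V m n, S γ c α = 0) := by
  by_cases h : ∃ β : Ix m n, γ.1 + β.1 = α.1
  · obtain ⟨β, hβ⟩ := h
    refine Or.inl ⟨β, hβ, fun c => ?_⟩
    rw [S_apply, Finset.sum_eq_single β]
    · simp [hβ]
    · intro b _ hb
      rw [if_neg]
      intro h'
      exact hb (Subtype.ext (add_left_cancel (h'.trans hβ.symm)))
    · simp
  · push Not at h
    refine Or.inr ⟨h, fun c => ?_⟩
    rw [S_apply]
    exact Finset.sum_eq_zero fun β _ => by rw [if_neg (h β)]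

lemma S_add (γ : Ix m n) (c d : V m n) : S γ (c + d) = S γ c + S γ d := by
  funext α
  rcases S_cases γ α with ⟨β, -, h⟩ | ⟨-, h⟩ <;> simp [h]
lemma S_smul (γ : Ix m n) (t : ℝ) (d : V m n) : S γ (t • d) = t • S γ d := by
  funext α
  rcases S_cases γ α with ⟨β, -, h⟩ | ⟨-, h⟩ <;> simp [h]
lemma S_le (γ : Ix m n) {c : V m n} {R : ℝ} (hR : 0 ≤ R) (h : ∀ α, |c α| ≤ R) (α : Ix m n) : |S γ c α| ≤ R := by
  rcases S_cases γ α with ⟨β, -, h'⟩ | ⟨-, h'⟩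
  · rw [h']; exact h β
  · rw [h']; simpa using hR

lemma un_S (hδ : 0 < δ) (γ : Ix m n) (c : V m n) : un x δ (S γ c) = mulX x δ γ (un x δ c) := by
  unfold mulX
  conv_rhs => unfold un
  rw [sh_sh_neg, ← map_smul]
  unfold un
  congr 1
  funext α
  rw [Pi.smul_apply, smul_eq_mul]
  change _ = _ * S γ (fun α => c α * δ ^ (m - deg α.1)) α
  rcases S_cases γ α with ⟨β, e, h⟩ | ⟨-, h⟩
  · rw [h, h]
    have h1 : deg α.1 = deg γ.1 + deg β.1 := by rw [← e, deg_add]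
    have := α.2
    have h2 : m - deg β.1 = deg γ.1 + (m - deg α.1) := by omega
    rw [h2, pow_add]; field_simp
  · rw [h, h]; simp

/-- Γ in normalized coordinates -/
def GN (E : Set (Euc n)) (f : Euc n → ℝ) (k : ℕ) (x : Euc n) (δ M : ℝ) : Set (V m n) :=
  {c | un x δ c ∈ Gam E f k x M}

/-- abstract properties of the family `GN` -/
structure AG (Cm : ℝ) (G : ℝ → Set (V m n)) : Prop where
  conv : ∀ M, Convex ℝ (G M)
  mono : ∀ M M' p, M ≤ M' → p ∈ G M → p ∈ G M'
  mult : ∀ M P q γ, P + q ∈ G M → P - q ∈ G M → (∀ α, |q α| ≤ M) → P + (2 * c0 m) • S γ q ∈ G (Cm * M)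

lemma exists_AG (hm : 0 < m) : ∃ Cm : ℝ, 1 ≤ Cm ∧ ∀ (E : Set (Euc n)) (f : Euc n → ℝ) (k : ℕ) (x : Euc n) (δ : ℝ),
    0 < δ → AG Cm (GN (m := m) E f k x δ) := by
  obtain ⟨C, hC, hmult⟩ := mult_fun (n := n) hm
  have hD := DD_nonneg (m := m) (n := n)
  refine ⟨C * (1 + 2 * DD m n), by nlinarith, fun E f k x δ hδ => ⟨fun M => ?_, fun M M' p hM hp => ?_, ?_⟩⟩
  · intro p hp q hq s t hs ht hst
    show un x δ (s • p + t • q) ∈ (Gam E f k x M : Set (V m n))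
    rw [un_add, un_smul, un_smul]
    exact Gam.convex hp hq hs ht hst
  · exact Gam.mono hp le_rfl le_rfl hM
  · intro M P q γ h1 h2 hq T hT hc
    obtain ⟨F1, a0, a1, a2, a3⟩ := h1 T hT hc
    obtain ⟨F2, b0, b1, b2, b3⟩ := h2 T hT hc
    have hM := a3.nonneg hm
    have hMM : M ≤ (1 + 2 * DD m n) * M := by nlinarith [mul_nonneg hD hM]
    have e : un x δ (P + q) - un x δ (P - q) = (2:ℝ) • un x δ q := by
      rw [← un_sub, ← un_smul]; congr 1; module
    obtain ⟨F, c0', c1, c2, c3⟩ := hmult F1 F2 ((1 + 2 * DD m n) * M) δ x _ _ γ hδ a0 b0 (a1.mono hMM) (b1.mono hMM)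
      (a3.mono hMM) (b3.mono hMM) (by
        rw [e, map_smul, nm_smul, abs_of_pos (by norm_num : (0:ℝ) < 2)]
        have := nm_le_nrm hδ (un x δ q) (x := x) (R := M) (fun α => by rw [nrm_un hδ]; exact hq α)
        nlinarith)
    rw [e] at c3
    refine ⟨F, c0', ?_, fun y hy => ?_, ?_⟩
    · rw [mul_assoc]; exact c1
    · rw [c2 y ((a2 y hy).trans (b2 y hy).symm), a2 y hy]
    · rw [mul_assoc]
      have e2 : un x δ (P + (2 * c0 m) • S γ q) = (1 / 2 : ℝ) • (un x δ (P + q) + un x δ (P - q)) +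
          c0 m • mulX x δ γ ((2:ℝ) • un x δ q) := by
        rw [← un_smul, ← un_S hδ, ← un_add, ← un_smul, ← un_smul, ← un_add, S_smul]
        congr 1; module
      rw [e2]; exact c3

end FP


namespace FP
variable {m n : ℕ}

lemma NI {ι : Type*} [Fintype ι] (T : (ι → ℝ) →ₗ[ℝ] (ι → ℝ))
    (h : ∀ s : ι → ℝ, ∑ j, |T s j - s j| ≤ (1 / 2) * ∑ i, |s i|) (v : ι → ℝ) :
    ∃ s, T s = v ∧ ∑ i, |s i| ≤ 2 * ∑ i, |v i| := by
  have key : ∀ s : ι → ℝ, ∑ i, |s i| ≤ 2 * ∑ i, |T s i| := by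
    intro s
    have h1 : ∑ i, |s i| ≤ ∑ i, (|T s i - s i| + |T s i|) := Finset.sum_le_sum fun i _ => by
      have := abs_sub_abs_le_abs_sub (s i) (T s i)
      rw [abs_sub_comm (s i)] at this
      linarith
    rw [Finset.sum_add_distrib] at h1
    linarith [h s]
  have inj : Function.Injective T := by
    rw [injective_iff_map_eq_zero]
    intro s hs
    have := key s
    rw [hs] at this
    simp only [Pi.zero_apply, abs_zero, Finset.sum_const_zero, mul_zero] at this
    have h0 := (Finset.sum_eq_zero_iff_of_nonneg (fun i _ => abs_nonneg (s i))).1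
      (le_antisymm this (Finset.sum_nonneg fun i _ => abs_nonneg (s i)))
    funext i
    exact abs_eq_zero.1 (h0 i (Finset.mem_univ i))
  obtain ⟨s, hs⟩ := (LinearMap.injective_iff_surjective.1 inj) v
  exact ⟨s, hs, by rw [← hs]; exact key s⟩

/-! monotone sets of multiindices -/

def key (α : Fin n → ℕ) : ℕ ×ₗ Lex (Fin n → ℕ) := toLex (deg α, toLex α)

lemma key_inj {α β : Fin n → ℕ} (h : key α = key β) : α = β := by
  have := congrArg (fun p => (ofLex p).2) h
  exact this

lemma key_add (γ : Fin n → ℕ) {α β : Fin n → ℕ} : key (γ + α) < key (γ + β) ↔ key α < key β := by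
  have : ∀ α : Fin n → ℕ, key (γ + α) = key γ + key α := by
    intro α
    unfold key
    rw [deg_add]
    rfl
  rw [this, this]
  exact add_lt_add_iff_left _

lemma key_deg {α β : Fin n → ℕ} (h : deg α < deg β) : key α < key β := by
  unfold key
  rw [Prod.Lex.toLex_lt_toLex]
  exact Or.inl h

def Mon (A : Finset (Ix m n)) : Prop := ∀ α ∈ A, ∀ γ β : Ix m n, γ.1 + α.1 = β.1 → β ∈ A

def NA (A : Finset (Ix m n)) (j : ℕ) : ℕ := (A.filter fun α => deg α.1 ≤ j).card

/-- `B` is a better label than `A` -/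
def LL (A B : Finset (Ix m n)) : Prop := ∃ j, (∀ i < j, NA A i ≤ NA B i) ∧ NA A j < NA B j

lemma LL_trans {A B D : Finset (Ix m n)} (h : LL A B) (h' : LL B D) : LL A D := by
  obtain ⟨j, h1, h2⟩ := h
  obtain ⟨k, h3, h4⟩ := h'
  rcases lt_trichotomy j k with hjk | hjk | hjk
  · exact ⟨j, fun i hi => (h1 i hi).trans (h3 i (hi.trans hjk)), h2.trans_le (h3 j hjk)⟩
  · subst hjk
    exact ⟨j, fun i hi => (h1 i hi).trans (h3 i hi), h2.trans h4⟩
  · exact ⟨k, fun i hi => (h1 i (hi.trans hjk)).trans (h3 i hi), (h1 k hjk).trans_lt h4⟩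

lemma LL_wf : WellFounded (fun B A : Finset (Ix m n) => LL A B) := by
  have : IsTrans (Finset (Ix m n)) (fun B A => LL A B) := ⟨fun a b c h h' => LL_trans h' h⟩
  have : Std.Irrefl (fun B A : Finset (Ix m n) => LL A B) := ⟨fun a ⟨j, _, h⟩ => lt_irrefl _ h⟩
  exact Finite.wellFounded_of_trans_of_irrefl _

/-! echelon forms -/

def Sl (γ : Ix m n) : V m n →ₗ[ℝ] V m n where
  toFun := S γ
  map_add' := S_add γ
  map_smul' := S_smul γ

lemma S_S (γ γ' : Ix m n) (c : V m n) : (∃ γ'' : Ix m n, S γ (S γ' c) = S γ'' c) ∨ S γ (S γ' c) = 0 := by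
  by_cases h : deg (γ.1 + γ'.1) < m
  · refine Or.inl ⟨⟨γ.1 + γ'.1, h⟩, ?_⟩
    funext α
    rcases S_cases ⟨γ.1 + γ'.1, h⟩ α with ⟨β, e, h'⟩ | ⟨e, h'⟩
    · rw [h']
      rcases S_cases γ α with ⟨β', e', h''⟩ | ⟨e', h''⟩
      · rw [h'']
        rcases S_cases γ' β' with ⟨β2, e2, h2⟩ | ⟨e2, h2⟩
        · rw [h2]; congr 1
          apply Subtype.ext
          simp only [] at e
          rw [← e2, ← add_assoc] at e'
          exact add_left_cancel (e'.trans e.symm)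
        · exfalso
          simp only [] at e
          rw [← e', add_assoc] at e
          exact e2 β (add_left_cancel e)
      · exfalso
        simp only [] at e
        have hd : deg (γ'.1 + β.1) < m := by
          have := α.2
          rw [← e, add_assoc, deg_add] at this
          omega
        exact e' ⟨_, hd⟩ (by rw [← e, add_assoc])
    · rw [h']
      rcases S_cases γ α with ⟨β', e', h''⟩ | ⟨e', h''⟩
      · rw [h'']
        rcases S_cases γ' β' with ⟨β2, e2, h2⟩ | ⟨e2, h2⟩
        · exfalso
          exact e β2 (by simp only []; rw [add_assoc, e2, e'])
        · rw [h2]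
      · rw [h'']
  · refine Or.inr ?_
    funext α
    rcases S_cases γ α with ⟨β', e', h''⟩ | ⟨e', h''⟩
    · rw [h'']
      rcases S_cases γ' β' with ⟨β2, e2, h2⟩ | ⟨e2, h2⟩
      · exfalso
        apply h
        have := α.2
        rw [← e', ← e2, ← add_assoc, deg_add] at this
        omega
      · rw [h2]; rfl
    · rw [h'']; rfl

/-- restriction of coordinates -/
def res (I : Submodule ℝ (V m n)) (B : Finset (Ix m n)) : I →ₗ[ℝ] ({κ // κ ∈ B} → ℝ) where
  toFun := fun i κ => i.1 κ.1
  map_add' := fun _ _ => rfl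
  map_smul' := fun _ _ => rfl

open Classical in
set_option maxHeartbeats 1000000 in
lemma echelon_point (A' : Finset (Ix m n)) (I : Submodule ℝ (V m n)) (hI : ∀ γ, ∀ i ∈ I, S γ i ∈ I)
    (q : Ix m n → V m n) (hqI : ∀ α ∈ A', q α ∈ I)
    (hq : ∀ α ∈ A', ∀ α' ∈ A', q α α' = if α = α' then 1 else 0) :
    ∃ A'' : Finset (Ix m n), Mon A'' ∧ (∀ j, NA A' j ≤ NA A'' j) ∧
      ∀ κ ∈ A'', ∃ w ∈ I, w κ = 1 ∧ ∀ κ' ∈ A'', κ' ≠ κ → w κ' = 0 := by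
  obtain ⟨A'', hA⟩ : ∃ A'' : Finset (Ix m n), ∀ κ, κ ∈ A'' ↔ ∃ i ∈ I, i κ ≠ 0 ∧
      ∀ β : Ix m n, key β.1 < key κ.1 → i β = 0 :=
    ⟨Finset.univ.filter fun κ => ∃ i ∈ I, i κ ≠ 0 ∧ ∀ β : Ix m n, key β.1 < key κ.1 → i β = 0, by simp⟩
  refine ⟨A'', ?_, ?_, ?_⟩
  · intro κ hκ γ β e
    obtain ⟨i, hi, h1, h2⟩ := (hA κ).1 hκ
    refine (hA β).2 ⟨S γ i, hI γ i hi, ?_, fun β' hβ' => ?_⟩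
    · rcases S_cases γ β with ⟨κ', e', h⟩ | ⟨e', h⟩
      · rw [h]
        rwa [show κ' = κ from Subtype.ext (add_left_cancel (e'.trans e.symm))]
      · exact absurd e (e' κ)
    · rcases S_cases γ β' with ⟨κ', e', h⟩ | ⟨e', h⟩
      · rw [h]
        apply h2
        rw [← e, ← e', key_add] at hβ'
        exact hβ'
      · rw [h]
  · intro j
    set a := res I (A''.filter fun α => deg α.1 ≤ j) with ha
    set b := res I (A'.filter fun α => deg α.1 ≤ j) with hb'
    have hab : LinearMap.ker a ≤ LinearMap.ker b := by
      intro i hi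
      rw [LinearMap.mem_ker] at hi ⊢
      have hi' : ∀ κ ∈ A'', deg κ.1 ≤ j → i.1 κ = 0 := fun κ h1 h2 =>
        congrFun hi ⟨κ, Finset.mem_filter.2 ⟨h1, h2⟩⟩
      funext κ
      show i.1 κ.1 = 0
      by_contra hne
      obtain ⟨κ0, hκ0, hmin⟩ := Finset.exists_min_image (Finset.univ.filter fun κ => i.1 κ ≠ 0) (fun κ => key κ.1)
        ⟨κ.1, by simp [hne]⟩
      simp only [Finset.mem_filter, Finset.mem_univ, true_and] at hκ0 hmin
      have : κ0 ∈ A'' := (hA κ0).2 ⟨i.1, i.2, hκ0, fun β hβ => by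
        by_contra h; exact absurd (hmin β h) (not_le.2 hβ)⟩
      have h1 : j < deg κ0.1 := by
        by_contra h
        exact hκ0 (hi' κ0 this (not_lt.1 h))
      have h2 := hmin κ.1 hne
      have h3 := (Finset.mem_filter.1 κ.2).2
      exact absurd h2 (not_le.2 (key_deg (h3.trans_lt h1)))
    have hb : Function.Surjective b := by
      intro v
      have hz : ∀ κ : {κ // κ ∈ A'.filter fun α => deg α.1 ≤ j}, q κ.1 ∈ I := fun κ => hqI _ (Finset.mem_filter.1 κ.2).1
      let z : {κ // κ ∈ A'.filter fun α => deg α.1 ≤ j} → I := fun κ => ⟨q κ.1, hz κ⟩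
      refine ⟨∑ κ, v κ • z κ, ?_⟩
      rw [map_sum]
      funext κ
      rw [Finset.sum_apply, Finset.sum_eq_single κ]
      · rw [map_smul, Pi.smul_apply, smul_eq_mul]
        have : b (z κ) κ = q κ.1 κ.1 := rfl
        rw [this, hq _ (Finset.mem_filter.1 κ.2).1 _ (Finset.mem_filter.1 κ.2).1]
        simp
      · intro κ' _ hne
        rw [map_smul, Pi.smul_apply, smul_eq_mul]
        have : b (z κ') κ = q κ'.1 κ.1 := rfl
        rw [this, hq _ (Finset.mem_filter.1 κ'.2).1 _ (Finset.mem_filter.1 κ.2).1, if_neg, mul_zero]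
        exact fun h => hne (Subtype.ext h)
      · simp
    have h1 := LinearMap.finrank_range_add_finrank_ker a
    have h2 := LinearMap.finrank_range_add_finrank_ker b
    have h3 := Submodule.finrank_mono hab
    have h4 : Module.finrank ℝ (LinearMap.range b) = NA A' j := by
      rw [LinearMap.range_eq_top.2 hb, finrank_top, Module.finrank_fintype_fun_eq_card, Fintype.card_coe]
      rfl
    have h5 : Module.finrank ℝ (LinearMap.range a) ≤ NA A'' j := by
      have h6 := Submodule.finrank_le (LinearMap.range a)
      rw [Module.finrank_fintype_fun_eq_card, Fintype.card_coe] at h6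
      exact h6
    omega
  · have sur : ∀ U : Finset (Ix m n), U ⊆ A'' → ∀ v : V m n, ∃ i ∈ I, ∀ κ ∈ U, i κ = v κ := by
      intro U
      induction U using Finset.induction_on_max_value (fun κ : Ix m n => key κ.1) with
      | empty => intro _ v; exact ⟨0, I.zero_mem, by simp⟩
      | insert a s ha hmax ih =>
        intro hU v
        obtain ⟨i, hi, h⟩ := ih ((Finset.subset_insert _ _).trans hU) v
        obtain ⟨l, hl, h1, h2⟩ := (hA a).1 (hU (Finset.mem_insert_self _ _))
        refine ⟨i + ((v a - i a) / l a) • l, I.add_mem hi (I.smul_mem _ hl), fun κ hκ => ?_⟩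
        rw [Pi.add_apply, Pi.smul_apply, smul_eq_mul]
        rcases Finset.mem_insert.1 hκ with rfl | hκ
        · field_simp; ring
        · rw [h κ hκ, h2 κ, mul_zero, add_zero]
          refine lt_of_le_of_ne (hmax κ hκ) fun h => ?_
          rw [Subtype.ext (key_inj h)] at hκ
          exact ha hκ
    intro κ hκ
    obtain ⟨w, hw, h⟩ := sur A'' (Finset.Subset.refl _) (fun κ' => if κ' = κ then 1 else 0)
    refine ⟨w, hw, by rw [h κ hκ]; simp, fun κ' hκ' hne => by rw [h κ' hκ']; simp [hne]⟩

/-- conclusion of the echelon lemma -/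
def Ech (A' : Finset (Ix m n)) (q : Ix m n → V m n) (C : ℝ) : Prop :=
  ∃ A'' : Finset (Ix m n), Mon A'' ∧ (∀ j, NA A' j ≤ NA A'' j) ∧
      ∀ κ ∈ A'', ∃ t : Ix m n × Ix m n → ℝ, ∑ p, |t p| ≤ C ∧
        (∑ p, t p • S p.1 (q p.2)) κ = 1 ∧ ∀ κ' ∈ A'', κ' ≠ κ → (∑ p, t p • S p.1 (q p.2)) κ' = 0

lemma Ech.mono {A' : Finset (Ix m n)} {q : Ix m n → V m n} {C C' : ℝ} (h : Ech A' q C) (hC : C ≤ C') :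
    Ech A' q C' := by
  obtain ⟨A'', h1, h2, h3⟩ := h
  refine ⟨A'', h1, h2, fun κ hκ => ?_⟩
  obtain ⟨t, h4, h5⟩ := h3 κ hκ
  exact ⟨t, h4.trans hC, h5⟩

lemma S_zero (hm : 0 < m) (c : V m n) : S ⟨0, by simpa [deg] using hm⟩ c = c := by
  funext α
  rcases S_cases ⟨0, by simpa [deg] using hm⟩ α with ⟨β, e, h⟩ | ⟨e, h⟩
  · rw [h]; congr 1; apply Subtype.ext; simpa using e
  · exact absurd (zero_add _) (e α)

open Classical in
set_option maxHeartbeats 1000000 in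
lemma echelon_compact (hm : 0 < m) (A' : Finset (Ix m n)) (R : ℝ) : ∃ C : ℝ, ∀ q : Ix m n → V m n,
    (∀ α ∈ A', ∀ α' ∈ A', q α α' = if α = α' then 1 else 0) → (∀ α β, |q α β| ≤ R) → Ech A' q C := by
  let K : Set (Ix m n → V m n) := {q | (∀ α ∈ A', ∀ α' ∈ A', q α α' = if α = α' then 1 else 0) ∧ ∀ α β, |q α β| ≤ R}
  have hK : IsCompact K := by
    have h1 : K ⊆ Set.pi Set.univ fun _ => Set.pi Set.univ fun _ => Set.Icc (-R) R := by
      intro q hq α _ β _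
      exact abs_le.1 (hq.2 α β)
    refine IsCompact.of_isClosed_subset (isCompact_univ_pi fun _ => isCompact_univ_pi fun _ => isCompact_Icc) ?_ h1
    have : K = (⋂ α ∈ A', ⋂ α' ∈ A', {q : Ix m n → V m n | q α α' = if α = α' then 1 else 0}) ∩
        ⋂ α, ⋂ β, {q | |q α β| ≤ R} := by
      ext q; simp [K]
    rw [this]
    refine IsClosed.inter ?_ ?_
    · refine isClosed_biInter fun α _ => isClosed_biInter fun α' _ => isClosed_eq ?_ continuous_const
      fun_prop
    · refine isClosed_iInter fun α => isClosed_iInter fun β => isClosed_le ?_ continuous_const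
      fun_prop
  suffices h : ∃ C : ℝ, ∀ q ∈ K, Ech A' q C by
    obtain ⟨C, h⟩ := h
    exact ⟨C, fun q h1 h2 => h q ⟨h1, h2⟩⟩
  refine hK.induction_on (p := fun s => ∃ C : ℝ, ∀ q ∈ s, Ech A' q C) ⟨0, by simp⟩ ?_ ?_ ?_
  · rintro s t hst ⟨C, h⟩
    exact ⟨C, fun q hq => h q (hst hq)⟩
  · rintro s t ⟨C, h⟩ ⟨C', h'⟩
    refine ⟨max C C', fun q hq => ?_⟩
    rcases hq with hq | hq
    · exact (h q hq).mono (le_max_left _ _)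
    · exact (h' q hq).mono (le_max_right _ _)
  · intro q0 hq0
    let v : Ix m n × Ix m n → V m n := fun p => S p.1 (q0 p.2)
    let I := Submodule.span ℝ (Set.range v)
    have hI : ∀ γ, ∀ i ∈ I, S γ i ∈ I := by
      intro γ i hi
      change Sl γ i ∈ I
      refine Submodule.span_induction (p := fun i _ => Sl γ i ∈ I) ?_ ?_ ?_ ?_ hi
      · rintro _ ⟨p, rfl⟩
        show S γ (S p.1 (q0 p.2)) ∈ I
        rcases S_S γ p.1 (q0 p.2) with ⟨γ'', h⟩ | h
        · rw [h]; exact Submodule.subset_span ⟨(γ'', p.2), rfl⟩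
        · rw [h]; exact I.zero_mem
      · rw [map_zero]; exact I.zero_mem
      · intro x y _ _ hx hy; rw [map_add]; exact I.add_mem hx hy
      · intro a x _ hx; rw [map_smul]; exact I.smul_mem _ hx
    obtain ⟨A'', hM, hN, hw⟩ := echelon_point A' I hI q0
      (fun α _ => Submodule.subset_span ⟨(⟨0, by simpa [deg] using hm⟩, α), S_zero hm _⟩) hq0.1
    have hw' : ∀ κ : Ix m n, ∃ t : Ix m n × Ix m n → ℝ, κ ∈ A'' → (∑ p, t p • v p) κ = 1 ∧
        ∀ κ' ∈ A'', κ' ≠ κ → (∑ p, t p • v p) κ' = 0 := by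
      intro κ
      by_cases hκ : κ ∈ A''
      · obtain ⟨w, hwI, h1, h2⟩ := hw κ hκ
        obtain ⟨t, ht⟩ := (Submodule.mem_span_range_iff_exists_fun ℝ).1 hwI
        exact ⟨t, fun _ => by rw [ht]; exact ⟨h1, h2⟩⟩
      · exact ⟨0, fun h => absurd h hκ⟩
    choose t ht using hw'
    let W : (Ix m n → V m n) → Ix m n → V m n := fun q κ => ∑ p, t κ p • S p.1 (q p.2)
    let ε : ℝ := 1 / (2 * ((Fintype.card (Ix m n) : ℝ) + 1))
    have hε : 0 < ε := by positivity
    let O : Set (Ix m n → V m n) := ⋂ κ, ⋂ j, {q | |W q κ j - W q0 κ j| < ε}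
    have hO : IsOpen O := by
      refine isOpen_iInter_of_finite fun κ => isOpen_iInter_of_finite fun j => isOpen_lt ?_ continuous_const
      have : Continuous fun q : Ix m n → V m n => W q κ j := by
        simp only [W, Finset.sum_apply, Pi.smul_apply, smul_eq_mul]
        refine continuous_finsetSum _ fun p _ => continuous_const.mul ?_
        rcases S_cases p.1 j with ⟨β, e, h⟩ | ⟨e, h⟩
        · simp only [h]; fun_prop
        · simp only [h]; fun_prop
      fun_prop
    refine ⟨O, mem_nhdsWithin_of_mem_nhds (hO.mem_nhds ?_), 2 * ∑ κ, ∑ p, |t κ p|, fun q hq => ?_⟩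
    · simp only [O, Set.mem_iInter, Set.mem_ofPred_eq, sub_self, abs_zero]
      exact fun _ _ => hε
    · simp only [O, Set.mem_iInter, Set.mem_ofPred_eq] at hq
      refine ⟨A'', hM, hN, fun κ hκ => ?_⟩
      let T : ({κ // κ ∈ A''} → ℝ) →ₗ[ℝ] ({κ // κ ∈ A''} → ℝ) :=
        { toFun := fun s j => ∑ i, s i * W q i.1 j.1
          map_add' := by
            intro s s'; funext j; simp [add_mul, Finset.sum_add_distrib]
          map_smul' := by
            intro a s; funext j; simp [Finset.mul_sum, mul_assoc] }
      have hT : ∀ s j, T s j = ∑ i, s i * W q i.1 j.1 := fun _ _ => rfl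
      have hs : ∀ (s : {κ // κ ∈ A''} → ℝ) j, s j = ∑ i, s i * W q0 i.1 j.1 := by
        intro s j
        rw [Finset.sum_eq_single j]
        · rw [show W q0 j.1 j.1 = 1 from (ht j.1 j.2).1, mul_one]
        · intro i _ hne
          rw [show W q0 i.1 j.1 = 0 from (ht i.1 i.2).2 j.1 j.2 (fun h => hne (Subtype.ext h.symm)), mul_zero]
        · simp
      obtain ⟨s, hs1, hs2⟩ := NI T (fun s => by
        calc ∑ j, |T s j - s j| ≤ ∑ j : {κ // κ ∈ A''}, ε * ∑ i, |s i| := by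
              refine Finset.sum_le_sum fun j _ => ?_
              rw [hT, hs s j, ← Finset.sum_sub_distrib, Finset.mul_sum]
              refine (Finset.abs_sum_le_sum_abs _ _).trans (Finset.sum_le_sum fun i _ => ?_)
              rw [← mul_sub, abs_mul, mul_comm]
              exact mul_le_mul_of_nonneg_right (hq _ _).le (abs_nonneg _)
          _ ≤ (1 / 2) * ∑ i, |s i| := by
              rw [Finset.sum_const, nsmul_eq_mul, ← mul_assoc]
              refine mul_le_mul_of_nonneg_right ?_ (Finset.sum_nonneg fun _ _ => abs_nonneg _)
              have h1 : ((Finset.univ : Finset {κ // κ ∈ A''}).card : ℝ) ≤ Fintype.card (Ix m n) + 1 := by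
                have : (Finset.univ : Finset {κ // κ ∈ A''}).card ≤ Fintype.card (Ix m n) := by
                  rw [Finset.card_univ, Fintype.card_coe]; exact Finset.card_le_univ _
                have : ((Finset.univ : Finset {κ // κ ∈ A''}).card : ℝ) ≤ Fintype.card (Ix m n) := by exact_mod_cast this
                linarith
              calc _ ≤ ((Fintype.card (Ix m n) : ℝ) + 1) * ε := mul_le_mul_of_nonneg_right h1 hε.le
                _ = 1 / 2 := by simp only [ε]; field_simp) (Pi.single ⟨κ, hκ⟩ 1)
      have hv : ∑ i, |(Pi.single ⟨κ, hκ⟩ 1 : {κ // κ ∈ A''} → ℝ) i| = 1 := by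
        rw [Finset.sum_eq_single ⟨κ, hκ⟩]
        · simp
        · intro i _ hi; simp [hi]
        · simp
      rw [hv] at hs2
      have hsum : ∀ j, (∑ p, (∑ i : {κ // κ ∈ A''}, s i * t i.1 p) • S p.1 (q p.2)) j = ∑ i, s i * W q i.1 j := by
        intro j
        simp only [W, Finset.sum_apply, Pi.smul_apply, smul_eq_mul, Finset.mul_sum, Finset.sum_mul]
        rw [Finset.sum_comm]
        refine Finset.sum_congr rfl fun i _ => Finset.sum_congr rfl fun p _ => by ring
      refine ⟨fun p => ∑ i : {κ // κ ∈ A''}, s i * t i.1 p, ?_, ?_, fun κ' hκ' hne => ?_⟩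
      · have hsi : ∀ i, |s i| ≤ 2 := fun i =>
          (Finset.single_le_sum (f := fun i => |s i|) (fun _ _ => abs_nonneg _) (Finset.mem_univ i)).trans (by linarith)
        calc _ ≤ ∑ p, ∑ i : {κ // κ ∈ A''}, 2 * |t i.1 p| := Finset.sum_le_sum fun p _ =>
              (Finset.abs_sum_le_sum_abs _ _).trans (Finset.sum_le_sum fun i _ => by
                rw [abs_mul]; exact mul_le_mul_of_nonneg_right (hsi i) (abs_nonneg _))
          _ = 2 * ∑ i : {κ // κ ∈ A''}, ∑ p, |t i.1 p| := by
              rw [Finset.sum_comm, Finset.mul_sum]; simp only [Finset.mul_sum]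
          _ ≤ _ := by
              refine mul_le_mul_of_nonneg_left ?_ (by norm_num)
              rw [Finset.sum_coe_sort A'' (fun κ => ∑ p, |t κ p|)]
              exact Finset.sum_le_sum_of_subset_of_nonneg (Finset.subset_univ _)
                fun _ _ _ => Finset.sum_nonneg fun _ _ => abs_nonneg _
      · rw [hsum κ]
        have := congrFun hs1 ⟨κ, hκ⟩
        rw [hT] at this
        simpa using this
      · rw [hsum κ']
        have := congrFun hs1 ⟨κ', hκ'⟩
        rw [hT] at this
        rw [this, Pi.single_apply, if_neg]
        exact fun h => hne (congrArg Subtype.val h)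

end FP


namespace FP
variable {m n : ℕ}

/-- symmetric perturbations -/
def Sy (G : ℝ → Set (V m n)) (M : ℝ) (P u : V m n) : Prop := P + u ∈ G M ∧ P - u ∈ G M

section
variable {G : ℝ → Set (V m n)} {Cm M M' C C' : ℝ} {P u : V m n} {A : Finset (Ix m n)}

lemma Sy.mono (hG : AG Cm G) (h : Sy G M P u) (hM : M ≤ M') : Sy G M' P u :=
  ⟨hG.mono _ _ _ hM h.1, hG.mono _ _ _ hM h.2⟩

lemma Sy.neg (h : Sy G M P u) : Sy G M P (-u) := ⟨by rw [← sub_eq_add_neg]; exact h.2, by rw [sub_neg_eq_add]; exact h.1⟩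

lemma Sy.half (hG : AG Cm G) (h : Sy G M P u) {t : ℝ} (ht : |t| ≤ 1) : P + t • u ∈ G M := by
  have h1 := abs_le.1 ht
  have := hG.conv M h.1 h.2 (a := (1 + t) / 2) (b := (1 - t) / 2) (by linarith) (by linarith) (by ring)
  convert this using 1
  module

lemma Sy.smul (hG : AG Cm G) (h : Sy G M P u) {t : ℝ} (ht : |t| ≤ 1) : Sy G M P (t • u) :=
  ⟨h.half hG ht, by
    have := h.half hG (t := -t) (by rwa [abs_neg])
    rwa [neg_smul, ← sub_eq_add_neg] at this⟩

lemma Sy.mem (hG : AG Cm G) (h : Sy G M P u) : P ∈ G M := by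
  simpa using h.half hG (t := 0) (by simp)

lemma Sy.zero (h : P ∈ G M) : Sy G M P 0 := ⟨by simpa, by simpa⟩

lemma Sy.sum {ι : Type*} (s : Finset ι) (hG : AG Cm G) (hP : P ∈ G M) (u : ι → V m n) (a : ι → ℝ)
    (hu : ∀ i ∈ s, Sy G M P (u i)) (ha : ∑ i ∈ s, |a i| ≤ 1) : Sy G M P (∑ i ∈ s, a i • u i) := by
  have key : ∀ (b : ι → ℝ), ∑ i ∈ s, |b i| ≤ 1 → P + ∑ i ∈ s, b i • u i ∈ G M := by
    intro b hb
    rcases eq_or_lt_of_le (Finset.sum_nonneg fun i (_ : i ∈ s) => abs_nonneg (b i)) with h0 | h0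
    · rw [Finset.sum_eq_zero, add_zero]; · exact hP
      intro i hi
      rw [abs_eq_zero.1 ((Finset.sum_eq_zero_iff_of_nonneg fun i _ => abs_nonneg (b i)).1 h0.symm i hi), zero_smul]
    · set w := ∑ i ∈ s, |b i| with hw
      have h1 : ∑ i ∈ s, (|b i| / w) • (P + (b i / |b i|) • u i) ∈ G M := by
        refine (hG.conv M).sum_mem (fun i _ => by positivity) (by rw [← Finset.sum_div, ← hw, div_self h0.ne']) ?_
        intro i hi
        refine (hu i hi).half hG ?_
        rw [abs_div, abs_abs]
        exact div_self_le_one _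
      have h2 := hG.conv M h1 hP h0.le (sub_nonneg.2 hb) (by ring)
      convert h2 using 1
      have e : ∀ i, (|b i| / w) • (P + (b i / |b i|) • u i) = (|b i| / w) • P + (b i / w) • u i := by
        intro i
        rw [smul_add, smul_smul]
        congr 2
        by_cases hbi : b i = 0
        · simp [hbi]
        · have := abs_pos.2 hbi; field_simp
      rw [Finset.sum_congr rfl fun i _ => e i, Finset.sum_add_distrib, ← Finset.sum_smul, ← Finset.sum_div, ← hw,
        div_self h0.ne', one_smul, smul_add, Finset.smul_sum]
      have : ∀ i, w • (b i / w) • u i = b i • u i := fun i => by rw [smul_smul]; congr 1; field_simp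
      rw [Finset.sum_congr rfl fun i _ => this i]
      module
  refine ⟨key a ha, ?_⟩
  have := key (fun i => - a i) (by simpa using ha)
  simpa [sub_eq_add_neg] using this

lemma Sy.mult (hG : AG Cm G) {q : V m n} (h : Sy G M P q) (hq : ∀ α, |q α| ≤ M) (γ : Ix m n) :
    Sy G (Cm * M) P ((2 * c0 m) • S γ q) := by
  refine ⟨hG.mult M P q γ h.1 h.2 hq, ?_⟩
  have := hG.mult M P (-q) γ h.neg.1 h.neg.2 (by simpa using hq)
  have e : S γ (-q) = - S γ q := by
    have := S_smul γ (-1) q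
    simpa using this
  rw [e, smul_neg, ← sub_eq_add_neg] at this
  exact this

/-- weak basis -/
def AWB (G : ℝ → Set (V m n)) (A : Finset (Ix m n)) (P : V m n) (C : ℝ) : Prop :=
  P ∈ G C ∧ ∀ α ∈ A, ∃ p : V m n, Sy G C P p ∧ p α = 1 / C ∧ (∀ α' ∈ A, α' ≠ α → p α' = 0) ∧
    ∀ β : Ix m n, deg α.1 ≤ deg β.1 → |p β| ≤ C

/-- strong basis -/
def AWS (G : ℝ → Set (V m n)) (A : Finset (Ix m n)) (P : V m n) (C : ℝ) : Prop :=
  P ∈ G C ∧ ∀ α ∈ A, ∃ p : V m n, Sy G C P p ∧ p α = 1 / C ∧ (∀ α' ∈ A, α' ≠ α → p α' = 0) ∧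
    ∀ β : Ix m n, |p β| ≤ C

lemma AWB.mono (hG : AG Cm G) (hC : 0 < C) (h : AWB G A P C) (hCC : C ≤ C') : AWB G A P C' := by
  refine ⟨hG.mono _ _ _ hCC h.1, fun α hα => ?_⟩
  obtain ⟨p, h1, h2, h3, h4⟩ := h.2 α hα
  have hC' : 0 < C' := hC.trans_le hCC
  have hr : |C / C'| ≤ 1 := by
    rw [abs_of_pos (by positivity)]; exact (div_le_one hC').2 hCC
  refine ⟨(C / C') • p, (h1.smul hG hr).mono hG hCC, ?_, fun α' h5 h6 => ?_, fun β hβ => ?_⟩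
  · rw [Pi.smul_apply, smul_eq_mul, h2]; field_simp
  · rw [Pi.smul_apply, smul_eq_mul, h3 α' h5 h6, mul_zero]
  · rw [Pi.smul_apply, smul_eq_mul, abs_mul]
    calc _ ≤ 1 * C := mul_le_mul hr (h4 β hβ) (abs_nonneg _) zero_le_one
      _ ≤ C' := by linarith

end

open Classical in
lemma echelon_unif (hm : 0 < m) (R : ℝ) : ∃ C : ℝ, 1 ≤ C ∧ ∀ (A' : Finset (Ix m n)) (q : Ix m n → V m n),
    (∀ α ∈ A', ∀ α' ∈ A', q α α' = if α = α' then 1 else 0) → (∀ α β, |q α β| ≤ R) → Ech A' q C := by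
  have h := fun A' : Finset (Ix m n) => echelon_compact hm A' R
  choose c hc using h
  refine ⟨1 + ∑ A', |c A'|, by
    have := Finset.sum_nonneg (s := Finset.univ) fun (A' : Finset (Ix m n)) _ => abs_nonneg (c A')
    linarith, fun A' q h1 h2 => (hc A' q ?_ h2).mono ?_⟩
  · intro α h3 α' h4
    exact h1 α h3 α' h4
  · have := Finset.single_le_sum (f := fun A' : Finset (Ix m n) => |c A'|) (fun _ _ => abs_nonneg _) (Finset.mem_univ A')
    have h3 := le_abs_self (c A')
    linarith

lemma c0_le (m : ℕ) : c0 m ≤ 1 := by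
  unfold c0; exact pow_le_one₀ (by norm_num) (by norm_num)

open Classical in
set_option maxHeartbeats 1000000 in
lemma L0 (hm : 0 < m) {Cm C : ℝ} (hCm : 1 ≤ Cm) (hC : 1 ≤ C) : ∃ C3 : ℝ, 1 ≤ C3 ∧
    ∀ (G : ℝ → Set (V m n)), AG Cm G → ∀ (A : Finset (Ix m n)) (P : V m n) (β : Ix m n) (v : V m n) (p : Ix m n → V m n),
    β ∉ A → Sy G C P v → (∀ b, |v b| ≤ C) → 1 / C ≤ |v β| → (∀ α ∈ A, deg α.1 ≤ deg β.1 → v α = 0) →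
    (∀ α ∈ A, deg α.1 ≤ deg β.1 → Sy G C P (p α) ∧ (∀ b, |p α b| ≤ C) ∧ p α α = 1 / C ∧
      ∀ α' ∈ A, deg α'.1 ≤ deg β.1 → α' ≠ α → p α α' = 0) →
    ∃ A'', Mon A'' ∧ LL A A'' ∧ AWB G A'' P C3 := by
  obtain ⟨C5, hC5, hech⟩ := echelon_unif (m := m) (n := n) hm (C ^ 2 + C ^ 4)
  have hC0 : 0 < C := by linarith
  set R' := C + C ^ 3 with hR'
  have hR'1 : C ≤ R' := by rw [hR']; nlinarith [pow_pos hC0 3]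
  have hR'0 : 0 < R' := by linarith
  have hc0 := c0_pos (m := m)
  set C3 := Cm * C + R' * C5 / (2 * c0 m) + C5 * (C ^ 2 + C ^ 4) with hC3
  have hCmC : 1 ≤ Cm * C := by nlinarith
  have ha1 : 0 ≤ R' * C5 / (2 * c0 m) := by positivity
  have ha2 : 0 ≤ C5 * (C ^ 2 + C ^ 4) := by positivity
  refine ⟨C3, by rw [hC3]; linarith, ?_⟩
  intro G hG A P β v p hβ hv hvb hvβ hvA hp
  have hC31 : 1 ≤ C3 := by rw [hC3]; linarith
  have hPm := hv.mem hG
  have hvβ0 : 0 < |v β| := lt_of_lt_of_le (by positivity) hvβ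
  have hvne : v β ≠ 0 := abs_pos.1 hvβ0
  have hinv : |(v β)⁻¹| ≤ C := by
    rw [abs_inv]
    rw [inv_le_comm₀ hvβ0 hC0]
    simpa using hvβ
  have hAne : ∀ α ∈ A, α ≠ β := fun α h h' => hβ (h' ▸ h)
  let A' : Finset (Ix m n) := insert β (A.filter fun α => deg α.1 ≤ deg β.1)
  let q : Ix m n → V m n := fun α => if α = β then (v β)⁻¹ • v else
    if α ∈ A ∧ deg α.1 ≤ deg β.1 then C • p α + (-(C * p α β) * (v β)⁻¹) • v else 0
  have q1 : q β = (v β)⁻¹ • v := by simp [q]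
  have q2 : ∀ α, α ∈ A → deg α.1 ≤ deg β.1 → q α = C • p α + (-(C * p α β) * (v β)⁻¹) • v := by
    intro α h1 h2
    simp only [q]
    rw [if_neg (hAne α h1), if_pos ⟨h1, h2⟩]
  have q3 : ∀ α, α ≠ β → ¬ (α ∈ A ∧ deg α.1 ≤ deg β.1) → q α = 0 := by
    intro α h1 h2
    simp only [q]
    rw [if_neg h1, if_neg h2]
  have hpc : ∀ α, α ∈ A → deg α.1 ≤ deg β.1 → |(-(C * p α β) * (v β)⁻¹)| ≤ C ^ 3 := by
    intro α h1 h2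
    rw [abs_mul, abs_neg, abs_mul, abs_of_pos hC0]
    calc C * |p α β| * |(v β)⁻¹| ≤ C * C * C := by
          have := (hp α h1 h2).2.1 β
          gcongr
      _ = C ^ 3 := by ring
  have hqR : ∀ α b, |q α b| ≤ C ^ 2 + C ^ 4 := by
    intro α b
    by_cases h1 : α = β
    · rw [h1, q1, Pi.smul_apply, smul_eq_mul, abs_mul]
      have := mul_le_mul hinv (hvb b) (abs_nonneg _) hC0.le
      nlinarith [pow_pos hC0 4]
    · by_cases h2 : α ∈ A ∧ deg α.1 ≤ deg β.1
      · rw [q2 α h2.1 h2.2, Pi.add_apply, Pi.smul_apply, Pi.smul_apply, smul_eq_mul, smul_eq_mul]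
        refine (abs_add_le _ _).trans ?_
        rw [abs_mul, abs_mul _ (v b), abs_of_pos hC0]
        have e1 := mul_le_mul_of_nonneg_left ((hp α h2.1 h2.2).2.1 b) hC0.le
        have e2 := mul_le_mul (hpc α h2.1 h2.2) (hvb b) (abs_nonneg _) (by positivity)
        nlinarith
      · rw [q3 α h1 h2]; simp; positivity
  have hqS : ∀ α, Sy G C P ((1 / R') • q α) := by
    intro α
    by_cases h1 : α = β
    · rw [h1, q1, smul_smul]
      refine hv.smul hG ?_
      rw [abs_mul, abs_of_pos (by positivity)]
      rw [one_div_mul_eq_div, div_le_one hR'0]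
      linarith
    · by_cases h2 : α ∈ A ∧ deg α.1 ≤ deg β.1
      · rw [q2 α h2.1 h2.2]
        have := Sy.sum (Finset.univ : Finset (Fin 2)) hG hPm ![p α, v] ![1 / R' * C, 1 / R' * (-(C * p α β) * (v β)⁻¹)]
          (by
            intro i _
            fin_cases i
            · exact (hp α h2.1 h2.2).1
            · exact hv) (by
            rw [Fin.sum_univ_two]
            simp only [Matrix.cons_val_zero, Matrix.cons_val_one]
            rw [abs_mul, abs_mul (1 / R'), ← mul_add, abs_of_pos (show 0 < 1 / R' by positivity), abs_of_pos hC0,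
              one_div_mul_eq_div, div_le_one hR'0]
            linarith [hpc α h2.1 h2.2])
        rw [Fin.sum_univ_two] at this
        simp only [Matrix.cons_val_zero, Matrix.cons_val_one] at this
        rwa [smul_add, smul_smul, smul_smul]
      · rw [q3 α h1 h2, smul_zero]; exact Sy.zero hPm
  have hqC : ∀ α b, |((1 / R') • q α) b| ≤ C := by
    intro α b
    rw [Pi.smul_apply, smul_eq_mul, abs_mul, abs_of_pos (show 0 < 1 / R' by positivity), one_div_mul_eq_div,
      div_le_iff₀ hR'0]
    refine (hqR α b).trans (le_of_eq ?_)
    rw [hR']; ring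
  obtain ⟨A'', hM, hN, hw⟩ := hech A' q (by
    intro α hα α' hα'
    have hmem : ∀ α, α ∈ A' ↔ α = β ∨ (α ∈ A ∧ deg α.1 ≤ deg β.1) := by simp [A']
    rcases (hmem α).1 hα with rfl | h1
    · rcases (hmem α').1 hα' with rfl | h2
      · rw [q1, Pi.smul_apply, smul_eq_mul, inv_mul_cancel₀ hvne]; simp
      · rw [q1, Pi.smul_apply, smul_eq_mul, hvA α' h2.1 h2.2, mul_zero, if_neg (hAne α' h2.1).symm]
    · rw [q2 α h1.1 h1.2, Pi.add_apply, Pi.smul_apply, Pi.smul_apply, smul_eq_mul, smul_eq_mul]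
      rcases (hmem α').1 hα' with rfl | h2
      · rw [if_neg (hAne α h1.1)]; field_simp; ring
      · rw [hvA α' h2.1 h2.2, mul_zero, add_zero]
        by_cases h : α = α'
        · subst h
          rw [if_pos rfl, (hp α h1.1 h1.2).2.2.1]; field_simp
        · rw [if_neg h, (hp α h1.1 h1.2).2.2.2 α' h2.1 h2.2 (Ne.symm h), mul_zero]) hqR
  refine ⟨A'', hM, ⟨deg β.1, fun i hi => ?_, ?_⟩, hG.mono _ _ _ ?_ hPm, fun κ hκ => ?_⟩
  · refine le_trans (Finset.card_le_card ?_) (hN i)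
    intro α hα
    rw [Finset.mem_filter] at hα ⊢
    exact ⟨Finset.mem_insert_of_mem (Finset.mem_filter.2 ⟨hα.1, hα.2.trans hi.le⟩), hα.2⟩
  · refine lt_of_lt_of_le (Finset.card_lt_card ?_) (hN (deg β.1))
    refine (Finset.ssubset_iff_of_subset ?_).2 ⟨β, ?_, ?_⟩
    · intro α hα
      rw [Finset.mem_filter] at hα ⊢
      exact ⟨Finset.mem_insert_of_mem (Finset.mem_filter.2 hα), hα.2⟩
    · exact Finset.mem_filter.2 ⟨Finset.mem_insert_self _ _, le_rfl⟩
    · exact fun h => hβ (Finset.mem_filter.1 h).1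
  · rw [hC3]; nlinarith
  · obtain ⟨t, ht, h1, h2⟩ := hw κ hκ
    have hC30 : 0 < C3 := by linarith
    have hlev : Cm * C ≤ C3 := by rw [hC3]; linarith
    refine ⟨(1 / C3) • ∑ p, t p • S p.1 (q p.2), ?_, ?_, fun κ' h3 h4 => ?_, fun b _ => ?_⟩
    · have := Sy.sum Finset.univ hG (hG.mono _ _ _ (show C ≤ Cm * C by nlinarith) hPm)
        (fun p : Ix m n × Ix m n => (2 * c0 m) • S p.1 ((1 / R') • q p.2))
        (fun p => t p * (R' / (C3 * (2 * c0 m)))) (fun p _ => (hqS p.2).mult hG (hqC p.2) p.1) (by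
          simp only [abs_mul]
          rw [← Finset.sum_mul, abs_of_pos (show 0 < R' / (C3 * (2 * c0 m)) by positivity)]
          calc _ ≤ C5 * (R' / (C3 * (2 * c0 m))) := mul_le_mul_of_nonneg_right ht (by positivity)
            _ = (R' * C5 / (2 * c0 m)) / C3 := by field_simp
            _ ≤ 1 := by rw [div_le_one hC30, hC3]; linarith)
      have h5 := this.mono hG hlev
      convert h5 using 1
      rw [Finset.smul_sum]
      refine Finset.sum_congr rfl fun p _ => ?_
      rw [S_smul, smul_smul, smul_smul, smul_smul]
      congr 1
      field_simp
    · rw [Pi.smul_apply, smul_eq_mul, h1, mul_one]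
    · rw [Pi.smul_apply, smul_eq_mul, h2 κ' h3 h4, mul_zero]
    · rw [Pi.smul_apply, smul_eq_mul, Finset.sum_apply, abs_mul, abs_of_pos (show 0 < 1 / C3 by positivity)]
      have h5 : |∑ c, (t c • S c.1 (q c.2)) b| ≤ C5 * (C ^ 2 + C ^ 4) := by
        refine (Finset.abs_sum_le_sum_abs _ _).trans ?_
        refine le_trans (Finset.sum_le_sum fun c _ => ?_) (le_trans (le_of_eq (Finset.sum_mul Finset.univ (fun c => |t c|) (C ^ 2 + C ^ 4)).symm)
          (mul_le_mul_of_nonneg_right ht (by positivity)))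
        rw [Pi.smul_apply, smul_eq_mul, abs_mul]
        exact mul_le_mul_of_nonneg_left (S_le _ (by positivity) (hqR _) _) (abs_nonneg _)
      have h6 : C5 * (C ^ 2 + C ^ 4) ≤ C3 := by rw [hC3]; linarith
      have h7 : 1 / C3 ≤ 1 := by rw [div_le_one hC30]; exact hC31
      calc _ ≤ 1 * C3 := mul_le_mul h7 (h5.trans h6) (abs_nonneg _) zero_le_one
        _ = C3 := one_mul _

lemma L1 (hm : 0 < m) {Cm C : ℝ} (hCm : 1 ≤ Cm) (hC : 1 ≤ C) : ∃ C3 : ℝ, 1 ≤ C3 ∧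
    ∀ (G : ℝ → Set (V m n)), AG Cm G → ∀ (A : Finset (Ix m n)) (P : V m n), AWB G A P C →
    AWS G A P C ∨ ∃ A'', Mon A'' ∧ LL A A'' ∧ AWB G A'' P C3 := by
  obtain ⟨C3, hC3, h0⟩ := L0 (n := n) hm hCm hC
  refine ⟨C3, hC3, fun G hG A P h => ?_⟩
  classical
  by_cases hs : AWS G A P C
  · exact Or.inl hs
  refine Or.inr ?_
  have h' : ∀ α : Ix m n, ∃ p : V m n, α ∈ A → Sy G C P p ∧ p α = 1 / C ∧ (∀ α' ∈ A, α' ≠ α → p α' = 0) ∧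
    ∀ β : Ix m n, deg α.1 ≤ deg β.1 → |p β| ≤ C := by
    intro α
    by_cases hα : α ∈ A
    · obtain ⟨p, hp⟩ := h.2 α hα
      exact ⟨p, fun _ => hp⟩
    · exact ⟨0, fun h => absurd h hα⟩
  choose p hp using h'
  have hbad : (A.filter fun α => ∃ b, C < |p α b|).Nonempty := by
    by_contra hne
    rw [Finset.not_nonempty_iff_eq_empty, Finset.filter_eq_empty_iff] at hne
    refine hs ⟨h.1, fun α hα => ⟨p α, (hp α hα).1, (hp α hα).2.1, (hp α hα).2.2.1, fun β => ?_⟩⟩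
    by_contra hb
    exact hne hα ⟨β, not_le.1 hb⟩
  obtain ⟨α, hα, hmin⟩ := Finset.exists_min_image _ (fun α : Ix m n => deg α.1) hbad
  rw [Finset.mem_filter] at hα
  obtain ⟨hαA, b0, hb0⟩ := hα
  obtain ⟨β, -, hmax⟩ := Finset.exists_max_image (Finset.univ : Finset (Ix m n)) (fun b => |p α b|) ⟨b0, Finset.mem_univ _⟩
  have hβC : C < |p α β| := hb0.trans_le (hmax b0 (Finset.mem_univ _))
  have hβ0 : 0 < |p α β| := by linarith
  obtain ⟨h1, h2, h3, h4⟩ := hp α hαA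
  have hdeg : deg β.1 < deg α.1 := by
    by_contra hd
    exact absurd (h4 β (not_lt.1 hd)) (not_le.2 hβC)
  have hβA : β ∉ A := by
    intro hβ
    have := h3 β hβ (fun h => by rw [h] at hdeg; exact lt_irrefl _ hdeg)
    rw [this, abs_zero] at hβ0
    exact lt_irrefl _ hβ0
  have hC0 : 0 < C := by linarith
  have hin : |1 / (|p α β|)| ≤ 1 := by
    rw [abs_of_pos (by positivity), div_le_one hβ0]; linarith
  refine h0 G hG A P β ((1 / |p α β|) • p α) p hβA (h1.smul hG hin) (fun b => ?_) ?_ (fun α' h5 h6 => ?_) (fun α' h5 h6 => ?_)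
  · rw [Pi.smul_apply, smul_eq_mul, abs_mul, abs_of_pos (show 0 < 1 / |p α β| by positivity), one_div_mul_eq_div]
    exact ((div_le_one hβ0).2 (hmax b (Finset.mem_univ _))).trans hC
  · rw [Pi.smul_apply, smul_eq_mul, abs_mul, abs_of_pos (show 0 < 1 / |p α β| by positivity), one_div_mul_eq_div,
      div_self hβ0.ne', div_le_one hC0]
    exact hC
  · rw [Pi.smul_apply, smul_eq_mul, h3 α' h5, mul_zero]
    rintro rfl; omega
  · obtain ⟨g1, g2, g3, g4⟩ := hp α' h5
    refine ⟨g1, fun b => ?_, g2, fun α'' h7 _ h8 => g3 α'' h7 h8⟩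
    by_contra hb
    have := hmin α' (Finset.mem_filter.2 ⟨h5, b, not_le.1 hb⟩)
    omega

end FP


namespace FP
variable {m n : ℕ}

lemma card_le_DD (A : Finset (Ix m n)) : (A.card : ℝ) ≤ DD m n := by
  unfold DD; exact_mod_cast Finset.card_le_univ A

lemma pick {A : Finset (Ix m n)} {Q : Ix m n → V m n → Prop} (h : ∀ α ∈ A, ∃ p, Q α p) :
    ∃ p : Ix m n → V m n, ∀ α ∈ A, Q α (p α) := by
  classical
  have : ∀ α : Ix m n, ∃ p, α ∈ A → Q α p := fun α => by
    by_cases hα : α ∈ A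
    · obtain ⟨p, hp⟩ := h α hα; exact ⟨p, fun _ => hp⟩
    · exact ⟨0, fun h => absurd h hα⟩
  choose p hp using this
  exact ⟨p, hp⟩

set_option maxHeartbeats 1000000 in
lemma ND (hm : 0 < m) {Cm C D : ℝ} (hCm : 1 ≤ Cm) (hC : 1 ≤ C) (hD : 1 ≤ D) : ∃ C3 η : ℝ, 1 ≤ C3 ∧ 0 < η ∧
    ∀ (G : ℝ → Set (V m n)), AG Cm G → ∀ (A : Finset (Ix m n)) (P0 Y : V m n), AWB G A P0 C → Y ∈ G C →
    (∀ b, |Y b - P0 b| ≤ 1) → (∃ b, 1 / D ≤ |Y b - P0 b|) → (∀ α ∈ A, |Y α - P0 α| ≤ η) →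
    ∃ A'' P, Mon A'' ∧ LL A A'' ∧ (∀ α ∈ A, P α = P0 α) ∧ (∀ b, |P b - P0 b| ≤ 1) ∧ AWB G A'' P C3 := by
  obtain ⟨K1, hK1, hL1⟩ := L1 (n := n) hm hCm hC
  have hDD := DD_nonneg (m := m) (n := n)
  have hCt : 1 ≤ 8 * D * C := by nlinarith
  obtain ⟨K0, hK0, hL0⟩ := L0 (n := n) hm hCm hCt
  have hC0 : 0 < C := by linarith
  have hD0 : 0 < D := by linarith
  set η := 1 / (2 * D * C ^ 2 * (DD m n + 1)) with hη
  have hη0 : 0 < η := by positivity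
  have hη1 : DD m n * C * η * C ≤ 1 / (2 * D) := by
    rw [hη]
    rw [show DD m n * C * (1 / (2 * D * C ^ 2 * (DD m n + 1))) * C = (1 / (2 * D)) * (DD m n / (DD m n + 1)) by
      field_simp]
    have : DD m n / (DD m n + 1) ≤ 1 := by rw [div_le_one (by linarith)]; linarith
    have h2 : 0 < 1 / (2 * D) := by positivity
    nlinarith
  have hDinv : 1 / (2 * D) ≤ 1 / 2 := by
    apply one_div_le_one_div_of_le <;> linarith
  have hη2 : DD m n * (C * η) ≤ 1 := by
    have : 0 ≤ DD m n * C * η := by positivity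
    nlinarith
  refine ⟨K1 + K0, η, by linarith, hη0, fun G hG A P0 Y hAW hY hU1 hUD hUA => ?_⟩
  rcases hL1 G hG A P0 hAW with hS | ⟨A'', h1, h2, h3⟩
  swap
  · exact ⟨A'', P0, h1, h2, fun _ _ => rfl, fun b => by simp, h3.mono hG (by linarith) (by linarith)⟩
  obtain ⟨p, hp⟩ := pick hS.2
  set e := ∑ α ∈ A, (C * (Y α - P0 α)) • p α with he
  have heS : Sy G C P0 e := by
    refine Sy.sum A hG hS.1 p _ (fun α hα => (hp α hα).1) ?_
    calc ∑ α ∈ A, |C * (Y α - P0 α)| ≤ A.card • (C * η) := Finset.sum_le_card_nsmul _ _ _ fun α hα => by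
          rw [abs_mul, abs_of_pos hC0]; exact mul_le_mul_of_nonneg_left (hUA α hα) hC0.le
      _ ≤ DD m n * (C * η) := by
          rw [nsmul_eq_mul]; exact mul_le_mul_of_nonneg_right (card_le_DD A) (by positivity)
      _ ≤ 1 := hη2
  have heb : ∀ b, |e b| ≤ 1 / (2 * D) := by
    intro b
    rw [he, Finset.sum_apply]
    refine (Finset.abs_sum_le_sum_abs _ _).trans ?_
    calc ∑ α ∈ A, |((C * (Y α - P0 α)) • p α) b| ≤ A.card • (C * η * C) := Finset.sum_le_card_nsmul _ _ _ fun α hα => by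
          rw [Pi.smul_apply, smul_eq_mul, abs_mul, abs_mul, abs_of_pos hC0]
          exact mul_le_mul (mul_le_mul_of_nonneg_left (hUA α hα) hC0.le) ((hp α hα).2.2.2 b) (abs_nonneg _) (by positivity)
      _ ≤ DD m n * (C * η * C) := by
          rw [nsmul_eq_mul]; exact mul_le_mul_of_nonneg_right (card_le_DD A) (by positivity)
      _ = DD m n * C * η * C := by ring
      _ ≤ _ := hη1
  have heA : ∀ α ∈ A, e α = Y α - P0 α := by
    intro α hα
    rw [he, Finset.sum_apply, Finset.sum_eq_single_of_mem α hα]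
    · rw [Pi.smul_apply, smul_eq_mul, (hp α hα).2.1]; field_simp
    · intro α' hα' hne
      rw [Pi.smul_apply, smul_eq_mul, (hp α' hα').2.2.1 α hα hne.symm, mul_zero]
  set U := Y - P0 - e with hU
  have hUz : ∀ α ∈ A, U α = 0 := by
    intro α hα
    simp only [hU, Pi.sub_apply]; rw [heA α hα]; ring
  have hUb : ∀ b, |U b| ≤ 2 := by
    intro b
    simp only [hU, Pi.sub_apply]
    have := abs_sub (Y b - P0 b) (e b)
    linarith [hU1 b, heb b]
  obtain ⟨β, hβ⟩ := hUD
  have hUβ : 1 / (2 * D) ≤ |U β| := by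
    simp only [hU, Pi.sub_apply]
    have h1 := abs_sub_abs_le_abs_sub (Y β - P0 β) (e β)
    have h2 := heb β
    have h3 : 1 / D = 2 * (1 / (2 * D)) := by field_simp
    linarith
  have hβA : β ∉ A := by
    intro h
    rw [hUz β h, abs_zero] at hUβ
    have : 0 < 1 / (2 * D) := by positivity
    linarith
  have hmid : P0 + (1 / 2 : ℝ) • U ∈ G C := by
    have := hG.conv C hY heS.2 (a := 1 / 2) (b := 1 / 2) (by norm_num) (by norm_num) (by norm_num)
    convert this using 1
    rw [hU]; module
  set P := P0 + (1 / 4 : ℝ) • U with hP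
  have hCC : C ≤ 8 * D * C := by nlinarith
  have hvS : Sy G C P ((1 / 4 : ℝ) • U) := by
    constructor
    · convert hmid using 1; rw [hP]; module
    · convert hS.1 using 1; rw [hP]; module
  have h8 : 0 < 1 / (8 * D) := by positivity
  have h81 : 1 / (8 * D) ≤ 1 / 8 := by apply one_div_le_one_div_of_le <;> linarith
  obtain ⟨A'', h1, h2, h3⟩ := hL0 G hG A P β ((1 / 4 : ℝ) • U) (fun α => (1 / (8 * D)) • p α) hβA (hvS.mono hG hCC)
    (fun b => by
      rw [Pi.smul_apply, smul_eq_mul, abs_mul, abs_of_pos (by norm_num)]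
      linarith [hUb b])
    (by
      rw [Pi.smul_apply, smul_eq_mul, abs_mul, abs_of_pos (show (0:ℝ) < 1 / 4 by norm_num)]
      have : 1 / (8 * D * C) ≤ 1 / (8 * D) := one_div_le_one_div_of_le (by positivity) (by nlinarith)
      have h3 : 1 / (8 * D) = 1 / 4 * (1 / (2 * D)) := by field_simp; norm_num
      linarith)
    (fun α hα _ => by rw [Pi.smul_apply, smul_eq_mul, hUz α hα, mul_zero])
    (fun α hα _ => by
      obtain ⟨g1, g2, g3, g4⟩ := hp α hα
      refine ⟨Sy.mono hG ?_ hCC, fun b => ?_, ?_, fun α' h1 _ h2 => ?_⟩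
      · have key : ∀ s : ℝ, |s| ≤ 1 → P + (s / 2) • p α ∈ G C := by
          intro s hs
          have := hG.conv C hmid (g1.half hG hs) (a := 1 / 2) (b := 1 / 2) (by norm_num) (by norm_num) (by norm_num)
          convert this using 1
          rw [hP]; module
        have hb : |2 * (1 / (8 * D))| ≤ 1 := by rw [abs_of_pos (by positivity)]; linarith
        constructor
        · have := key (2 * (1 / (8 * D))) hb
          convert this using 3; ring
        · have := key (-(2 * (1 / (8 * D)))) (by rwa [abs_neg])
          convert this using 1
          module
      · rw [Pi.smul_apply, smul_eq_mul, abs_mul, abs_of_pos h8]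
        have := g4 b
        nlinarith [abs_nonneg (p α b)]
      · rw [Pi.smul_apply, smul_eq_mul, g2]; field_simp
      · rw [Pi.smul_apply, smul_eq_mul, g3 α' h1 h2, mul_zero])
  refine ⟨A'', P, h1, h2, fun α hα => ?_, fun b => ?_, h3.mono hG (by linarith) (by linarith)⟩
  · rw [hP, Pi.add_apply, Pi.smul_apply, smul_eq_mul, hUz α hα]; ring
  · rw [hP, Pi.add_apply, Pi.smul_apply, smul_eq_mul, add_sub_cancel_left, abs_mul, abs_of_pos (by norm_num)]
    linarith [hUb b]

open Classical in
set_option maxHeartbeats 1000000 in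
lemma TR {Cm C0 : ℝ} (hC : 1 ≤ C0) : ∃ C1 ε : ℝ, C0 ≤ C1 ∧ 0 < ε ∧ ε ≤ 1 ∧
    ∀ (G : ℝ → Set (V m n)), AG Cm G → ∀ (A : Finset (Ix m n)) (P0 Y0 : V m n) (p Yp Ym : Ix m n → V m n),
    Y0 ∈ G C0 → (∀ b, |Y0 b - P0 b| ≤ ε) →
    (∀ α ∈ A, Yp α ∈ G C0 ∧ Ym α ∈ G C0 ∧ (∀ b, |p α b| ≤ C0) ∧ p α α = 1 / C0 ∧ (∀ α' ∈ A, α' ≠ α → p α α' = 0) ∧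
      (∀ b, |Yp α b - (P0 + p α) b| ≤ ε) ∧ (∀ b, |Ym α b - (P0 - p α) b| ≤ ε)) →
    ∃ P, (∀ α ∈ A, P α = P0 α) ∧ (∀ b, |P b - P0 b| ≤ C1) ∧ AWB G A P C1 := by
  have hDD := DD_nonneg (m := m) (n := n)
  have hC00 : 0 < C0 := by linarith
  set D := DD m n + 1 with hD
  have hD1 : 1 ≤ D := by linarith
  have hD0 : 0 < D := by linarith
  set ε := 1 / (4 * C0 * D ^ 2) with hε
  have hε0 : 0 < ε := by positivity
  have hεb : ε * (4 * C0 * D ^ 2) = 1 := by rw [hε]; field_simp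
  have hCD : C0 ≤ C0 * D ^ 2 := by nlinarith [mul_nonneg hC00.le (sub_nonneg.2 (one_le_pow₀ hD1 (n := 2)))]
  have hε1 : ε ≤ 1 := by
    nlinarith
  have hCsq : C0 ≤ C0 ^ 2 := by nlinarith
  have hC1 : C0 ≤ 4 * C0 ^ 2 * D := by nlinarith [mul_le_mul_of_nonneg_left hD1 (sq_nonneg C0)]
  refine ⟨4 * C0 ^ 2 * D, ε, hC1, hε0, hε1, fun G hG A P0 Y0 p Yp Ym hY0 hY0b hA => ?_⟩
  set C1 := 4 * C0 ^ 2 * D with hC1d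
  have hC10 : 0 < C1 := by linarith
  obtain ⟨a, ha⟩ : ∃ a : ℝ, a = (A.card : ℝ) := ⟨_, rfl⟩
  have ha0 : 0 ≤ a := by rw [ha]; positivity
  have haD : a + 1 ≤ D := by have := card_le_DD A; linarith
  set w : ℝ := 1 / (a + 1) with hw
  have hw0 : 0 < w := by positivity
  have hwa : w * (a + 1) = 1 := by rw [hw]; field_simp
  set d : Ix m n → V m n := fun α => (1 / 2 : ℝ) • (Yp α - Ym α) with hd
  set mi : Ix m n → V m n := fun α => (1 / 2 : ℝ) • (Yp α + Ym α) with hmi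
  set Z := w • (Y0 + ∑ α ∈ A, mi α) with hZ
  have hmem : ∀ g : Ix m n → V m n, (∀ α ∈ A, g α ∈ G C0) → w • (Y0 + ∑ α ∈ A, g α) ∈ G C0 := by
    intro g hg
    have h1 : ∑ i ∈ insert none (A.map Function.Embedding.some), w • (fun i : Option (Ix m n) => i.elim Y0 g) i ∈ G C0 := by
      refine (hG.conv C0).sum_mem (fun _ _ => hw0.le) ?_ ?_
      · rw [Finset.sum_const, Finset.card_insert_of_notMem (by simp), Finset.card_map, nsmul_eq_mul]
        push_cast
        rw [mul_comm, ← ha]; exact hwa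
      · intro i hi
        rw [Finset.mem_insert] at hi
        rcases hi with rfl | hi
        · exact hY0
        · obtain ⟨α, hα, rfl⟩ := Finset.mem_map.1 hi
          exact hg α hα
    rw [Finset.sum_insert (by simp), Finset.sum_map] at h1
    rw [smul_add, Finset.smul_sum]
    exact h1
  have hmiG : ∀ α ∈ A, mi α ∈ G C0 := by
    intro α hα
    have := hG.conv C0 (hA α hα).1 (hA α hα).2.1 (a := 1 / 2) (b := 1 / 2) (by norm_num) (by norm_num) (by norm_num)
    rw [hmi]; simp only []; rw [smul_add]; exact this
  have hZG : Z ∈ G C0 := hmem mi hmiG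
  have hZS : ∀ α ∈ A, Sy G C0 Z (w • d α) := by
    intro α hα
    have key : ∀ g : V m n, g ∈ G C0 → Z + w • (g - mi α) ∈ G C0 := by
      intro g hg
      have := hmem (Function.update mi α g) (fun α' hα' => by
        by_cases h : α' = α
        · subst h; simpa using hg
        · rw [Function.update_of_ne h]; exact hmiG α' hα')
      convert this using 1
      rw [hZ, ← smul_add, Finset.sum_update_of_mem hα, ← Finset.add_sum_erase A mi hα,
        Finset.sdiff_singleton_eq_erase]
      congr 1
      abel
    constructor
    · convert key _ (hA α hα).1 using 3
      simp only [hd, hmi]; module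
    · convert key _ (hA α hα).2.1 using 1
      simp only [hd, hmi]; module
  have hdp : ∀ α ∈ A, ∀ b, |d α b - p α b| ≤ ε := by
    intro α hα b
    have h1 := abs_le.1 ((hA α hα).2.2.2.2.2.1 b)
    have h2 := abs_le.1 ((hA α hα).2.2.2.2.2.2 b)
    simp only [Pi.add_apply, Pi.sub_apply] at h1 h2
    simp only [hd, Pi.smul_apply, smul_eq_mul, Pi.sub_apply]
    rw [abs_le]; constructor <;> linarith
  have hmP : ∀ α ∈ A, ∀ b, |mi α b - P0 b| ≤ ε := by
    intro α hα b
    have h1 := abs_le.1 ((hA α hα).2.2.2.2.2.1 b)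
    have h2 := abs_le.1 ((hA α hα).2.2.2.2.2.2 b)
    simp only [Pi.add_apply, Pi.sub_apply] at h1 h2
    simp only [hmi, Pi.smul_apply, smul_eq_mul, Pi.add_apply]
    rw [abs_le]; constructor <;> linarith
  have hZP : ∀ b, |Z b - P0 b| ≤ ε := by
    intro b
    have e : Z b - P0 b = w * ((Y0 b - P0 b) + ∑ α ∈ A, (mi α b - P0 b)) := by
      rw [Finset.sum_sub_distrib, Finset.sum_const, nsmul_eq_mul, ← ha, hZ]
      simp only [Pi.smul_apply, smul_eq_mul, Pi.add_apply, Finset.sum_apply]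
      linear_combination (P0 b) * hwa
    rw [e, abs_mul, abs_of_pos hw0]
    have h1 : |(Y0 b - P0 b) + ∑ α ∈ A, (mi α b - P0 b)| ≤ ε + a * ε := by
      refine (abs_add_le _ _).trans (add_le_add (hY0b b) ((Finset.abs_sum_le_sum_abs _ _).trans ?_))
      rw [ha, ← nsmul_eq_mul]
      exact Finset.sum_le_card_nsmul _ _ _ fun α hα => hmP α hα b
    calc _ ≤ w * (ε + a * ε) := mul_le_mul_of_nonneg_left h1 hw0.le
      _ = ε := by linear_combination ε * hwa
  have hdb : ∀ α ∈ A, ∀ b, |d α b| ≤ 2 * C0 := by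
    intro α hα b
    have h1 := hdp α hα b
    have h2 := (hA α hα).2.2.1 b
    have h3 := abs_sub_abs_le_abs_sub (d α b) (p α b)
    linarith
  -- the correction operator
  let T : ({κ // κ ∈ A} → ℝ) →ₗ[ℝ] ({κ // κ ∈ A} → ℝ) :=
    { toFun := fun s j => ∑ i, s i * (C0 * d i.1 j.1)
      map_add' := by
        intro s s'; funext j; simp [add_mul, Finset.sum_add_distrib]
      map_smul' := by
        intro a s; funext j; simp [Finset.mul_sum, mul_assoc] }
  have hT : ∀ s j, T s j = ∑ i, s i * (C0 * d i.1 j.1) := fun _ _ => rfl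
  have hTs : ∀ (s : {κ // κ ∈ A} → ℝ) j, s j = ∑ i, s i * (C0 * p i.1 j.1) := by
    intro s j
    rw [Finset.sum_eq_single j]
    · rw [(hA j.1 j.2).2.2.2.1]; field_simp
    · intro i _ hne
      rw [(hA i.1 i.2).2.2.2.2.1 j.1 j.2 (fun h => hne (Subtype.ext h.symm))]; ring
    · simp
  have hcardA : ((Finset.univ : Finset {κ // κ ∈ A}).card : ℝ) = a := by
    rw [Finset.card_univ, Fintype.card_coe, ha]
  have hNI := NI T (fun s => by
    calc ∑ j, |T s j - s j| ≤ ∑ j : {κ // κ ∈ A}, C0 * ε * ∑ i, |s i| := by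
          refine Finset.sum_le_sum fun j _ => ?_
          rw [hT, hTs s j, ← Finset.sum_sub_distrib, Finset.mul_sum]
          refine (Finset.abs_sum_le_sum_abs _ _).trans (Finset.sum_le_sum fun i _ => ?_)
          rw [← mul_sub, ← mul_sub, abs_mul, abs_mul, abs_of_pos hC00, mul_comm]
          exact mul_le_mul_of_nonneg_right (mul_le_mul_of_nonneg_left (hdp _ i.2 _) hC00.le) (abs_nonneg _)
      _ ≤ (1 / 2) * ∑ i, |s i| := by
          rw [Finset.sum_const, nsmul_eq_mul, ← mul_assoc, hcardA]
          refine mul_le_mul_of_nonneg_right ?_ (Finset.sum_nonneg fun _ _ => abs_nonneg _)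
          have h1 : a * (C0 * ε) ≤ D ^ 2 * (C0 * ε) := by
            refine mul_le_mul_of_nonneg_right ?_ (by positivity)
            nlinarith
          linarith)
  let cmb : ({κ // κ ∈ A} → ℝ) → V m n := fun s => ∑ i, s i • (C0 • d i.1)
  have cmbT : ∀ s (j : {κ // κ ∈ A}), cmb s j.1 = T s j := by
    intro s j
    rw [hT]; simp [cmb]
  have cmbb : ∀ s b, |cmb s b| ≤ (∑ i, |s i|) * (2 * C0 ^ 2) := by
    intro s b
    simp only [cmb, Finset.sum_apply, Pi.smul_apply, smul_eq_mul]
    rw [Finset.sum_mul]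
    refine (Finset.abs_sum_le_sum_abs _ _).trans (Finset.sum_le_sum fun i _ => ?_)
    rw [abs_mul, abs_mul, abs_of_pos hC00]
    refine mul_le_mul_of_nonneg_left ?_ (abs_nonneg _)
    have := mul_le_mul_of_nonneg_left (hdb i.1 i.2 b) hC00.le
    linarith
  have cmbS : ∀ s, (∑ i, |s i|) * (C0 * D) ≤ 1 → Z + cmb s ∈ G C0 := by
    intro s hs
    have := (Sy.sum Finset.univ hG hZG (fun i : {κ // κ ∈ A} => w • d i.1) (fun i => s i * (C0 * (a + 1)))
      (fun i _ => hZS i.1 i.2) (by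
        simp only [abs_mul]
        rw [← Finset.sum_mul]
        refine le_trans (mul_le_mul_of_nonneg_left ?_ (Finset.sum_nonneg fun _ _ => abs_nonneg _)) hs
        rw [abs_of_pos hC00, abs_of_pos (by linarith)]
        exact mul_le_mul_of_nonneg_left haD hC00.le)).1
    convert this using 2
    refine Finset.sum_congr rfl fun i _ => ?_
    show s i • C0 • d i.1 = (s i * (C0 * (a + 1))) • w • d i.1
    have e : s i * (C0 * (a + 1)) * w = s i * C0 := by linear_combination (s i * C0) * hwa
    rw [← mul_smul (s i * (C0 * (a + 1))) w, e, mul_smul]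
  have cmb_add : ∀ s s', cmb (s + s') = cmb s + cmb s' := by
    intro s s'
    simp [cmb, add_smul, Finset.sum_add_distrib]
  have cmb_smul : ∀ (t : ℝ) s, cmb (t • s) = t • cmb s := by
    intro t s
    simp [cmb, Finset.smul_sum, mul_smul]
  obtain ⟨s, hs1, hs2⟩ := hNI (fun j => P0 j.1 - Z j.1)
  have hsb : ∑ i, |s i| ≤ 2 * (a * ε) := by
    refine hs2.trans (mul_le_mul_of_nonneg_left ?_ (by norm_num))
    rw [← hcardA, ← nsmul_eq_mul]
    refine Finset.sum_le_card_nsmul _ _ _ fun i _ => ?_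
    rw [abs_sub_comm]; exact hZP i.1
  have hsD : (∑ i, |s i|) * (C0 * D) ≤ 1 / 2 := by
    have h1 : (∑ i, |s i|) * (C0 * D) ≤ 2 * (D * ε) * (C0 * D) := by
      refine mul_le_mul_of_nonneg_right (hsb.trans ?_) (by positivity)
      have : a * ε ≤ D * ε := mul_le_mul_of_nonneg_right (by linarith) hε0.le
      linarith
    linarith
  have hs0 : 0 ≤ ∑ i, |s i| := Finset.sum_nonneg fun _ _ => abs_nonneg _
  refine ⟨Z + cmb s, fun α hα => ?_, fun b => ?_, hG.mono _ _ _ hC1 (cmbS s (by linarith)), fun α hα => ?_⟩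
  · rw [Pi.add_apply, cmbT s ⟨α, hα⟩, hs1]; ring
  · rw [Pi.add_apply]
    have h1 := hZP b
    have h2 := cmbb s b
    have h3 : |Z b + cmb s b - P0 b| ≤ |Z b - P0 b| + |cmb s b| := by
      rw [show Z b + cmb s b - P0 b = (Z b - P0 b) + cmb s b by ring]; exact abs_add_le _ _
    have h4 : (∑ i, |s i|) * (2 * C0 ^ 2) ≤ C0 := by
      have e : (∑ i, |s i|) * (2 * C0 ^ 2) = 2 * C0 * ((∑ i, |s i|) * C0) := by ring
      have : (∑ i, |s i|) * C0 ≤ (∑ i, |s i|) * (C0 * D) := mul_le_mul_of_nonneg_left (by nlinarith) hs0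
      rw [e]; nlinarith
    have h5 : 4 * C0 ^ 2 * 1 ≤ 4 * C0 ^ 2 * D := mul_le_mul_of_nonneg_left hD1 (by positivity)
    rw [hC1d]; linarith
  · obtain ⟨r, hr1, hr2⟩ := hNI (Pi.single ⟨α, hα⟩ 1)
    have hv : ∑ i, |(Pi.single ⟨α, hα⟩ 1 : {κ // κ ∈ A} → ℝ) i| = 1 := by
      rw [Finset.sum_eq_single ⟨α, hα⟩]
      · simp
      · intro i _ hi; simp [hi]
      · simp
    rw [hv, mul_one] at hr2
    have hr0 : 0 ≤ ∑ i, |r i| := Finset.sum_nonneg fun _ _ => abs_nonneg _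
    have key : ∀ t : ℝ, |t| ≤ 1 / C1 → Z + cmb s + t • cmb r ∈ G C1 := by
      intro t ht
      refine hG.mono _ _ _ hC1 ?_
      rw [← cmb_smul, add_assoc, ← cmb_add]
      refine cmbS _ ?_
      have h1 : ∑ i, |(s + t • r) i| ≤ ∑ i, |s i| + |t| * ∑ i, |r i| := by
        rw [Finset.mul_sum, ← Finset.sum_add_distrib]
        refine Finset.sum_le_sum fun i _ => (abs_add_le _ _).trans (le_of_eq ?_)
        rw [Pi.smul_apply, smul_eq_mul, abs_mul]
      have h2 : |t| * ∑ i, |r i| ≤ 1 / C1 * 2 := mul_le_mul ht hr2 hr0 (by positivity)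
      have h3 : 1 / C1 * 2 * (C0 * D) ≤ 1 / 2 := by
        rw [hC1d, show 1 / (4 * C0 ^ 2 * D) * 2 * (C0 * D) = 1 / 2 * (1 / C0) by field_simp; norm_num]
        have : 1 / C0 ≤ 1 := by rw [div_le_one hC00]; exact hC
        linarith
      calc _ ≤ (∑ i, |s i| + 1 / C1 * 2) * (C0 * D) :=
            mul_le_mul_of_nonneg_right (by linarith) (by positivity)
        _ ≤ 1 := by rw [add_mul]; linarith
    refine ⟨(1 / C1) • cmb r, ⟨key _ (by rw [abs_of_pos (by positivity)]), ?_⟩, ?_, fun α' h1 h2 => ?_, fun b _ => ?_⟩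
    · rw [sub_eq_add_neg, ← neg_smul]
      exact key _ (by rw [abs_neg, abs_of_pos (by positivity)])
    · rw [Pi.smul_apply, smul_eq_mul, cmbT r ⟨α, hα⟩, hr1]; simp
    · rw [Pi.smul_apply, smul_eq_mul, cmbT r ⟨α', h1⟩, hr1, Pi.single_apply, if_neg, mul_zero]
      exact fun h => h2 (congrArg Subtype.val h)
    · rw [Pi.smul_apply, smul_eq_mul, abs_mul, abs_of_pos (show 0 < 1 / C1 by positivity)]
      have h1 := cmbb r b
      have h2 : (∑ i, |r i|) * (2 * C0 ^ 2) ≤ 2 * (2 * C0 ^ 2) := mul_le_mul_of_nonneg_right hr2 (by positivity)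
      have h3 : 1 / C1 ≤ 1 := by rw [div_le_one hC10]; linarith
      have h5 : 4 * C0 ^ 2 * 1 ≤ C1 := mul_le_mul_of_nonneg_left hD1 (by positivity)
      calc _ ≤ 1 * C1 := mul_le_mul h3 (by linarith) (abs_nonneg _) zero_le_one
        _ = C1 := one_mul _

end FP


namespace FP
variable {m n : ℕ}

/-- weak basis for the family of local jets -/
def WB (E : Set (Euc n)) (f : Euc n → ℝ) (k : ℕ) (x : Euc n) (δ : ℝ) (A : Finset (Ix m n)) (P : V m n)
    (C : ℝ) : Prop := AWB (GN E f k x δ) A (nrm x δ P) C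

section
variable {E E' : Set (Euc n)} {f : Euc n → ℝ} {k k' : ℕ} {x y z : Euc n} {C C' δ δ' : ℝ}
  {A : Finset (Ix m n)} {P : V m n}

lemma GN_add (hδ : 0 < δ) (p : V m n) : nrm x δ P + p ∈ GN E f k x δ C ↔ P + un x δ p ∈ Gam E f k x C := by
  show un x δ (nrm x δ P + p) ∈ Gam E f k x C ↔ _
  rw [un_add, un_nrm hδ]

lemma GN_sub (hδ : 0 < δ) (p : V m n) : nrm x δ P - p ∈ GN E f k x δ C ↔ P - un x δ p ∈ Gam E f k x C := by
  show un x δ (nrm x δ P - p) ∈ Gam E f k x C ↔ _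
  rw [un_sub, un_nrm hδ]

lemma GN_nrm (hδ : 0 < δ) : nrm x δ P ∈ GN E f k x δ C ↔ P ∈ Gam E f k x C := by
  show un x δ (nrm x δ P) ∈ Gam E f k x C ↔ _
  rw [un_nrm hδ]

lemma WB.mem (hδ : 0 < δ) (h : WB E f k x δ A P C) : P ∈ Gam E f k x C := (GN_nrm hδ).1 h.1

lemma WB.mono (hm : 0 < m) (hδ : 0 < δ) (h : WB E f k x δ A P C) (hE : E' ⊆ E) (hk : k' ≤ k) (hC : 0 < C)
    (hCC : C ≤ C') : WB E' f k' x δ A P C' := by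
  obtain ⟨Cm, hCm, hAG⟩ := exists_AG (m := m) (n := n) hm
  refine AWB.mono (hAG E' f k' x δ hδ) hC ?_ hCC
  refine ⟨Gam.mono h.1 hE hk le_rfl, fun α hα => ?_⟩
  obtain ⟨p, h1, h2⟩ := h.2 α hα
  exact ⟨p, ⟨Gam.mono h1.1 hE hk le_rfl, Gam.mono h1.2 hE hk le_rfl⟩, h2⟩

lemma WB.scale (hm : 0 < m) (hδ' : 0 < δ') (hδδ : δ' ≤ δ) (h : WB E f k x δ A P C) :
    WB E f k x δ' A P C := by
  obtain ⟨Cm, hCm, hAG⟩ := exists_AG (m := m) (n := n) hm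
  have hδ : 0 < δ := hδ'.trans_le hδδ
  have hG := hAG E f k x δ' hδ'
  refine ⟨(GN_nrm hδ').2 (h.mem hδ), fun α hα => ?_⟩
  obtain ⟨p, h1, h2, h3, h4⟩ := h.2 α hα
  have hr : δ' / δ ≤ 1 := (div_le_one hδ).2 hδδ
  have hr0 : 0 < δ' / δ := by positivity
  have hval : ∀ β : Ix m n, ((δ' / δ) ^ (m - deg α.1) • nrm x δ' (un x δ p)) β
      = (δ' / δ) ^ (m - deg α.1) / (δ' / δ) ^ (m - deg β.1) * p β := by
    intro β
    rw [Pi.smul_apply, smul_eq_mul]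
    unfold nrm
    rw [sh_un, div_pow δ' δ (m - deg β.1)]
    field_simp
  refine ⟨(δ' / δ) ^ (m - deg α.1) • nrm x δ' (un x δ p), Sy.smul hG ⟨?_, ?_⟩ ?_, ?_, ?_, ?_⟩
  · rw [GN_add hδ', un_nrm hδ', ← GN_add hδ]; exact h1.1
  · rw [GN_sub hδ', un_nrm hδ', ← GN_sub hδ]; exact h1.2
  · rw [abs_of_pos (by positivity)]; exact pow_le_one₀ hr0.le hr
  · rw [hval, div_self (by positivity), one_mul, h2]
  · intro α' ha hne
    rw [hval, h3 α' ha hne, mul_zero]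
  · intro β hβ
    rw [hval, abs_mul, abs_of_pos (by positivity)]
    have : (δ' / δ) ^ (m - deg α.1) / (δ' / δ) ^ (m - deg β.1) ≤ 1 :=
      (div_le_one (by positivity)).2 (pow_le_pow_of_le_one hr0.le hr (by omega))
    calc _ ≤ 1 * |p β| := mul_le_mul_of_nonneg_right this (abs_nonneg _)
      _ ≤ C := by rw [one_mul]; exact h4 β hβ

lemma vanish (hA : Mon A) {p : V m n} (h : ∀ α ∈ A, sh x p α = 0) : ∀ α ∈ A, sh y p α = 0 := by
  intro α hα
  rw [co_change x y, sh_apply]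
  refine Finset.sum_eq_zero fun β _ => ?_
  by_cases hab : α.1 ≤ β.1
  · have hβ : β ∈ A := by
      refine hA α hα ⟨β.1 - α.1, lt_of_le_of_lt (deg_mono tsub_le_self) β.2⟩ β ?_
      exact tsub_add_cancel_of_le hab
    rw [h β hβ, mul_zero]
  · rw [bc_eq_zero _ hab, zero_mul]

lemma recen (hδ : 0 < δ) (hxy : ‖x - y‖ ≤ δ) (p : V m n) : nm δ (sh y p) ≤ Csh m n * nm δ (sh x p) := by
  rw [co_change x y]
  exact nm_sh_le hδ (by rwa [norm_sub_rev y x]) _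

lemma shift_err (hδ : 0 < δ) {ε R : ℝ} (hε : ε ≤ 1) (hxz : ‖z - x‖ ≤ ε * δ) {p : V m n} (hp : ∀ b, |p b| ≤ R)
    (b : Ix m n) : |nrm z δ (un x δ p) b - p b| ≤ 2 ^ m * ε * (DD m n * R) := by
  have h1 := sh_sub_le hδ hε hxz (sh x (un x δ p)) b
  rw [← co_change, sh_un] at h1
  have h2 : nm δ (sh x (un x δ p)) ≤ DD m n * R := nm_le_nrm hδ _ (by rw [nrm_un hδ]; exact hp)
  have hε0 : 0 ≤ ε := by
    by_contra hh
    have : ε * δ < 0 := mul_neg_of_neg_of_pos (by linarith) hδ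
    linarith [norm_nonneg (z - x)]
  have h3 : 0 < δ ^ (m - deg b.1) := by positivity
  have e : nrm z δ (un x δ p) b - p b = (sh z (un x δ p) b - p b * δ ^ (m - deg b.1)) / δ ^ (m - deg b.1) := by
    unfold nrm; field_simp
  rw [e, abs_div, abs_of_pos h3, div_le_iff₀ h3]
  refine h1.trans ?_
  gcongr
end

lemma transport (hm : 0 < m) {C : ℝ} (hC : 1 ≤ C) : ∃ C1 ε : ℝ, C ≤ C1 ∧ 0 < ε ∧ ε ≤ 1 ∧
    ∀ (E : Set (Euc n)) (f : Euc n → ℝ) (k k' : ℕ) (x z : Euc n) (δ : ℝ) (A : Finset (Ix m n)) (P : V m n),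
    E.Finite → hN m n * k ≤ k' → 0 < δ → ‖z - x‖ ≤ ε * δ → AWS (GN E f k' x δ) A (nrm x δ P) C →
    ∃ P', (∀ α ∈ A, sh z (P' - P) α = 0) ∧ nm δ (sh z (P' - P)) ≤ C1 ∧ WB E f k z δ A P' C1 := by
  obtain ⟨Cm, hCm, hAG⟩ := exists_AG (m := m) (n := n) hm
  obtain ⟨C1, ε0, hC1, hε0, hε01, hTR⟩ := TR (m := m) (n := n) (Cm := Cm) hC
  have hDD := DD_nonneg (m := m) (n := n)
  have hCsh := one_le_Csh (m := m) (n := n)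
  have hCL := one_le_CL (m := m) (n := n)
  have hC1' : 1 ≤ C1 := hC.trans hC1
  have hC0 : 0 < C := by linarith
  obtain ⟨K, hK⟩ : ∃ K, K = Csh m n * CL m n * C + 2 ^ m * (DD m n * C) + 1 := ⟨_, rfl⟩
  have hcc : 0 ≤ Csh m n * CL m n * C := by positivity
  have hdd : 0 ≤ 2 ^ m * (DD m n * C) := by positivity
  have hK1 : 1 ≤ K := by linarith
  have hεle : ε0 / K ≤ ε0 := div_le_self hε0.le hK1
  have hεp : 0 < ε0 / K := by positivity
  have hεK : ε0 / K * K = ε0 := by field_simp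
  refine ⟨C1 * (DD m n + 1), ε0 / K, by nlinarith, hεp, by linarith, ?_⟩
  intro E f k k' x z δ A P hE hk hδ hxz hS
  obtain ⟨ε, hε⟩ : ∃ ε, ε = ε0 / K := ⟨_, rfl⟩
  rw [← hε] at hxz hεp hεK hεle
  have hε1 : ε ≤ 1 := by linarith
  have hG := hAG E f k z δ hδ
  have hεδ : ε * δ ≤ δ := by nlinarith
  have hxz' : ‖x - z‖ ≤ ε * δ := by rwa [norm_sub_rev x z]
  have hKK : ε * (Csh m n * CL m n * C) + ε * (2 ^ m * (DD m n * C)) ≤ ε0 := by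
    rw [← hεK, hK]; nlinarith
  have step : ∀ Q ∈ Gam E f k' x C, ∃ Y ∈ GN (m := m) E f k z δ C,
      ∀ b, |Y b - nrm z δ Q b| ≤ ε * (Csh m n * CL m n * C) := by
    intro Q hQ
    obtain ⟨p', hp', hd⟩ := pair hm hE hk hQ z
    refine ⟨nrm z δ p', (GN_nrm hδ).2 hp', fun b => ?_⟩
    have h1 := hd (ε * δ) (by positivity) hxz'
    have h2 : nm δ (sh x (Q - p')) ≤ ε * (CL m n * C) := by
      refine (nm_mono (by positivity : 0 < ε * δ) hεδ _).trans ?_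
      rw [mul_div_assoc, div_self hδ.ne', mul_one]
      gcongr
    have h3 := recen hδ (hxz'.trans hεδ) (Q - p')
    have h4 := nrm_le (x := z) hδ (Q - p') b
    rw [nrm_sub, Pi.sub_apply, abs_sub_comm] at h4
    calc _ ≤ _ := h4
      _ ≤ _ := h3
      _ ≤ Csh m n * (ε * (CL m n * C)) := by gcongr
      _ = _ := by ring
  obtain ⟨Y0, hY0, hY0e⟩ := step P ((GN_nrm hδ).1 hS.1)
  obtain ⟨p, hp⟩ := pick hS.2
  have hpm : ∀ α ∈ A, ∃ Yp : V m n, Yp ∈ GN E f k z δ C ∧ ∀ b, |Yp b - (nrm z δ P + p α) b| ≤ ε0 := by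
    intro α hα
    obtain ⟨h1, h2, h3, h4⟩ := hp α hα
    obtain ⟨Y, hY, hYe⟩ := step _ ((GN_add hδ _).1 h1.1)
    refine ⟨Y, hY, fun b => ?_⟩
    have h5 := hYe b
    have h6 := shift_err hδ hε1 hxz h4 b
    rw [nrm_add, Pi.add_apply] at h5
    rw [Pi.add_apply]
    have h7 := abs_add_le (Y b - (nrm z δ P b + nrm z δ (un x δ (p α)) b)) (nrm z δ (un x δ (p α)) b - p α b)
    rw [show Y b - (nrm z δ P b + nrm z δ (un x δ (p α)) b) + (nrm z δ (un x δ (p α)) b - p α b)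
      = Y b - (nrm z δ P b + p α b) by ring] at h7
    linarith
  have hmm : ∀ α ∈ A, ∃ Yp : V m n, Yp ∈ GN E f k z δ C ∧ ∀ b, |Yp b - (nrm z δ P - p α) b| ≤ ε0 := by
    intro α hα
    obtain ⟨h1, h2, h3, h4⟩ := hp α hα
    obtain ⟨Y, hY, hYe⟩ := step _ ((GN_sub hδ _).1 h1.2)
    refine ⟨Y, hY, fun b => ?_⟩
    have h5 := hYe b
    have h6 := shift_err hδ hε1 hxz h4 b
    rw [nrm_sub, Pi.sub_apply] at h5
    rw [Pi.sub_apply]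
    have h7 := abs_sub (Y b - (nrm z δ P b - nrm z δ (un x δ (p α)) b)) (nrm z δ (un x δ (p α)) b - p α b)
    rw [show Y b - (nrm z δ P b - nrm z δ (un x δ (p α)) b) - (nrm z δ (un x δ (p α)) b - p α b)
      = Y b - (nrm z δ P b - p α b) by ring] at h7
    linarith
  obtain ⟨Yp, hYp⟩ := pick hpm
  obtain ⟨Ym, hYm⟩ := pick hmm
  obtain ⟨P', hP1, hP2, hP3⟩ := hTR (GN E f k z δ) hG A (nrm z δ P) Y0 p Yp Ym hY0
    (fun b => (hY0e b).trans (by nlinarith)) (fun α hα => by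
      obtain ⟨h1, h2, h3, h4⟩ := hp α hα
      exact ⟨(hYp α hα).1, (hYm α hα).1, h4, h2, h3, (hYp α hα).2, (hYm α hα).2⟩)
  refine ⟨un z δ P', fun α hα => ?_, ?_, ?_⟩
  · have h1 := hP1 α hα
    rw [map_sub, Pi.sub_apply, sh_un, h1]
    unfold nrm; field_simp; ring
  · refine (nm_le_nrm hδ _ (R := C1) fun b => ?_).trans (by nlinarith)
    rw [nrm_sub, nrm_un hδ]; exact hP2 b
  · have h1 : WB E f k z δ A (un z δ P') C1 := by
      unfold WB; rw [nrm_un hδ]; exact hP3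
    exact h1.mono hm hδ subset_rfl le_rfl (by linarith) (by nlinarith)

lemma NDw (hm : 0 < m) {C : ℝ} (hC : 1 ≤ C) : ∃ C3 η : ℝ, 1 ≤ C3 ∧ 0 < η ∧
    ∀ (E : Set (Euc n)) (f : Euc n → ℝ) (k : ℕ) (z : Euc n) (δ : ℝ) (A : Finset (Ix m n)) (P0 Y : V m n),
    0 < δ → WB E f k z δ A P0 C → Y ∈ Gam E f k z C → 1 ≤ nm δ (sh z (Y - P0)) →
    (∀ α ∈ A, |sh z (Y - P0) α| ≤ η * δ ^ (m - deg α.1)) →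
    ∃ A'' P, Mon A'' ∧ LL A A'' ∧ (∀ α ∈ A, sh z (P - P0) α = 0) ∧ nm δ (sh z (P - P0)) ≤ DD m n ∧
      WB E f k z δ A'' P C3 := by
  obtain ⟨Cm, hCm, hAG⟩ := exists_AG (m := m) (n := n) hm
  have hDD := DD_nonneg (m := m) (n := n)
  obtain ⟨C3, η, hC3, hη, hND⟩ := ND (n := n) hm hCm hC (D := DD m n + 1) (by linarith)
  refine ⟨C3, η, hC3, hη, fun E f k z δ A P0 Y hδ hW hY hN hA => ?_⟩
  obtain ⟨N, hNe⟩ : ∃ N, N = nm δ (sh z (Y - P0)) := ⟨_, rfl⟩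
  rw [← hNe] at hN
  have hN0 : 0 < N := by linarith
  have hN1 : 1 / N ≤ 1 := (div_le_one hN0).2 hN
  have hN2 : 0 ≤ 1 / N := by positivity
  have hval : ∀ b, nrm z δ (P0 + (1 / N) • (Y - P0)) b - nrm z δ P0 b = 1 / N * nrm z δ (Y - P0) b := by
    intro b
    rw [nrm_add, nrm_smul]; simp
  have g1 : nrm z δ (P0 + (1 / N) • (Y - P0)) ∈ GN E f k z δ C := by
    rw [GN_nrm hδ]
    have := Gam.convex (hW.mem hδ) hY (a := 1 - 1 / N) (b := 1 / N) (by linarith) hN2 (by ring)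
    convert this using 1
    module
  have g2 : ∀ b, |nrm z δ (P0 + (1 / N) • (Y - P0)) b - nrm z δ P0 b| ≤ 1 := by
    intro b
    rw [hval, abs_mul, abs_of_nonneg hN2]
    have := nrm_le (x := z) hδ (Y - P0) b
    rw [← hNe] at this
    calc _ ≤ 1 / N * N := by gcongr
      _ = 1 := by field_simp
  have g3 : ∃ b, 1 / (DD m n + 1) ≤ |nrm z δ (P0 + (1 / N) • (Y - P0)) b - nrm z δ P0 b| := by
    by_contra! hcon
    have : nm δ (sh z (Y - P0)) ≤ DD m n * (N / (DD m n + 1)) := by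
      refine nm_le_nrm hδ _ fun b => ?_
      have h := hcon b
      rw [hval, abs_mul, abs_of_nonneg hN2, div_mul_eq_mul_div, one_mul, div_lt_div_iff₀ hN0 (by linarith)] at h
      rw [le_div_iff₀ (by linarith)]; linarith
    rw [← hNe] at this
    have h2 : DD m n * (N / (DD m n + 1)) * (DD m n + 1) = DD m n * N := by field_simp
    nlinarith
  have g4 : ∀ α ∈ A, |nrm z δ (P0 + (1 / N) • (Y - P0)) α - nrm z δ P0 α| ≤ η := by
    intro α hα
    rw [hval, abs_mul, abs_of_nonneg hN2]
    have h := hA α hα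
    have h3 : |nrm z δ (Y - P0) α| ≤ η := by
      unfold nrm
      rw [abs_div, abs_of_pos (show 0 < δ ^ (m - deg α.1) by positivity), div_le_iff₀ (by positivity)]
      exact h
    calc _ ≤ 1 * η := by gcongr
      _ = η := one_mul _
  obtain ⟨A'', P, h1, h2, h3, h4, h5⟩ := hND (GN E f k z δ) (hAG E f k z δ hδ) A (nrm z δ P0)
    (nrm z δ (P0 + (1 / N) • (Y - P0))) hW g1 g2 g3 g4
  · refine ⟨A'', un z δ P, h1, h2, fun α hα => ?_, ?_, ?_⟩
    · rw [map_sub, Pi.sub_apply, sh_un, h3 α hα]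
      unfold nrm; field_simp; ring
    · refine (nm_le_nrm hδ _ (R := 1) fun b => ?_).trans (by linarith)
      rw [nrm_sub, nrm_un hδ]; exact h4 b
    · unfold WB; rw [nrm_un hδ]; exact h5

lemma recenter (hm : 0 < m) {C : ℝ} (hC : 1 ≤ C) : ∃ C3 : ℝ, C ≤ C3 ∧
    ∀ (E : Set (Euc n)) (f : Euc n → ℝ) (k : ℕ) (z : Euc n) (δ : ℝ) (A A' : Finset (Ix m n)) (Pz P : V m n),
    0 < δ → WB E f k z δ A Pz C → WB E f k z δ A' P C → Mon A' → LL A A' →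
    (∀ α ∈ A, sh z (P - Pz) α = 0) →
    ∃ A'' P', Mon A'' ∧ LL A A'' ∧ nm δ (sh z (P' - Pz)) ≤ DD m n + 1 ∧ WB E f k z δ A'' P' C3 := by
  obtain ⟨C3, η, hC3, hη, h⟩ := NDw (n := n) hm hC
  have hDD := DD_nonneg (m := m) (n := n)
  have hC0 : 0 < C := by linarith
  refine ⟨C + C3, by linarith, fun E f k z δ A A' Pz P hδ hW hW' hMon hLL hA => ?_⟩
  by_cases hN : nm δ (sh z (P - Pz)) ≤ 1
  · exact ⟨A', P, hMon, hLL, by linarith, hW'.mono hm hδ subset_rfl le_rfl hC0 (by linarith)⟩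
  · push Not at hN
    obtain ⟨A'', P', h1, h2, h3, h4, h5⟩ := h E f k z δ A Pz P hδ hW (hW'.mem hδ) hN.le (fun α hα => by
      rw [hA α hα, abs_zero]; positivity)
    exact ⟨A'', P', h1, h2, by linarith, h5.mono hm hδ subset_rfl le_rfl (by linarith) (by linarith)⟩

lemma sup_lemma {Δ : Set ℝ} {δ0 : ℝ} (h0 : ∀ t ∈ Δ, 0 < t ∧ t ≤ δ0) (hne : Δ.Nonempty)
    (hd : ∀ t ∈ Δ, ∀ s, 0 < s → s ≤ t → s ∈ Δ) :
    ∃ τ, 0 < τ ∧ τ ≤ δ0 ∧ (∀ t, 0 < t → t < τ → t ∈ Δ) ∧ ∀ t ∈ Δ, t ≤ τ := by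
  have hb : BddAbove Δ := ⟨δ0, fun t ht => (h0 t ht).2⟩
  obtain ⟨a, ha⟩ := hne
  refine ⟨sSup Δ, (h0 a ha).1.trans_le (le_csSup hb ha), csSup_le ⟨a, ha⟩ fun t ht => (h0 t ht).2,
    fun t ht hlt => ?_, fun t ht => le_csSup hb ht⟩
  obtain ⟨b, hb1, hb2⟩ := exists_lt_of_lt_csSup ⟨a, ha⟩ hlt
  exact hd b hb1 t ht hb2.le

end FP


namespace FP
variable {m n : ℕ}

/-- conclusion of the main lemma -/
def Ext (E : Set (Euc n)) (f : Euc n → ℝ) (x0 : Euc n) (δ0 : ℝ) (P0 : V m n) (C' : ℝ) : Prop :=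
  ∃ F : Euc n → ℝ, (∀ y, 0 ≤ F y) ∧ Good m F C' ∧ (∀ e ∈ E, F e = f e) ∧
    ∃ q, JetAt F x0 q C' ∧ nm δ0 (sh x0 (q - P0)) ≤ C'

lemma Ext.mono {E : Set (Euc n)} {f : Euc n → ℝ} {x0 : Euc n} {δ0 : ℝ} {P0 : V m n} {C C' : ℝ}
    (h : Ext E f x0 δ0 P0 C) (hC : C ≤ C') : Ext E f x0 δ0 P0 C' := by
  obtain ⟨F, h1, h2, h3, q, h4, h5⟩ := h
  exact ⟨F, h1, h2.mono hC, h3, q, h4.mono hC, h5.trans hC⟩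

/-- the main lemma for label `A`, constant `C` and given output constants -/
def MLC (A : Finset (Ix m n)) (C : ℝ) (k : ℕ) (ε C' : ℝ) : Prop :=
  ∀ (E : Set (Euc n)) (f : Euc n → ℝ) (x0 : Euc n) (δ0 : ℝ) (P0 : V m n), E.Finite → 0 < δ0 →
    (∀ e ∈ E, ‖e - x0‖ ≤ ε * δ0) → WB E f k x0 δ0 A P0 C → Ext E f x0 δ0 P0 C'

def ML (A : Finset (Ix m n)) : Prop :=
  ∀ C : ℝ, 1 ≤ C → ∃ (k : ℕ) (ε C' : ℝ), 0 < ε ∧ ε ≤ 1 ∧ 1 ≤ C' ∧ MLC A C k ε C'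

lemma ML_unif (hm : 0 < m) (A : Finset (Ix m n)) (h : ∀ B, LL A B → Mon B → ML B) {C : ℝ} (hC : 1 ≤ C) :
    ∃ (k : ℕ) (ε C' : ℝ), 0 < ε ∧ ε ≤ 1 ∧ 1 ≤ C' ∧ ∀ B, LL A B → Mon B → MLC B C k ε C' := by
  have h1 : ∀ B : Finset (Ix m n), ∃ (k : ℕ) (ε C' : ℝ), 0 < ε ∧ ε ≤ 1 ∧ 1 ≤ C' ∧
      (LL A B → Mon B → MLC B C k ε C') := by
    intro B
    by_cases hB : LL A B ∧ Mon B
    · obtain ⟨k, ε, C', h1, h2, h3, h4⟩ := h B hB.1 hB.2 C hC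
      exact ⟨k, ε, C', h1, h2, h3, fun _ _ => h4⟩
    · exact ⟨0, 1, 1, one_pos, le_rfl, le_rfl, fun h1 h2 => absurd ⟨h1, h2⟩ hB⟩
  choose k ε C' h2 h3 h4 h5 using h1
  obtain ⟨Bk, hBk⟩ := Finite.exists_max k
  obtain ⟨Be, hBe⟩ := Finite.exists_min ε
  obtain ⟨Bc, hBc⟩ := Finite.exists_max C'
  refine ⟨k Bk, ε Be, C' Bc, h2 _, h3 _, h4 _, fun B hB1 hB2 E f x0 δ0 P0 hE hδ hcl hW => ?_⟩
  refine (h5 B hB1 hB2 E f x0 δ0 P0 hE hδ (fun e he => (hcl e he).trans ?_) ?_).mono (hBc B)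
  · have := hBe B; gcongr
  · exact hW.mono hm hδ subset_rfl (hBk B) (by linarith) le_rfl

lemma isolate {E : Set (Euc n)} (hE : E.Finite) (z : Euc n) {δ0 : ℝ} (h0 : 0 < δ0) :
    ∃ δ, 0 < δ ∧ δ ≤ δ0 ∧ ∀ e ∈ E, ‖e - z‖ < δ → e = z := by
  have h1 : IsOpen (E \ {z})ᶜ := (hE.subset Set.sdiff_subset).isClosed.isOpen_compl
  obtain ⟨r, hr, hb⟩ := Metric.isOpen_iff.1 h1 z (by simp)
  refine ⟨min r δ0, lt_min hr h0, min_le_right _ _, fun e he hlt => ?_⟩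
  by_contra hne
  have : e ∈ Metric.ball z r := by
    rw [mem_ball_iff_norm]; exact hlt.trans_le (min_le_left _ _)
  exact hb this ⟨he, hne⟩

/-- compatibility of neighbouring polynomials -/
lemma compat_step (hm : 0 < m) {E : Set (Euc n)} {f : Euc n → ℝ} {k1 k2 : ℕ} {δ0 L s C1 C3 η : ℝ}
    {A : Finset (Ix m n)} {Py Pz : V m n} {y z : Euc n} (hE : E.Finite) (hk : hN m n * k2 ≤ k1) (hk' : k2 ≤ k1)
    (hC1 : 1 ≤ C1) (hL : 1 ≤ L) (hs : 0 < s) (hLs : L * s ≤ δ0) (hη : Csh m n * CL m n * C1 ≤ η * L)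
    (hND : ∀ (E : Set (Euc n)) (f : Euc n → ℝ) (k : ℕ) (z : Euc n) (δ : ℝ) (A : Finset (Ix m n)) (P0 Y : V m n),
      0 < δ → WB E f k z δ A P0 C1 → Y ∈ Gam E f k z C1 → 1 ≤ nm δ (sh z (Y - P0)) →
      (∀ α ∈ A, |sh z (Y - P0) α| ≤ η * δ ^ (m - deg α.1)) →
      ∃ A'' P, Mon A'' ∧ LL A A'' ∧ (∀ α ∈ A, sh z (P - P0) α = 0) ∧ nm δ (sh z (P - P0)) ≤ DD m n ∧
        WB E f k z δ A'' P C3)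
    (hWy : WB E f k1 y δ0 A Py C1) (hPz : Pz ∈ Gam E f k1 z C1) (hzy : ‖z - y‖ ≤ s)
    (hv : ∀ α ∈ A, sh y (Pz - Py) α = 0)
    (hno : ¬ ∃ A' Q, Mon A' ∧ LL A A' ∧ (∀ α ∈ A, sh y (Q - Py) α = 0) ∧ WB E f k2 y (L * s) A' Q C3) :
    nm s (sh y (Pz - Py)) ≤ Csh m n * CL m n * C1 + L ^ m := by
  obtain ⟨Y, hY, hYe⟩ := pair hm hE hk hPz y
  have hCsh := one_le_Csh (m := m) (n := n)
  have hLs0 : 0 < L * s := by positivity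
  have hsL : s ≤ L * s := by nlinarith
  have h1 : nm s (sh y (Pz - Y)) ≤ Csh m n * CL m n * C1 := by
    refine (recen hs hzy _).trans ?_
    rw [mul_assoc]
    exact mul_le_mul_of_nonneg_left (hYe s hs hzy) (by linarith)
  have h2 : nm (L * s) (sh y (Y - Py)) ≤ 1 := by
    by_contra! hN
    obtain ⟨A'', P, a1, a2, a3, a4, a5⟩ := hND E f k2 y (L * s) A Py Y hLs0
      ((hWy.scale hm hLs0 hLs).mono hm hLs0 subset_rfl hk' (by linarith) le_rfl) hY hN.le (fun α hα => by
        have e : sh y (Y - Py) α = - sh y (Pz - Y) α := by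
          have := hv α hα
          rw [map_sub, Pi.sub_apply] at this ⊢
          rw [map_sub, Pi.sub_apply]; linarith
        rw [e, abs_neg]
        refine (coef_le_nm hLs0 _ α).trans ?_
        gcongr
        refine (nm_mono hs hsL _).trans ?_
        rw [div_mul_eq_mul_div, div_le_iff₀ hLs0]
        nlinarith)
    exact hno ⟨A'', P, a1, a2, a3, a5⟩
  have h3 : nm s (sh y (Y - Py)) ≤ L ^ m := by
    refine (nm_anti hs hsL _).trans ?_
    rw [mul_div_assoc, div_self hs.ne', mul_one]
    exact mul_le_of_le_one_right (by positivity) h2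
  have h4 := nm_add hs (sh y (Pz - Y)) (sh y (Y - Py))
  rw [← map_add, sub_add_sub_cancel] at h4
  linarith

set_option maxHeartbeats 1000000 in
lemma main_step (hm : 0 < m) (hn : 0 < n) (A : Finset (Ix m n)) (hA : Mon A)
    (ih : ∀ B, LL A B → Mon B → ML B) : ML A := by
  intro C hC
  obtain ⟨Cm, hCm, hAG⟩ := exists_AG (m := m) (n := n) hm
  obtain ⟨K1, hK1, hL1⟩ := L1 (n := n) hm hCm hC
  obtain ⟨C1, ε1, hC1, hε1, hε11, htr⟩ := transport (n := n) hm hC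
  have hC1' : 1 ≤ C1 := hC.trans hC1
  obtain ⟨C3a, η, hC3a, hη, hND⟩ := NDw (n := n) hm hC1'
  have hC2 : 1 ≤ max C1 C3a := le_max_of_le_left hC1'
  obtain ⟨C2, hC2e⟩ : ∃ C2, C2 = max C1 C3a := ⟨_, rfl⟩
  rw [← hC2e] at hC2
  have hC12 : C1 ≤ C2 := hC2e ▸ le_max_left _ _
  have hC32 : C3a ≤ C2 := hC2e ▸ le_max_right _ _
  obtain ⟨C3, hC3, hrec⟩ := recenter (n := n) hm hC2
  have hCI : 1 ≤ max K1 C3 := le_max_of_le_left hK1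
  obtain ⟨k2', ε', C', hε', hε'1, hC', hIH⟩ := ML_unif hm A ih hCI
  have hCsh := one_le_Csh (m := m) (n := n)
  have hCL := one_le_CL (m := m) (n := n)
  have hDD := DD_nonneg (m := m) (n := n)
  obtain ⟨B1, hB1⟩ : ∃ B1, B1 = Csh m n * CL m n * C1 := ⟨_, rfl⟩
  have hB10 : 0 ≤ B1 := by rw [hB1]; positivity
  obtain ⟨L, hL⟩ : ∃ L, L = 2 + B1 / η := ⟨_, rfl⟩
  have hL2 : 2 ≤ L := by rw [hL]; have : 0 ≤ B1 / η := by positivity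
                         linarith
  have hηL : Csh m n * CL m n * C1 ≤ η * L := by
    rw [← hB1, hL, mul_add, mul_div_cancel₀ _ hη.ne']; linarith
  obtain ⟨L', hL'⟩ : ∃ L', L' = 2 / ε' + 1 := ⟨_, rfl⟩
  have hL'1 : 1 ≤ L' := by rw [hL']; have : 0 ≤ 2 / ε' := by positivity
                           linarith
  obtain ⟨Cg, hCg, hGT⟩ := GT (m := m) (n := n) hm hn L' hL'1
  obtain ⟨M, hM⟩ : ∃ M, M = C1 + C' + (2 / ε') ^ m * (C' + DD m n + 1) + (B1 + L ^ m * ((Csh m n + 1) * C1 + 1)) := ⟨_, rfl⟩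
  have hMa : 0 ≤ (2 / ε') ^ m * (C' + DD m n + 1) := by positivity
  have hMb : 0 ≤ L ^ m * ((Csh m n + 1) * C1 + 1) := by positivity
  have hMb' : L ^ m ≤ L ^ m * ((Csh m n + 1) * C1 + 1) := by
    have : 0 ≤ (Csh m n + 1) * C1 := by positivity
    exact le_mul_of_one_le_right (by positivity) (by linarith)
  have hMb2 : L ^ m * ((Csh m n + 1) * C1) ≤ L ^ m * ((Csh m n + 1) * C1 + 1) := by gcongr; linarith
  have hM0 : 0 ≤ M := by linarith
  have hM1 : C1 ≤ M := by linarith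
  have hM2 : C' ≤ M := by linarith
  have hM3 : (2 / ε') ^ m * (C' + DD m n + 1) ≤ M := by linarith
  have hM4 : B1 + L ^ m * ((Csh m n + 1) * C1 + 1) ≤ M := by linarith
  have hCgM : 0 ≤ Cg * M := by positivity
  have hCsC : 0 ≤ Csh m n * C1 := by positivity
  have h2m : (1:ℝ) ≤ 2 ^ m := one_le_pow₀ (by norm_num)
  have h2mM : Cg * M ≤ 2 ^ m * (Cg * M) := le_mul_of_one_le_left hCgM h2m
  have hhN : 1 ≤ hN m n := by unfold hN; omega
  obtain ⟨k2, hk2⟩ : ∃ k2, k2 = k2' + 1 := ⟨_, rfl⟩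
  have hk21 : k2 ≤ hN m n * k2 := Nat.le_mul_of_pos_left _ hhN
  have hk1k : hN m n * k2 ≤ hN m n * (hN m n * k2) := Nat.le_mul_of_pos_left _ hhN
  have hk1' : hN m n * k2 ≤ (k2' + 1) * 0 + hN m n * k2 := by omega
  refine ⟨hN m n * (hN m n * k2), min (min ε1 ε') (1 / 2), C + C' + 2 ^ m * (Cg * M) + Csh m n * C1,
    by positivity, (min_le_right _ _).trans (by norm_num), by linarith, ?_⟩
  intro E f x0 δ0 P0 hE hδ0 hcl hW
  have hcl1 : ∀ e ∈ E, ‖e - x0‖ ≤ ε1 * δ0 := fun e he => (hcl e he).trans (by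
    have : min (min ε1 ε') (1 / 2) ≤ ε1 := (min_le_left _ _).trans (min_le_left _ _)
    gcongr)
  have hcl2 : ∀ e ∈ E, ‖e - x0‖ ≤ ε' * δ0 := fun e he => (hcl e he).trans (by
    have : min (min ε1 ε') (1 / 2) ≤ ε' := (min_le_left _ _).trans (min_le_right _ _)
    gcongr)
  have hcl3 : ∀ e ∈ E, ‖e - x0‖ ≤ 1 / 2 * δ0 := fun e he => (hcl e he).trans (by
    have : min (min ε1 ε') (1 / 2) ≤ (1 / 2 : ℝ) := min_le_right _ _
    gcongr)
  rcases E.eq_empty_or_nonempty with hEe | ⟨e0, he0⟩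
  · obtain ⟨F, h1, h2, -, h3⟩ := hW.mem hδ0 ∅ (by simp) (by simp)
    have : C ≤ C + C' + 2 ^ m * (Cg * M) + Csh m n * C1 := by linarith
    refine ⟨F, h1, h2.mono this, by simp [hEe], P0, h3.mono this, ?_⟩
    rw [sub_self, map_zero, nm_zero]; linarith
  rcases hL1 _ (hAG E f (hN m n * (hN m n * k2)) x0 δ0 hδ0) A _ hW with hS | ⟨A'', hA1, hA2, hA3⟩
  swap
  · have hW' : WB E f (hN m n * (hN m n * k2)) x0 δ0 A'' P0 K1 := hA3
    exact (hIH A'' hA2 hA1 E f x0 δ0 P0 hE hδ0 hcl2 (hW'.mono hm hδ0 subset_rfl (by omega) (by linarith)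
      (le_max_left _ _))).mono (by linarith)
  -- the main case
  have hex : ∀ z, ∃ P', z ∈ E → (∀ α ∈ A, sh z (P' - P0) α = 0) ∧ nm δ0 (sh z (P' - P0)) ≤ C1 ∧
      WB E f (hN m n * k2) z δ0 A P' C1 := by
    intro z
    by_cases hz : z ∈ E
    · obtain ⟨P', h⟩ := htr E f (hN m n * k2) _ x0 z δ0 A P0 hE le_rfl hδ0 (hcl1 z hz) hS
      exact ⟨P', fun _ => h⟩
    · exact ⟨0, fun h => absurd h hz⟩
  choose P hP using hex
  obtain ⟨OK, hOK⟩ : ∃ OK : Euc n → ℝ → Prop, ∀ z δ, OK z δ ↔ ∃ A' Q, Mon A' ∧ LL A A' ∧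
      (∀ α ∈ A, sh z (Q - P z) α = 0) ∧ WB E f k2 z δ A' Q C2 := ⟨_, fun _ _ => Iff.rfl⟩
  have hex2 : ∀ z, ∃ τ, 0 < τ ∧ τ ≤ δ0 ∧
      (∀ t, 0 < t → t < τ → (0 < t ∧ t ≤ δ0) ∧ (OK z t ∨ ∀ e ∈ E, ‖e - z‖ < t → e = z)) ∧
      ∀ t, ((0 < t ∧ t ≤ δ0) ∧ (OK z t ∨ ∀ e ∈ E, ‖e - z‖ < t → e = z)) → t ≤ τ := by
    intro z
    refine sup_lemma (Δ := {t | (0 < t ∧ t ≤ δ0) ∧ (OK z t ∨ ∀ e ∈ E, ‖e - z‖ < t → e = z)}) (δ0 := δ0)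
      (fun t ht => ht.1) ?_ ?_
    · obtain ⟨δ, h1, h2, h3⟩ := isolate hE z hδ0
      exact ⟨δ, ⟨h1, h2⟩, Or.inr h3⟩
    · rintro t ⟨⟨h1, h2⟩, h3⟩ s hs hst
      refine ⟨⟨hs, hst.trans h2⟩, ?_⟩
      rcases h3 with h3 | h3
      · left
        rw [hOK] at h3 ⊢
        obtain ⟨A', Q, a1, a2, a3, a4⟩ := h3
        exact ⟨A', Q, a1, a2, a3, a4.scale hm hs hst⟩
      · exact Or.inr fun e he hlt => h3 e he (hlt.trans_le hst)
  choose τ hτ0 hτδ hτ1 hτ2 using hex2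
  have hloc : ∀ z ∈ E, ∀ s > 0, ∃ G : Euc n → ℝ, (∀ y, 0 ≤ G y) ∧ Good m G M ∧
      (∃ q, JetAt G z q M ∧ nm s (sh z (q - P z)) ≤ M) ∧
      (s * L' ≤ τ z → ∀ e ∈ E, ‖e - z‖ < 2 * s → G e = f e) := by
    intro z hz s hs
    obtain ⟨hz1, hz2, hz3⟩ := hP z hz
    have hPz := hz3.mem hδ0
    have hself : nm s (sh z (P z - P z)) ≤ M := by rw [sub_self, map_zero, nm_zero]; exact hM0
    by_cases hsτ : s * L' ≤ τ z
    swap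
    · obtain ⟨F, h1, h2, -, h3⟩ := hPz ∅ (by simp) (by simp)
      exact ⟨F, h1, h2.mono hM1, ⟨P z, h3.mono hM1, hself⟩, fun h => absurd h hsτ⟩
    obtain ⟨δ, hδe⟩ : ∃ δ, δ = 2 / ε' * s := ⟨_, rfl⟩
    have hδ : 0 < δ := by rw [hδe]; positivity
    have hδτ : δ < τ z := by
      refine lt_of_lt_of_le ?_ hsτ
      rw [hδe, hL']; linarith
    have hεδ : ε' * δ = 2 * s := by rw [hδe]; field_simp
    have h2s : 2 * s ≤ δ := by
      rw [← hεδ]; exact mul_le_of_le_one_left hδ.le hε'1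
    have hsδ : s ≤ δ := by linarith
    have hδδ0 : δ ≤ δ0 := hδτ.le.trans (hτδ z)
    rcases (hτ1 z δ hδ hδτ).2 with hok | hiso
    · rw [hOK] at hok
      obtain ⟨A', Q, a1, a2, a3, a4⟩ := hok
      obtain ⟨A'', P', b1, b2, b3, b4⟩ := hrec E f k2 z δ A A' (P z) Q hδ
        ((hz3.scale hm hδ hδδ0).mono hm hδ subset_rfl hk21 (by linarith) hC12) a4 a1 a2 a3
      obtain ⟨F, h1, h2, h3, q, h4, h5⟩ := hIH A'' b2 b1 (E ∩ {e | ‖e - z‖ ≤ 2 * s}) f z δ P'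
        (hE.subset Set.inter_subset_left) hδ (fun e he => by rw [hεδ]; exact he.2)
        (b4.mono hm hδ Set.inter_subset_left (by omega) (by linarith) (le_max_right _ _))
      refine ⟨F, h1, h2.mono hM2, ⟨q, h4.mono hM2, ?_⟩, fun _ e he hlt => h3 e ⟨he, hlt.le⟩⟩
      refine le_trans ?_ hM3
      refine (nm_anti hs hsδ _).trans ?_
      have e1 : δ / s = 2 / ε' := by rw [hδe]; field_simp
      rw [e1]
      refine mul_le_mul_of_nonneg_left ?_ (by positivity)
      have h6 := nm_add hδ (sh z (q - P')) (sh z (P' - P z))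
      rw [← map_add, sub_add_sub_cancel] at h6
      linarith
    · obtain ⟨F, h1, h2, h2', h3⟩ := hPz {z} (by simpa using hz) (by
        rw [Finset.card_singleton]; omega)
      refine ⟨F, h1, h2.mono hM1, ⟨P z, h3.mono hM1, hself⟩, fun _ e he hlt => ?_⟩
      rw [hiso e he (hlt.trans_le h2s)]
      exact h2' z (by simp)
  have hcomp : ∀ z ∈ E, ∀ y ∈ E, ∀ s > 0, ‖z - y‖ ≤ s → τ y ≤ s → nm s (sh y (P z - P y)) ≤ M := by
    intro z hz y hy s hs hzy hτs
    obtain ⟨hz1, hz2, hz3⟩ := hP z hz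
    obtain ⟨hy1, hy2, hy3⟩ := hP y hy
    refine le_trans ?_ hM4
    have hsL : s ≤ L * s := by nlinarith
    by_cases hLs : L * s ≤ δ0
    · have hv : ∀ α ∈ A, sh y (P z - P y) α = 0 := by
        intro α hα
        have e1 := vanish (x := z) (y := y) hA hz1 α hα
        have e2 := hy1 α hα
        rw [map_sub, Pi.sub_apply] at e1 e2 ⊢
        linarith
      have := compat_step hm hE le_rfl hk21 hC1' (by linarith) hs hLs hηL hND hy3 (hz3.mem hδ0) hzy hv (by
        rintro ⟨A', Q, a1, a2, a3, a4⟩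
        have hLs0 : 0 < L * s := by positivity
        have h1 : OK y (L * s) := (hOK _ _).2 ⟨A', Q, a1, a2, a3, a4.mono hm hLs0 subset_rfl le_rfl (by linarith) hC32⟩
        have h2 := hτ2 y (L * s) ⟨⟨hLs0, hLs⟩, Or.inl h1⟩
        nlinarith)
      rw [hB1]; linarith
    · push Not at hLs
      have hzyδ : ‖z - y‖ ≤ δ0 := by
        have h1 := norm_sub_le_norm_sub_add_norm_sub z x0 y
        have h2 := hcl3 z hz
        have h3 := hcl3 y hy
        rw [norm_sub_rev x0 y] at h1
        linarith
      have h1 : nm δ0 (sh y (P z - P0)) ≤ Csh m n * C1 :=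
        (recen hδ0 hzyδ _).trans (mul_le_mul_of_nonneg_left hz2 (by linarith))
      have h2 := nm_sub hδ0 (sh y (P z - P0)) (sh y (P y - P0))
      rw [← map_sub, sub_sub_sub_cancel_right] at h2
      have h3 := nm_anti hs hsL (sh y (P z - P y))
      rw [mul_div_assoc, div_self hs.ne', mul_one] at h3
      have h4 := nm_mono' hδ0 hLs.le (sh y (P z - P y))
      have h5 : nm (L * s) (sh y (P z - P y)) ≤ (Csh m n + 1) * C1 := by linarith
      have h6 : L ^ m * nm (L * s) (sh y (P z - P y)) ≤ L ^ m * ((Csh m n + 1) * C1) := by gcongr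
      linarith
  obtain ⟨F, h1, h2, h3, h4⟩ := hGT E f τ P M hM0 hE ⟨e0, he0⟩ (fun z _ => hτ0 z) hloc hcomp
  obtain ⟨q, hq⟩ := h2.jetAt x0
  have hle : Cg * M ≤ C + C' + 2 ^ m * (Cg * M) + Csh m n * C1 := by linarith
  refine ⟨F, h1, h2.mono hle, h3, q, hq.mono hle, ?_⟩
  have hd := hcl3 e0 he0
  have h5 := h4 x0 e0 he0 (2 * δ0) (by rw [norm_sub_rev x0 e0]; linarith [hτδ e0]) q hq
  have h6 := nm_anti hδ0 (by linarith : δ0 ≤ 2 * δ0) (sh x0 (q - P e0))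
  rw [mul_div_assoc, div_self hδ0.ne', mul_one] at h6
  have h7 : (2:ℝ) ^ m * nm (2 * δ0) (sh x0 (q - P e0)) ≤ 2 ^ m * (Cg * M) := by gcongr
  have h8 : nm δ0 (sh x0 (P e0 - P0)) ≤ Csh m n * C1 :=
    (recen hδ0 (by linarith) _).trans (mul_le_mul_of_nonneg_left (hP e0 he0).2.1 (by linarith))
  have h9 := nm_add hδ0 (sh x0 (q - P e0)) (sh x0 (P e0 - P0))
  rw [← map_add, sub_add_sub_cancel] at h9
  linarith

lemma main_lemma (hm : 0 < m) (hn : 0 < n) (A : Finset (Ix m n)) : Mon A → ML A := by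
  induction A using LL_wf.induction with
  | _ A ih => exact fun hA => main_step hm hn A hA fun B hB hMB => ih B hB hMB

end FP


namespace FP
variable {m n : ℕ}

lemma exists_coef (hm : 0 < m) (P : MPoly n) (hP : P.totalDegree ≤ m - 1) : ∃ p : V m n, peval P = pl p := by
  refine ⟨fun α => P.coeff (Finsupp.equivFunOnFinite.symm α.1), ?_⟩
  rw [← peval_toMv]
  congr 1
  ext s
  by_cases hs : deg (s : Fin n → ℕ) < m
  · have h := coeff_toMv (m := m) (fun α => P.coeff (Finsupp.equivFunOnFinite.symm α.1)) ⟨s, hs⟩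
    have e : Finsupp.equivFunOnFinite.symm (s : Fin n → ℕ) = s := Finsupp.equivFunOnFinite_symm_coe s
    simp only [e] at h
    exact h.symm
  · rw [MvPolynomial.coeff_eq_zero_of_totalDegree_lt]
    · rw [toMv, MvPolynomial.coeff_sum]
      symm
      refine Finset.sum_eq_zero fun α _ => ?_
      rw [MvPolynomial.coeff_monomial, if_neg]
      intro h
      apply hs
      rw [← h]
      exact α.2
    · have : ∑ i ∈ s.support, s i = deg (s : Fin n → ℕ) := by
        unfold deg
        exact Finset.sum_subset (Finset.subset_univ _) (by simp)
      rw [this]; omega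

lemma peval_sub (P Q : MPoly n) : peval (P - Q) = fun x => peval P x - peval Q x := by
  funext x; simp [peval]

lemma Good.scale {F : Euc n → ℝ} {M : ℝ} (h : Good m F M) {t : ℝ} (ht : 0 ≤ t) : Good m (fun y => t * F y) (t * M) := by
  intro z
  obtain ⟨c, h1, h2⟩ := h z
  refine ⟨t • c, fun α => ?_, fun y => ?_⟩
  · rw [Pi.smul_apply, smul_eq_mul, abs_mul, abs_of_nonneg ht]
    exact mul_le_mul_of_nonneg_left (h1 α) ht
  · rw [pl_smul, ← mul_sub, abs_mul, abs_of_nonneg ht, mul_assoc]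
    exact mul_le_mul_of_nonneg_left (h2 y) ht

lemma first_step (hm : 0 < m) (hn : 0 < n) : ∃ C : ℝ, 1 ≤ C ∧ ∀ (S : Set (Euc n)) (f : Euc n → ℝ) (M₀ : ℝ)
    (P : Euc n → MPoly n), S.Finite → 0 < M₀ → (∀ x ∈ S, P x ∈ GammaF' m n f x M₀) →
    (∀ x ∈ S, ∀ y ∈ S, ∀ β : Fin n → ℕ, deg β ≤ m - 1 →
      |mD β (peval (P x - P y)) x| ≤ M₀ * ‖x - y‖ ^ (m - deg β)) →
    ∃ F : Euc n → ℝ, (∀ y, 0 ≤ F y) ∧ Good m F (C * M₀) ∧ ∀ y ∈ S, F y = f y := by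
  obtain ⟨Cg, hCg, hGT⟩ := GT (m := m) (n := n) hm hn 2 (by norm_num)
  have hDD := DD_nonneg (m := m) (n := n)
  have hCT := one_le_CTm (m := m) (n := n)
  have hCTn : 0 ≤ CTm m n * n := by positivity
  obtain ⟨K, hK⟩ : ∃ K, K = CTm m n * n + 1 + DD m n := ⟨_, rfl⟩
  have hK1 : 1 ≤ K := by linarith
  refine ⟨Cg * K, one_le_mul_of_one_le_of_one_le hCg hK1, fun S f M₀ P hS hM₀ hP hcomp => ?_⟩
  rcases S.eq_empty_or_nonempty with hSe | hSne
  · refine ⟨fun _ => 0, fun _ => le_rfl, fun z => ⟨0, fun α => ?_, fun y => ?_⟩, by simp [hSe]⟩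
    · simp; positivity
    · rw [pl_zero, sub_zero, abs_zero]; positivity
  have hex : ∀ z, ∃ p : V m n, z ∈ S → peval (P z) = pl p := by
    intro z
    by_cases hz : z ∈ S
    · obtain ⟨⟨F, h1, h2, h3⟩, h4⟩ := hP z hz
      obtain ⟨p, hp⟩ := exists_coef hm (P z) h3.1
      exact ⟨p, fun _ => hp⟩
    · exact ⟨0, fun h => absurd h hz⟩
  choose p hp using hex
  choose τ hτ0 hτ1 hτ2 using fun z => isolate hS z one_pos
  have hMK : K * M₀ = CTm m n * n * M₀ + M₀ + DD m n * M₀ := by rw [hK]; ring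
  have a1 : 0 ≤ CTm m n * n * M₀ := by positivity
  have a2 : 0 ≤ DD m n * M₀ := by positivity
  obtain ⟨F, h1, h2, h3, -⟩ := hGT S f τ p (K * M₀) (by positivity) hS hSne (fun z _ => hτ0 z) (by
    intro z hz s hs
    obtain ⟨⟨F, h1, h2, h3⟩, h4⟩ := hP z hz
    have hsh : sh z (p z) = tc m F z := by
      funext α
      have hα := α.2
      have e1 := h3.2 α.1 (by omega)
      rw [hp z hz, mD_pl] at e1
      unfold tc
      rw [← e1, mul_div_cancel_left₀ _ (mf_pos α.1).ne']
    refine ⟨F, h2, fun x => ⟨tc m F x, fun α => (tc_le h1 x α).trans (by linarith), fun y => ?_⟩,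
      ⟨p z, ⟨fun α => ?_, fun y => ?_⟩, ?_⟩, fun hle e he hlt => ?_⟩
    · refine (T1 hm h1 x y).trans ?_
      exact mul_le_mul_of_nonneg_right (by linarith) (by positivity)
    · rw [hsh]; exact (tc_le h1 z α).trans (by linarith)
    · rw [hsh]
      refine (T1 hm h1 z y).trans ?_
      exact mul_le_mul_of_nonneg_right (by linarith) (by positivity)
    · rw [sub_self, map_zero, nm_zero]; positivity
    · rw [hτ2 z e he (by linarith)]
      have h5 := T1 hm h1 z z
      rw [← hsh, pl_sh_sub, sub_self, norm_zero, zero_pow hm.ne', mul_zero] at h5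
      have h6 := abs_nonpos_iff.1 h5
      rw [← h4, hp z hz]; linarith) (by
    intro z hz y hy s hs hzy hτ
    have h5 : nm s (sh y (p z - p y)) ≤ DD m n * M₀ := by
      refine nm_le_of_coef hs _ fun α => ?_
      have hα := α.2
      have h6 := hcomp y hy z hz α.1 (by omega)
      have e : peval (P y - P z) = pl (p y - p z) := by
        rw [peval_sub, hp y hy, hp z hz]; funext x; rw [pl_sub]
      rw [e, mD_pl, abs_mul, abs_of_pos (mf_pos α.1)] at h6
      have e2 : |sh y (p z - p y) α| = |sh y (p y - p z) α| := by
        rw [← neg_sub (p y) (p z), map_neg, Pi.neg_apply, abs_neg]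
      rw [e2]
      calc _ ≤ mf α.1 * |sh y (p y - p z) α| := le_mul_of_one_le_left (abs_nonneg _) (one_le_mf _)
        _ ≤ _ := h6
        _ ≤ _ := by rw [norm_sub_rev y z]; gcongr
    linarith)
  exact ⟨F, h1, by rw [mul_assoc]; exact h2, h3⟩

end FP

/-- **Lemma 4.3**: finiteness principle for nonnegative `C^{m-1,1}` interpolation,
finite `E`, jet form. -/
theorem fp_nonneg_Cm11_jets_finite (m n : ℕ) (hm : 0 < m) (hn : 0 < n) :
    ∃ (kSharp : ℕ) (C : ℝ), 0 < C ∧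
      ∀ (E : Set (Euc n)), E.Finite → ∀ f : Euc n → ℝ, (∀ x ∈ E, 0 ≤ f x) →
        ∀ M₀ : ℝ, 0 < M₀ →
        (∀ S : Set (Euc n), S ⊆ E → S.ncard ≤ kSharp →
          ∃ P : Euc n → MPoly n,
            (∀ x ∈ S, P x ∈ GammaF' m n f x M₀) ∧
            (∀ x ∈ S, ∀ y ∈ S, ∀ β : Fin n → ℕ, deg β ≤ m - 1 →
              |mD β (peval (P x - P y)) x| ≤ M₀ * ‖x - y‖ ^ (m - deg β))) →
        ∃ F : Euc n → ℝ, CmLipNormLe m n F (C * M₀) ∧ (∀ y, 0 ≤ F y) ∧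
          ∀ x ∈ E, F x = f x := by
  obtain ⟨C1, hC1, hfs⟩ := FP.first_step hm hn
  obtain ⟨k, ε, C', hε, hε1, hC', hML⟩ := FP.main_lemma hm hn ∅ (fun α hα => by simp at hα) C1 hC1
  have hCL := FP.one_le_CL (m := m) (n := n)
  refine ⟨FP.hN m n * k, m.factorial * FP.CL m n * C', by positivity, ?_⟩
  intro E hE f hf M₀ hM₀ hyp
  obtain ⟨p, hp⟩ := FP.helly_core (m := m) (k := k) (M := C1) (f := fun y => M₀⁻¹ * f y) hE (fun _ => True)
    (fun _ _ _ _ _ _ _ _ _ => trivial) (fun S hS hc => by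
      obtain ⟨P, hP1, hP2⟩ := hyp S hS (by rw [Set.ncard_coe_finset]; exact hc)
      obtain ⟨F, h1, h2, h3⟩ := hfs S f M₀ P S.finite_toSet hM₀ hP1 hP2
      refine ⟨fun y => M₀⁻¹ * F y, fun y => mul_nonneg (by positivity) (h1 y), ?_, fun y hy => by
        show M₀⁻¹ * F y = M₀⁻¹ * f y
        rw [h3 y hy], trivial⟩
      have := FP.Good.scale h2 (t := M₀⁻¹) (by positivity)
      rwa [show M₀⁻¹ * (C1 * M₀) = C1 by field_simp] at this) 0
  obtain ⟨R, hR⟩ := hE.isBounded.exists_norm_le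
  have hδ0 : 0 < (|R| + 1) / ε := by positivity
  obtain ⟨F, h1, h2, h3, -⟩ := hML E (fun y => M₀⁻¹ * f y) 0 ((|R| + 1) / ε) p hE hδ0 (fun e he => by
      rw [sub_zero, mul_div_cancel₀ _ hε.ne']
      linarith [hR e he, le_abs_self R]) ⟨(FP.GN_nrm hδ0).2 (fun S hS hc => by
        obtain ⟨F, a1, a2, a3, -, a4⟩ := hp S hS hc
        exact ⟨F, a1, a2, a3, a4⟩), by simp⟩
  refine ⟨fun y => M₀ * F y, ?_, fun y => mul_nonneg hM₀.le (h1 y), fun x hx => ?_⟩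
  · have := FP.T2 hm (by positivity) (FP.Good.scale h2 hM₀.le)
    rwa [show (m.factorial : ℝ) * FP.CL m n * (M₀ * C') = m.factorial * FP.CL m n * C' * M₀ by ring] at this
  · show M₀ * F x = f x
    rw [h3 x hx]; field_simp

end
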